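/- Every group automorphism of the plane Cremona group is inner up to a field automorphism of ℂ: for every group automorphism Φ of Bir(ℙ²_ℂ) = Aut_ℂ(ℂ(x,y)) there exists a ring automorphism θ of the field ℂ(x,y) mapping the subfield ℂ onto itself such that Φ(f) = θ ∘ f ∘ θ⁻¹ for every f ∈ Aut_ℂ(ℂ(x,y)). (Writing θ = κ̃ ∘ ψ, with ψ ∈ Bir(ℙ²_ℂ) and κ̃ the extension to ℂ(x,y) of a field automorphism κ of ℂ fixing x and y, recovers the form Φ(f) = ᵏ(ψ ∘ f ∘ ψ⁻¹).) -/

import Mathlib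

set_option autoImplicit false

noncomputable section

/-- The field `ℂ(x,y)` of rational functions in two variables over `ℂ`. -/
abbrev K2 : Type := FractionRing (MvPolynomial (Fin 2) ℂ)

/-- The plane Cremona group `Bir(ℙ²_ℂ)`, identified with the group `Aut_ℂ(ℂ(x,y))`
of `ℂ`-algebra automorphisms of `ℂ(x,y)`. -/
abbrev Cremona2 : Type := K2 ≃ₐ[ℂ] K2

/-- The coordinate function `x`. -/
def X0 : K2 := algebraMap (MvPolynomial (Fin 2) ℂ) K2 (MvPolynomial.X 0)

/-- The coordinate function `y`. -/
def X1 : K2 := algebraMap (MvPolynomial (Fin 2) ℂ) K2 (MvPolynomial.X 1)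

theorem mem_range_of_isAlgebraic_of_mem_adjoin {F E ι : Type*} [Field F] [Field E] [Algebra F E]
    {v : ι → E} (hv : AlgebraicIndependent F v) {z : E}
    (hz : z ∈ IntermediateField.adjoin F (Set.range v)) (hza : IsAlgebraic F z) :
    z ∈ Set.range (algebraMap F E) := by
  rw [IntermediateField.mem_adjoin_range_iff] at hz
  obtain ⟨r, s, rfl⟩ := hz
  by_cases hs : MvPolynomial.aeval v s = 0
  · exact ⟨0, by simp [hs]⟩
  have hv' := hv.algebraicClosure
  set z : E := MvPolynomial.aeval v r / MvPolynomial.aeval v s with hzdef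
  let z' : algebraicClosure F E := ⟨z, mem_algebraicClosure_iff.2 hza⟩
  let φ := algebraMap F (algebraicClosure F E)
  have key : MvPolynomial.map φ r = MvPolynomial.C z' * MvPolynomial.map φ s := by
    apply hv'
    have h1 : ∀ q : MvPolynomial ι F, MvPolynomial.aeval v (MvPolynomial.map φ q)
        = MvPolynomial.aeval v q := fun q => by
      rw [MvPolynomial.aeval_map_algebraMap]
    rw [map_mul, h1, h1, MvPolynomial.aeval_C]
    have : algebraMap (algebraicClosure F E) E z' = z := rfl
    rw [this, hzdef, div_mul_cancel₀ _ hs]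
  have hs0 : s ≠ 0 := by rintro rfl; simp at hs
  obtain ⟨m, hm⟩ := MvPolynomial.ne_zero_iff.1 hs0
  have hc := congrArg (MvPolynomial.coeff m) key
  rw [MvPolynomial.coeff_map, MvPolynomial.coeff_C_mul, MvPolynomial.coeff_map] at hc
  refine ⟨r.coeff m / s.coeff m, ?_⟩
  have hc' := congrArg (algebraMap (algebraicClosure F E) E) hc
  rw [map_mul] at hc'
  have h2 : ∀ c : F, algebraMap (algebraicClosure F E) E (φ c) = algebraMap F E c := fun c => rfl
  rw [h2, h2] at hc'
  have h3 : algebraMap (algebraicClosure F E) E z' = z := rfl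
  rw [map_div₀, hc', h3, mul_div_cancel_right₀]
  simpa using hm

theorem exists_automorphism_ne {F : Subfield ℂ} {ξ : ℂ} (hξ : ξ ∉ F) (ha : IsAlgebraic F ξ) :
    ∃ κ : ℂ ≃+* ℂ, (∀ c ∈ F, κ c = c) ∧ κ ξ ≠ ξ := by
  obtain ⟨s, hs⟩ := exists_isTranscendenceBasis F ℂ
  let E := IntermediateField.adjoin F (Set.range ((↑) : s → ℂ))
  have : Algebra.IsAlgebraic E ℂ := hs.isAlgebraic_field
  have hE : ξ ∉ E := fun h => by
    obtain ⟨c, hc⟩ := mem_range_of_isAlgebraic_of_mem_adjoin hs.1 h ha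
    exact hξ (hc ▸ c.2)
  have : IsAlgClosure E ℂ := ⟨inferInstance, this⟩
  have : IsGalois E ℂ := {}
  by_contra! hcon
  apply hE
  have := (InfiniteGalois.mem_bot_iff_fixed (k := E) ξ).2 fun f => hcon f.toRingEquiv (fun c hc =>
    f.commutes ⟨c, IntermediateField.algebraMap_mem E ⟨c, hc⟩⟩)
  obtain ⟨c, hc⟩ := IntermediateField.mem_bot.1 this
  exact hc ▸ c.2

open KaehlerDifferential in
theorem exists_derivation_ne_zero {k : Subfield ℂ} {ξ : ℂ} (hξ : Transcendental k ξ) :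
    ∃ δ : Derivation ℤ ℂ ℂ, (∀ c ∈ k, δ c = 0) ∧ δ ξ ≠ 0 := by
  classical
  have hi : AlgebraicIndepOn k id ({ξ} : Set ℂ) := by
    have := (algebraicIndependent_singleton_iff (R := k) (x := ((↑) : ({ξ} : Set ℂ) → ℂ))
      ⟨ξ, rfl⟩).2 hξ
    exact this
  obtain ⟨s, hs, hs'⟩ := exists_isTranscendenceBasis_superset hi
  let S := MvPolynomial s k
  let _ : Algebra S ℂ := (MvPolynomial.aeval ((↑) : s → ℂ) : S →ₐ[k] ℂ).toRingHom.toAlgebra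
  have hmap : ∀ q : S, algebraMap S ℂ q = MvPolynomial.aeval ((↑) : s → ℂ) q := fun _ => rfl
  have : IsScalarTower k S ℂ := IsScalarTower.of_algebraMap_eq fun c => by
    rw [hmap]; exact (AlgHom.commutes _ c).symm
  have hinj : Function.Injective (algebraMap S ℂ) := hs'.1
  have : FaithfulSMul S ℂ := (faithfulSMul_iff_algebraMap_injective S ℂ).2 hinj
  let _ : Algebra (FractionRing S) ℂ := FractionRing.liftAlgebra S ℂ
  have : Algebra.IsAlgebraic (FractionRing S) ℂ := by
    have h1 := hs'.isAlgebraic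
    have h2 : Algebra.IsAlgebraic S ℂ := by
      refine Algebra.IsAlgebraic.of_ringHom_of_comp_eq (S := Algebra.adjoin k
        (Set.range ((↑) : s → ℂ))) (B := ℂ) hs'.1.aevalEquiv.toRingEquiv (RingHom.id ℂ)
        hs'.1.aevalEquiv.surjective Function.injective_id ?_
      ext x
      · rfl
      · exact (hs'.1.algebraMap_aevalEquiv (MvPolynomial.X x)).trans (hmap _).symm
    exact (IsFractionRing.comap_isAlgebraic_iff (A := S) (K := FractionRing S)).1 h2
  have : Algebra.FormallyEtale S (FractionRing S) :=
    Algebra.FormallyEtale.of_isLocalization (nonZeroDivisors S)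
  have : Algebra.FormallyEtale (FractionRing S) ℂ := Algebra.FormallyEtale.of_isSeparable _ _
  have : Algebra.FormallyEtale S ℂ := Algebra.FormallyEtale.comp S (FractionRing S) ℂ
  let d : Derivation k S ℂ :=
    MvPolynomial.mkDerivation k (fun i : s => if i = ⟨ξ, hs rfl⟩ then (1 : ℂ) else 0)
  let l : Ω[ℂ⁄k] →ₗ[ℂ] ℂ := (d.liftKaehlerDifferential.liftBaseChange ℂ) ∘ₗ
    (tensorKaehlerEquivOfFormallyEtale k S ℂ).symm.toLinearMap
  let δ : Derivation k ℂ ℂ := l.compDer (D k ℂ)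
  refine ⟨δ.restrictScalars ℤ, fun c hc => δ.map_algebraMap ⟨c, hc⟩, ?_⟩
  have h3 : ξ = algebraMap S ℂ (MvPolynomial.X ⟨ξ, hs rfl⟩) := by simp [hmap]
  have h4 : δ ξ = 1 := by
    change l (D k ℂ ξ) = 1
    rw [h3]
    change (d.liftKaehlerDifferential.liftBaseChange ℂ)
      ((tensorKaehlerEquivOfFormallyEtale k S ℂ).symm _) = 1
    rw [tensorKaehlerEquivOfFormallyEtale_symm_D_algebraMap]
    simp only [LinearMap.liftBaseChange_tmul, one_smul, Derivation.liftKaehlerDifferential_comp_D]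
    exact (MvPolynomial.mkDerivation_X k _ _).trans (if_pos rfl)
  change δ ξ ≠ 0
  rw [h4]
  exact one_ne_zero

section Coordinates

variable {K : Type*} [Field K] [Algebra ℂ K]

/-- `x` and `y` are algebraically independent over `ℂ` and generate the field `K`. -/
structure IsCoord (x y : K) : Prop where
  indep : AlgebraicIndependent ℂ ![x, y]
  gen : IntermediateField.adjoin ℂ {x, y} = ⊤

theorem range_pair {α : Type*} (x y : α) : Set.range ![x, y] = {x, y} := by
  simp [Set.pair_comm]

theorem ringHom_eq_of_mem_adjoin {L : Type*} [Field L] {x y z : K}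
    (hz : z ∈ IntermediateField.adjoin ℂ {x, y}) {f g : K →+* L}
    (h : ∀ c, f (algebraMap ℂ K c) = g (algebraMap ℂ K c)) (hx : f x = g x) (hy : f y = g y) :
    f z = g z := by
  induction hz using IntermediateField.adjoin_induction with
  | mem t ht => rcases ht with rfl | rfl <;> assumption
  | algebraMap c => exact h c
  | add a b _ _ ha hb => simp [ha, hb]
  | inv a _ ha => simp [ha]
  | mul a b _ _ ha hb => simp [ha, hb]

theorem derivation_eq_of_mem_adjoin {x y z : K}
    (hz : z ∈ IntermediateField.adjoin ℂ {x, y}) {f g : Derivation ℤ K K}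
    (h : ∀ c, f (algebraMap ℂ K c) = g (algebraMap ℂ K c)) (hx : f x = g x) (hy : f y = g y) :
    f z = g z := by
  induction hz using IntermediateField.adjoin_induction with
  | mem t ht => rcases ht with rfl | rfl <;> assumption
  | algebraMap c => exact h c
  | add a b _ _ ha hb => simp [ha, hb]
  | inv a _ ha => simp [ha, Derivation.leibniz_inv]
  | mul a b _ _ ha hb => simp [ha, hb]

namespace IsCoord

variable {x y : K} (h : IsCoord x y)
include h

theorem mem_adjoin (z : K) : z ∈ IntermediateField.adjoin ℂ {x, y} := h.gen ▸ trivial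

theorem ringHom_ext {L : Type*} [Field L] {f g : K →+* L}
    (hc : ∀ c, f (algebraMap ℂ K c) = g (algebraMap ℂ K c)) (hx : f x = g x) (hy : f y = g y) :
    f = g :=
  RingHom.ext fun z => ringHom_eq_of_mem_adjoin (h.mem_adjoin z) hc hx hy

theorem algEquiv_ext {f g : K ≃ₐ[ℂ] K} (hx : f x = g x) (hy : f y = g y) : f = g :=
  AlgEquiv.ext fun z => ringHom_eq_of_mem_adjoin (f := f.toRingEquiv.toRingHom)
    (g := g.toRingEquiv.toRingHom) (h.mem_adjoin z) (fun c => by simp) hx hy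

theorem derivation_ext {f g : Derivation ℤ K K}
    (hc : ∀ c, f (algebraMap ℂ K c) = g (algebraMap ℂ K c)) (hx : f x = g x) (hy : f y = g y) :
    f = g :=
  Derivation.ext fun z => derivation_eq_of_mem_adjoin (h.mem_adjoin z) hc hx hy

theorem exists_eq_div (z : K) : ∃ r s : MvPolynomial (Fin 2) ℂ,
    z = MvPolynomial.aeval ![x, y] r / MvPolynomial.aeval ![x, y] s := by
  have := h.mem_adjoin z
  rwa [← range_pair, IntermediateField.mem_adjoin_range_iff] at this

theorem exists_eq_div' (z : K) : ∃ r s : MvPolynomial (Fin 2) ℂ, s ≠ 0 ∧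
    z * MvPolynomial.aeval ![x, y] s = MvPolynomial.aeval ![x, y] r := by
  obtain ⟨r, s, rfl⟩ := h.exists_eq_div z
  by_cases hs : MvPolynomial.aeval ![x, y] s = 0
  · exact ⟨0, 1, one_ne_zero, by simp [hs]⟩
  · exact ⟨r, s, by rintro rfl; simp at hs, div_mul_cancel₀ _ hs⟩

theorem isFractionRing :
    letI := (MvPolynomial.aeval ![x, y] : MvPolynomial (Fin 2) ℂ →ₐ[ℂ] K).toRingHom.toAlgebra
    IsFractionRing (MvPolynomial (Fin 2) ℂ) K := by
  let _ := (MvPolynomial.aeval ![x, y] : MvPolynomial (Fin 2) ℂ →ₐ[ℂ] K).toRingHom.toAlgebra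
  refine ⟨?_, ?_, ?_⟩
  · intro s
    have : MvPolynomial.aeval ![x, y] (s : MvPolynomial (Fin 2) ℂ) ≠ 0 := fun h0 =>
      nonZeroDivisors.coe_ne_zero s (h.indep (h0.trans (map_zero _).symm))
    exact isUnit_iff_ne_zero.2 this
  · intro z
    obtain ⟨r, s, hs, e⟩ := h.exists_eq_div' z
    exact ⟨(r, ⟨s, mem_nonZeroDivisors_of_ne_zero hs⟩), e⟩
  · intro a b hab
    exact ⟨1, by rw [h.indep hab]⟩

/-- The universal property of a field of rational functions. -/
theorem exists_ringHom {L : Type*} [CommRing L] (φ : ℂ →+* L) (p q : L)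
    (hu : ∀ s : MvPolynomial (Fin 2) ℂ, s ≠ 0 → IsUnit (MvPolynomial.eval₂Hom φ ![p, q] s)) :
    ∃ ψ : K →+* L, (∀ c, ψ (algebraMap ℂ K c) = φ c) ∧ ψ x = p ∧ ψ y = q := by
  let _ := (MvPolynomial.aeval ![x, y] : MvPolynomial (Fin 2) ℂ →ₐ[ℂ] K).toRingHom.toAlgebra
  have := h.isFractionRing
  have hm : ∀ s, algebraMap (MvPolynomial (Fin 2) ℂ) K s = MvPolynomial.aeval ![x, y] s :=
    fun _ => rfl
  have hu' : ∀ s : nonZeroDivisors (MvPolynomial (Fin 2) ℂ),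
    IsUnit (MvPolynomial.eval₂Hom φ ![p, q] s) := fun s => hu s (nonZeroDivisors.coe_ne_zero s)
  have e : ∀ s, IsLocalization.lift hu' (MvPolynomial.aeval ![x, y] s : K)
    = MvPolynomial.eval₂Hom φ ![p, q] s := fun s => IsLocalization.lift_eq hu' s
  refine ⟨IsLocalization.lift hu', fun c => ?_, ?_, ?_⟩
  · simpa using e (MvPolynomial.C c)
  · simpa using e (MvPolynomial.X 0)
  · simpa using e (MvPolynomial.X 1)

theorem exists_derivation (δ : Derivation ℤ ℂ ℂ) (a b : K) :
    ∃ D : Derivation ℤ K K, (∀ c, D (algebraMap ℂ K c) = algebraMap ℂ K (δ c)) ∧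
      D x = a ∧ D y = b := by
  let φ : ℂ →+* TrivSqZeroExt K K :=
    { toFun := fun c => TrivSqZeroExt.inl (algebraMap ℂ K c) +
        TrivSqZeroExt.inr (algebraMap ℂ K (δ c))
      map_one' := by ext <;> simp
      map_mul' := fun c d => by
        ext
        · simp
        · simp
          simp only [Algebra.smul_def]
          ring
      map_zero' := by ext <;> simp
      map_add' := fun c d => by ext <;> simp [Algebra.smul_def] }
  let p : TrivSqZeroExt K K := TrivSqZeroExt.inl x + TrivSqZeroExt.inr a
  let q : TrivSqZeroExt K K := TrivSqZeroExt.inl y + TrivSqZeroExt.inr b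
  have hfst : ∀ s : MvPolynomial (Fin 2) ℂ,
      (MvPolynomial.eval₂Hom φ ![p, q] s).fst = MvPolynomial.aeval ![x, y] s := by
    intro s
    have : ((TrivSqZeroExt.fstHom ℂ K K).toRingHom.comp (MvPolynomial.eval₂Hom φ ![p, q]))
        = (MvPolynomial.aeval ![x, y] : MvPolynomial (Fin 2) ℂ →ₐ[ℂ] K).toRingHom := by
      apply MvPolynomial.ringHom_ext
      · intro c; simp [φ]
      · intro i; fin_cases i <;> simp [p, q]
    exact RingHom.congr_fun this s
  obtain ⟨ψ, h1, h2, h3⟩ := h.exists_ringHom φ p q fun s hs => by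
    rw [TrivSqZeroExt.isUnit_iff_isUnit_fst, hfst, isUnit_iff_ne_zero]
    exact fun h0 => hs (h.indep (h0.trans (map_zero _).symm))
  have hid : ∀ z, (ψ z).fst = z := by
    intro z
    have := h.ringHom_ext (f := (TrivSqZeroExt.fstHom ℂ K K).toRingHom.comp ψ)
      (g := RingHom.id K) (fun c => by simp [h1, φ]) (by simp [h2, p]) (by simp [h3, q])
    exact RingHom.congr_fun this z
  let D₀ : K →+ K :=
    { toFun := fun z => (ψ z).snd
      map_zero' := by simp
      map_add' := by simp }
  refine ⟨Derivation.mk' D₀.toIntLinearMap fun u v => ?_, fun c => ?_, ?_, ?_⟩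
  · simp [D₀, hid, mul_comm]
  · change (ψ _).snd = _
    rw [h1]
    simp [φ, Algebra.smul_def]
    rfl
  · change (ψ _).snd = _
    simp [h2, p]
  · change (ψ _).snd = _
    simp [h3, q]

theorem exists_ringEquiv {p q : K} (h' : IsCoord p q) (κ : ℂ ≃+* ℂ) :
    ∃ θ : K ≃+* K, (∀ c, θ (algebraMap ℂ K c) = algebraMap ℂ K (κ c)) ∧ θ x = p ∧ θ y = q := by
  have key : ∀ {x y p q : K}, IsCoord x y → IsCoord p q → ∀ κ : ℂ ≃+* ℂ, ∃ θ : K →+* K,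
      (∀ c, θ (algebraMap ℂ K c) = algebraMap ℂ K (κ c)) ∧ θ x = p ∧ θ y = q := by
    intro x y p q h h' κ
    refine h.exists_ringHom ((algebraMap ℂ K).comp κ) p q fun s hs => ?_
    rw [isUnit_iff_ne_zero, MvPolynomial.coe_eval₂Hom, ← MvPolynomial.eval₂_map]
    intro h0
    have h1 : MvPolynomial.map (κ : ℂ →+* ℂ) s = 0 := h'.indep (h0.trans (map_zero _).symm)
    exact hs (MvPolynomial.map_injective _ κ.injective (h1.trans (map_zero _).symm))
  obtain ⟨θ, a1, a2, a3⟩ := key h h' κ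
  obtain ⟨η, b1, b2, b3⟩ := key h' h κ.symm
  refine ⟨RingEquiv.ofRingHom θ η ?_ ?_, a1, a2, a3⟩
  · exact h'.ringHom_ext (fun c => by simp [a1, b1]) (by simp [b2, a2]) (by simp [b3, a3])
  · exact h.ringHom_ext (fun c => by simp [a1, b1]) (by simp [b2, a2]) (by simp [b3, a3])

theorem exists_algEquiv {p q : K} (h' : IsCoord p q) : ∃ f : K ≃ₐ[ℂ] K, f x = p ∧ f y = q := by
  obtain ⟨θ, h1, h2, h3⟩ := h.exists_ringEquiv h' (RingEquiv.refl ℂ)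
  exact ⟨AlgEquiv.ofRingEquiv (f := θ) h1, h2, h3⟩

theorem of_mem {p q : K} (hx : x ∈ IntermediateField.adjoin ℂ {p, q})
    (hy : y ∈ IntermediateField.adjoin ℂ {p, q}) : IsCoord p q := by
  have hg : IntermediateField.adjoin ℂ {p, q} = ⊤ := by
    rw [eq_top_iff, ← h.gen, IntermediateField.adjoin_le_iff]
    rintro _ (rfl | rfl) <;> assumption
  have h1 : IsTranscendenceBasis ℂ ![x, y] := by
    rw [h.indep.isTranscendenceBasis_iff_isAlgebraic,
      ← IntermediateField.isAlgebraic_adjoin_iff_top, range_pair, h.gen]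
    exact ⟨fun z => isAlgebraic_algebraMap (⟨z, trivial⟩ : (⊤ : IntermediateField ℂ K))⟩
  have : Algebra.IsAlgebraic (Algebra.adjoin ℂ (Set.range ![p, q])) K := by
    rw [← IntermediateField.isAlgebraic_adjoin_iff_top, range_pair, hg]
    exact ⟨fun z => isAlgebraic_algebraMap (⟨z, trivial⟩ : (⊤ : IntermediateField ℂ K))⟩
  have h2 := Algebra.IsAlgebraic.isTranscendenceBasis_of_lift_le_trdeg_of_finite (R := ℂ) ![p, q]
    (by rw [← h1.lift_cardinalMk_eq_trdeg])
  exact ⟨h2.1, hg⟩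

theorem map (f : K ≃ₐ[ℂ] K) : IsCoord (f x) (f y) := by
  have key : ∀ z, f z ∈ IntermediateField.adjoin ℂ {f x, f y} := by
    intro z
    have hz := h.mem_adjoin z
    induction hz using IntermediateField.adjoin_induction with
    | mem t ht =>
      rcases ht with rfl | rfl
      · exact IntermediateField.subset_adjoin _ _ (by simp)
      · exact IntermediateField.subset_adjoin _ _ (by simp)
    | algebraMap c => rw [f.commutes]; exact IntermediateField.algebraMap_mem _ c
    | add a b _ _ ha hb => simpa using add_mem ha hb
    | inv a _ ha => simpa using inv_mem ha
    | mul a b _ _ ha hb => simpa using mul_mem ha hb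
  exact h.of_mem (by simpa using key (f.symm x)) (by simpa using key (f.symm y))

end IsCoord

end Coordinates

section OneVariable

open Polynomial

variable {F E : Type*} [Field F] [Field E] [Algebra F E]

theorem exists_coprime_fraction {t z : E} (hz : z ∈ IntermediateField.adjoin F {t}) :
    ∃ P Q : F[X], IsCoprime P Q ∧ Q.Monic ∧ aeval t Q ≠ 0 ∧ z * aeval t Q = aeval t P := by
  classical
  obtain ⟨r, s, e⟩ := (IntermediateField.mem_adjoin_simple_iff F z).1 hz
  by_cases hs : aeval t s = 0
  · exact ⟨0, 1, isCoprime_one_right, monic_one, by simp, by simp [e, hs]⟩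
  have hs0 : s ≠ 0 := by rintro rfl; simp at hs
  set g := EuclideanDomain.gcd r s
  obtain ⟨r', hr⟩ : g ∣ r := EuclideanDomain.gcd_dvd_left r s
  obtain ⟨s', hs'⟩ : g ∣ s := EuclideanDomain.gcd_dvd_right r s
  have hg : g ≠ 0 := by rintro h; rw [h, zero_mul] at hs'; exact hs0 hs'
  have hs'0 : s' ≠ 0 := by rintro rfl; rw [mul_zero] at hs'; exact hs0 hs'
  have hc : IsCoprime r' s' := by
    refine ⟨EuclideanDomain.gcdA r s, EuclideanDomain.gcdB r s, mul_left_cancel₀ hg ?_⟩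
    have := EuclideanDomain.gcd_eq_gcd_ab r s
    calc g * (EuclideanDomain.gcdA r s * r' + EuclideanDomain.gcdB r s * s')
        = (g * r') * EuclideanDomain.gcdA r s + (g * s') * EuclideanDomain.gcdB r s := by ring
      _ = g * 1 := by rw [← hr, ← hs', ← this, mul_one]
  have hlc : s'.leadingCoeff⁻¹ ≠ 0 := inv_ne_zero (leadingCoeff_ne_zero.2 hs'0)
  have hu : IsUnit (C s'.leadingCoeff⁻¹) := isUnit_C.2 hlc.isUnit
  have hg0 : aeval t g ≠ 0 := fun h => hs (by rw [hs', map_mul, h, zero_mul])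
  have hs0' : aeval t s' ≠ 0 := fun h => hs (by rw [hs', map_mul, h, mul_zero])
  have hl : algebraMap F E s'.leadingCoeff⁻¹ ≠ 0 := by simpa using hs'0
  refine ⟨C s'.leadingCoeff⁻¹ * r', C s'.leadingCoeff⁻¹ * s', ?_, ?_, ?_, ?_⟩
  · exact (isCoprime_mul_unit_left hu _ _).2 hc
  · rw [mul_comm]; exact monic_mul_leadingCoeff_inv hs'0
  · rw [map_mul, aeval_C]
    exact mul_ne_zero hl hs0'
  · rw [e, map_mul, map_mul, hr, hs', map_mul, map_mul, mul_div_mul_left _ _ hg0]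
    field_simp

theorem mem_closure_of_fraction {t z : E} {P Q : F[X]} (hQ : aeval t Q ≠ 0)
    (h : z * aeval t Q = aeval t P) (L : Subfield E) (ht : t ∈ L)
    (hP : ∀ n, algebraMap F E (P.coeff n) ∈ L) (hQ' : ∀ n, algebraMap F E (Q.coeff n) ∈ L) :
    z ∈ L := by
  have key : ∀ R : F[X], (∀ n, algebraMap F E (R.coeff n) ∈ L) → aeval t R ∈ L := by
    intro R hR
    rw [aeval_eq_sum_range]
    exact sum_mem fun i _ => by
      rw [Algebra.smul_def]
      exact mul_mem (hR i) (pow_mem ht i)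
  rw [eq_div_of_mul_eq hQ h]
  exact div_mem (key P hP) (key Q hQ')

theorem degree_lt_of_coeff {Q R : F[X]} (hQ : Q.Monic) (h1 : R.coeff Q.natDegree = 0)
    (h : ∀ n, Q.coeff n = 0 → R.coeff n = 0) : R.degree < Q.degree := by
  rw [degree_eq_natDegree hQ.ne_zero, degree_lt_iff_coeff_zero]
  intro m hm
  rcases hm.eq_or_lt with rfl | hm
  · exact h1
  · exact h m (coeff_eq_zero_of_natDegree_lt hm)

theorem eq_zero_of_dvd_of_lt {Q R : F[X]} (h : Q ∣ R) (hd : R.degree < Q.degree) : R = 0 :=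
  eq_zero_of_dvd_of_degree_lt h hd

theorem coeff_derivation_eq_zero {t z : E} (ht : Transcendental F t) {P Q : F[X]}
    (hc : IsCoprime P Q) (hQ : Q.Monic) (h : z * aeval t Q = aeval t P)
    (D : Derivation ℤ E E) (hDt : D t = 0) (hDz : D z = 0)
    (hD : ∀ c : F, ∃ d : F, D (algebraMap F E c) = algebraMap F E d) (n : ℕ) :
    D (algebraMap F E (P.coeff n)) = 0 ∧ D (algebraMap F E (Q.coeff n)) = 0 := by
  choose d hd using hD
  have hinj := (algebraMap F E).injective
  have hd0 : d 0 = 0 := hinj (by rw [← hd]; simp)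
  have hd1 : d 1 = 0 := hinj (by rw [← hd]; simp)
  have key : ∀ R : F[X], ∃ R' : F[X], (∀ n, R'.coeff n = d (R.coeff n)) ∧
      D (aeval t R) = aeval t R' := by
    intro R
    refine ⟨∑ i ∈ Finset.range (R.natDegree + 1), monomial i (d (R.coeff i)), ?_, ?_⟩
    · intro n
      rw [finsetSum_coeff]
      simp only [coeff_monomial, Finset.sum_ite_eq', Finset.mem_range]
      split_ifs with hn
      · rfl
      · rw [coeff_eq_zero_of_natDegree_lt (by omega), hd0]
    · rw [aeval_eq_sum_range]
      rw [map_sum, map_sum]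
      refine Finset.sum_congr rfl fun i _ => ?_
      rw [aeval_monomial, Algebra.smul_def, Derivation.leibniz, hd, Derivation.leibniz_pow, hDt]
      simp [mul_comm]
  obtain ⟨P', hP', eP⟩ := key P
  obtain ⟨Q', hQ', eQ⟩ := key Q
  have e1 : z * aeval t Q' = aeval t P' := by
    have := congrArg D h
    rwa [Derivation.leibniz, hDz, smul_zero, add_zero, eP, eQ, smul_eq_mul] at this
  have inj : Function.Injective (aeval (R := F) t) := transcendental_iff_injective.1 ht
  have e2 : P * Q' = Q * P' := inj (by rw [map_mul, map_mul, ← e1, ← h]; ring)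
  have hdvd : Q ∣ Q' := hc.symm.dvd_of_dvd_mul_left ⟨P', e2⟩
  have hQ'0 : Q' = 0 := eq_zero_of_dvd_of_lt hdvd (degree_lt_of_coeff hQ
    (by rw [hQ', hQ.coeff_natDegree, hd1]) fun n hn => by rw [hQ', hn, hd0])
  have hP'0 : P' = 0 := by
    rw [hQ'0, mul_zero, eq_comm, mul_eq_zero] at e2
    exact e2.resolve_left hQ.ne_zero
  rw [hd, hd, ← hP', ← hQ', hQ'0, hP'0]
  simp

theorem coeff_ringHom_eq {t z : E} (ht : Transcendental F t) {P Q : F[X]}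
    (hc : IsCoprime P Q) (hQ : Q.Monic) (h : z * aeval t Q = aeval t P)
    (θ : E →+* E) (k : F →+* F) (hk : ∀ c, θ (algebraMap F E c) = algebraMap F E (k c))
    (hθt : θ t = t) (hθz : θ z = z) : P.map k = P ∧ Q.map k = Q := by
  have key : ∀ R : F[X], θ (aeval t R) = aeval t (R.map k) := by
    intro R
    rw [aeval_eq_sum_range, aeval_def, eval₂_map, eval₂_eq_sum_range]
    simp [Algebra.smul_def, hk, hθt]
  have inj : Function.Injective (aeval (R := F) t) := transcendental_iff_injective.1 ht
  have e1 : z * aeval t (Q.map k) = aeval t (P.map k) := by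
    rw [← key, ← key, ← h, map_mul, hθz]
  have e2 : P * Q.map k = Q * P.map k := inj (by rw [map_mul, map_mul, ← e1, ← h]; ring)
  have hdvd : Q ∣ Q.map k := hc.symm.dvd_of_dvd_mul_left ⟨_, e2⟩
  have e3 : Q.map k = Q :=
    eq_of_monic_of_dvd_of_natDegree_le hQ (hQ.map k) hdvd natDegree_map_le
  refine ⟨?_, e3⟩
  rw [e3, mul_comm] at e2
  exact (mul_left_cancel₀ hQ.ne_zero e2).symm

theorem mem_range_of_derivation_eq_zero [CharZero F] {t z : E} (ht : Transcendental F t)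
    (hz : z ∈ IntermediateField.adjoin F {t}) (D : Derivation ℤ E E)
    (hD : ∀ c : F, D (algebraMap F E c) = 0) (hDt : D t ≠ 0) (hDz : D z = 0) :
    z ∈ Set.range (algebraMap F E) := by
  obtain ⟨P, Q, hc, hQ, hQ0, h⟩ := exists_coprime_fraction hz
  have key : ∀ R : F[X], D (aeval t R) = aeval t (derivative R) * D t := by
    intro R
    induction R using Polynomial.induction_on' with
    | add p q hp hq => simp [hp, hq, add_mul]
    | monomial n a =>
      simp [aeval_monomial, derivative_monomial, Derivation.leibniz, Derivation.leibniz_pow, hD]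
      ring
  have inj : Function.Injective (aeval (R := F) t) := transcendental_iff_injective.1 ht
  have e1 : z * aeval t (derivative Q) = aeval t (derivative P) := by
    have := congrArg D h
    rw [Derivation.leibniz, hDz, smul_zero, add_zero, key, key, smul_eq_mul, ← mul_assoc] at this
    exact mul_right_cancel₀ hDt this
  have e2 : P * derivative Q = Q * derivative P :=
    inj (by rw [map_mul, map_mul, ← e1, ← h]; ring)
  have hdvd : Q ∣ derivative Q := hc.symm.dvd_of_dvd_mul_left ⟨_, e2⟩
  have h3 : derivative Q = 0 := eq_zero_of_dvd_of_lt hdvd (degree_derivative_lt hQ.ne_zero)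
  rw [h3, mul_zero, eq_comm, mul_eq_zero] at e2
  have h4 : derivative P = 0 := e2.resolve_left hQ.ne_zero
  have h5 := derivative_eq_zero.1 h3
  have h6 := derivative_eq_zero.1 h4
  rw [eq_one_of_monic_natDegree_zero hQ h5, map_one, mul_one] at h
  rw [eq_C_of_natDegree_eq_zero h6, aeval_C] at h
  exact ⟨_, h.symm⟩

theorem eq_C_of_comp_X_add_C [CharZero F] {a : F} (ha : a ≠ 0) {R : F[X]}
    (h : R.comp (X + C a) = R) : R = C (R.coeff 0) := by
  have h1 : ∀ n : ℕ, (R - C (R.coeff 0)).IsRoot (n * a) := by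
    intro n
    induction n with
    | zero => simp [coeff_zero_eq_eval_zero]
    | succ n ih =>
      have : R.eval (n * a + a) = R.eval (n * a) := by
        conv_rhs => rw [← h]
        simp
      simp only [IsRoot.def, eval_sub, eval_C] at ih ⊢
      rw [← ih, ← this]; push_cast; ring_nf
  have h2 : R - C (R.coeff 0) = 0 := by
    apply eq_zero_of_infinite_isRoot
    refine Set.infinite_of_injective_forall_mem (f := fun n : ℕ => (n : F) * a) ?_ h1
    intro m n hmn
    exact_mod_cast mul_right_cancel₀ ha hmn
  exact sub_eq_zero.1 h2

theorem mem_range_of_translation [CharZero F] {t z : E} (ht : Transcendental F t)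
    (hz : z ∈ IntermediateField.adjoin F {t}) (θ : E →+* E)
    (hθ : ∀ c : F, θ (algebraMap F E c) = algebraMap F E c) {a : F} (ha : a ≠ 0)
    (hθt : θ t = t + algebraMap F E a) (hθz : θ z = z) :
    z ∈ Set.range (algebraMap F E) := by
  obtain ⟨P, Q, hc, hQ, hQ0, h⟩ := exists_coprime_fraction hz
  have key : ∀ R : F[X], θ (aeval t R) = aeval t (R.comp (X + C a)) := by
    intro R
    rw [aeval_comp, aeval_eq_sum_range, aeval_eq_sum_range]
    simp [Algebra.smul_def, hθ, hθt]
  have inj : Function.Injective (aeval (R := F) t) := transcendental_iff_injective.1 ht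
  have e1 : z * aeval t (Q.comp (X + C a)) = aeval t (P.comp (X + C a)) := by
    rw [← key, ← key, ← h, map_mul, hθz]
  have e2 : P * Q.comp (X + C a) = Q * P.comp (X + C a) :=
    inj (by rw [map_mul, map_mul, ← e1, ← h]; ring)
  have hdvd : Q ∣ Q.comp (X + C a) := hc.symm.dvd_of_dvd_mul_left ⟨_, e2⟩
  have e3 : Q.comp (X + C a) = Q :=
    eq_of_monic_of_dvd_of_natDegree_le hQ (hQ.comp_X_add_C a) hdvd
      (by rw [natDegree_comp]; simp)
  rw [e3, mul_comm] at e2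
  have e4 := (mul_left_cancel₀ hQ.ne_zero e2).symm
  have h5 := eq_C_of_comp_X_add_C ha e3
  have h6 := eq_C_of_comp_X_add_C ha e4
  rw [h5, h6, aeval_C, aeval_C] at h
  rw [h5, aeval_C] at hQ0
  exact ⟨P.coeff 0 / Q.coeff 0, by rw [map_div₀, div_eq_iff hQ0, h]⟩

theorem mem_range_of_dilation {t z : E} (ht : Transcendental F t)
    (hz : z ∈ IntermediateField.adjoin F {t}) (θ : E →+* E)
    (hθ : ∀ c : F, θ (algebraMap F E c) = algebraMap F E c) {a : F} (ha0 : a ≠ 0)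
    (ha : ∀ n : ℕ, n ≠ 0 → a ^ n ≠ 1)
    (hθt : θ t = algebraMap F E a * t) (hθz : θ z = z) :
    z ∈ Set.range (algebraMap F E) := by
  obtain ⟨P, Q, hc, hQ, hQ0, h⟩ := exists_coprime_fraction hz
  have key : ∀ R : F[X], θ (aeval t R) = aeval t (R.comp (C a * X)) := by
    intro R
    rw [aeval_comp, aeval_eq_sum_range, aeval_eq_sum_range]
    simp [Algebra.smul_def, hθ, hθt]
  have inj : Function.Injective (aeval (R := F) t) := transcendental_iff_injective.1 ht
  have e1 : z * aeval t (Q.comp (C a * X)) = aeval t (P.comp (C a * X)) := by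
    rw [← key, ← key, ← h, map_mul, hθz]
  have e2 : P * Q.comp (C a * X) = Q * P.comp (C a * X) :=
    inj (by rw [map_mul, map_mul, ← e1, ← h]; ring)
  have hdvd : Q ∣ Q.comp (C a * X) := hc.symm.dvd_of_dvd_mul_left ⟨_, e2⟩
  have hap : ∀ m n : ℕ, a ^ m = a ^ n → m = n := by
    have : ∀ m n : ℕ, m ≤ n → a ^ m = a ^ n → m = n := by
      intro m n hmn h
      obtain ⟨k, rfl⟩ := Nat.exists_eq_add_of_le hmn
      by_contra hk
      refine ha k (by omega) ?_
      rw [pow_add] at h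
      exact (mul_right_eq_self₀.1 h.symm).resolve_right (pow_ne_zero _ ha0)
    intro m n h
    rcases le_total m n with hmn | hmn
    · exact this m n hmn h
    · exact (this n m hmn h.symm).symm
  have e3 : Q.comp (C a * X) = C (a ^ Q.natDegree) * Q := by
    obtain ⟨S, hS⟩ := hdvd
    have hne : Q.comp (C a * X) ≠ 0 := fun h0 => by
      have := congrArg (coeff · Q.natDegree) h0
      simp [comp_C_mul_X_coeff, hQ.coeff_natDegree, ha0] at this
    have hS0 : S ≠ 0 := by rintro rfl; simp [hne] at hS
    have hd : (Q.comp (C a * X)).natDegree = Q.natDegree + S.natDegree := by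
      rw [hS, natDegree_mul hQ.ne_zero hS0]
    rw [natDegree_comp, natDegree_C_mul_X a ha0] at hd
    have hS' := eq_C_of_natDegree_eq_zero (p := S) (by omega)
    have := congrArg (coeff · Q.natDegree) hS
    rw [hS'] at this
    simp only [comp_C_mul_X_coeff, coeff_mul_C, hQ.coeff_natDegree, one_mul] at this
    rw [hS, hS', this, mul_comm]
  have e4 : P.comp (C a * X) = C (a ^ Q.natDegree) * P := by
    rw [e3] at e2
    refine mul_left_cancel₀ hQ.ne_zero ?_
    rw [← e2]; ring
  have mono : ∀ R : F[X], R.comp (C a * X) = C (a ^ Q.natDegree) * R →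
      ∀ n, n ≠ Q.natDegree → R.coeff n = 0 := by
    intro R hR n hn
    have := congrArg (coeff · n) hR
    simp only [comp_C_mul_X_coeff, coeff_C_mul] at this
    by_contra h0
    rw [mul_comm] at this
    exact hn (hap _ _ (mul_right_cancel₀ h0 this))
  have hd0 : Q.natDegree = 0 := by
    by_contra hd
    have hP0 := mono P e4 0 (Ne.symm hd)
    have hQ0 := mono Q e3 0 (Ne.symm hd)
    exact not_isUnit_X (hc.isUnit_of_dvd' (X_dvd_iff.2 hP0) (X_dvd_iff.2 hQ0))
  have hP : P = C (P.coeff 0) := by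
    ext n
    rcases Nat.eq_zero_or_pos n with rfl | hn
    · simp
    · rw [mono P e4 n (by omega), coeff_C_of_ne_zero (by omega)]
  rw [eq_one_of_monic_natDegree_zero hQ hd0, map_one, mul_one, hP, aeval_C] at h
  exact ⟨_, h.symm⟩

end OneVariable

section Coefficients

open Polynomial

theorem exists_coefficients_simple {F E : Type*} [Field F] [Field E] [Algebra F E] {t z : E}
    (ht : Transcendental F t) (hz : z ∈ IntermediateField.adjoin F {t}) :
    ∃ S : Set F, S.Finite ∧ (∀ L : Subfield E, t ∈ L → (∀ c ∈ S, algebraMap F E c ∈ L) → z ∈ L) ∧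
      (∀ D : Derivation ℤ E E, (∀ c : F, ∃ d : F, D (algebraMap F E c) = algebraMap F E d) →
        D t = 0 → D z = 0 → ∀ c ∈ S, D (algebraMap F E c) = 0) ∧
      (∀ θ : E →+* E, (∀ c : F, ∃ d : F, θ (algebraMap F E c) = algebraMap F E d) →
        θ t = t → θ z = z → ∀ c ∈ S, θ (algebraMap F E c) = algebraMap F E c) := by
  obtain ⟨P, Q, hc, hQ, hQ0, h⟩ := exists_coprime_fraction hz
  have hP0 : ∀ (R : F[X]) n, R.coeff n = 0 ∨ n < R.natDegree + 1 := by
    intro R n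
    by_cases hn : n < R.natDegree + 1
    · exact Or.inr hn
    · exact Or.inl (coeff_eq_zero_of_natDegree_lt (by omega))
  refine ⟨P.coeff '' Set.Iio (P.natDegree + 1) ∪ Q.coeff '' Set.Iio (Q.natDegree + 1),
    ((Set.finite_Iio _).image _).union ((Set.finite_Iio _).image _), ?_, ?_, ?_⟩
  · intro L hL hS
    refine mem_closure_of_fraction hQ0 h L hL (fun n => ?_) (fun n => ?_)
    · rcases hP0 P n with hn | hn
      · rw [hn, map_zero]; exact L.zero_mem
      · exact hS _ (Or.inl ⟨n, hn, rfl⟩)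
    · rcases hP0 Q n with hn | hn
      · rw [hn, map_zero]; exact L.zero_mem
      · exact hS _ (Or.inr ⟨n, hn, rfl⟩)
  · intro D hD hDt hDz c hcS
    have key := coeff_derivation_eq_zero ht hc hQ h D hDt hDz hD
    rcases hcS with ⟨n, _, rfl⟩ | ⟨n, _, rfl⟩
    · exact (key n).1
    · exact (key n).2
  · intro θ hθ hθt hθz c hcS
    choose k hk using hθ
    have hinj := (algebraMap F E).injective
    let k' : F →+* F :=
      { toFun := k
        map_one' := hinj (by rw [← hk]; simp)
        map_zero' := hinj (by rw [← hk]; simp)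
        map_add' := fun a b => hinj (by rw [← hk, map_add, map_add, map_add, hk, hk])
        map_mul' := fun a b => hinj (by rw [← hk, map_mul, map_mul, map_mul, hk, hk]) }
    have key := coeff_ringHom_eq ht hc hQ h θ k' hk hθt hθz
    rcases hcS with ⟨n, _, rfl⟩ | ⟨n, _, rfl⟩
    · rw [hk]
      have := congrArg (coeff · n) key.1
      rw [coeff_map] at this
      exact congrArg _ this
    · rw [hk]
      have := congrArg (coeff · n) key.2
      rw [coeff_map] at this
      exact congrArg _ this

variable {K : Type*} [Field K] [Algebra ℂ K]

namespace IsCoord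

variable {x y : K} (h : IsCoord x y)
include h

theorem symm : IsCoord y x :=
  h.of_mem (IntermediateField.subset_adjoin _ _ (by simp))
    (IntermediateField.subset_adjoin _ _ (by simp))

theorem mem_adjoin_adjoin (z : K) :
    z ∈ IntermediateField.adjoin (IntermediateField.adjoin ℂ {x}) {y} := by
  have := h.mem_adjoin z
  rw [← IntermediateField.mem_restrictScalars ℂ, IntermediateField.adjoin_adjoin_left]
  rwa [Set.singleton_union]

theorem transcendental_left : Transcendental ℂ x := by
  simpa using h.indep.transcendental 0

theorem transcendental_right : Transcendental ℂ y := h.symm.transcendental_left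

theorem transcendental_adjoin : Transcendental (IntermediateField.adjoin ℂ {x}) y := by
  have h1 := h.indep.transcendental_adjoin (s := {0}) (i := 1) (by simp)
  have h2 : ![x, y] '' {0} = {x} := by simp
  rw [h2] at h1
  exact fun h3 => h1 ((IntermediateField.isAlgebraic_adjoin_iff).1 h3)

omit h in
theorem mem_adjoin_simple_of_maps {z : K} (hz : z ∈ IntermediateField.adjoin ℂ {x})
    (D : Derivation ℤ K K)
    (hD : ∀ c : ℂ, ∃ d : ℂ, D (algebraMap ℂ K c) = algebraMap ℂ K d) (hx : D x = 0) :
    D z ∈ IntermediateField.adjoin ℂ {x} := by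
  induction hz using IntermediateField.adjoin_induction with
  | mem t ht =>
    rcases ht with rfl
    rw [hx]; exact zero_mem _
  | algebraMap c =>
    obtain ⟨d, hd⟩ := hD c
    rw [hd]; exact IntermediateField.algebraMap_mem _ d
  | add a b _ _ ha hb => rw [map_add]; exact add_mem ha hb
  | inv a h ha =>
    rw [Derivation.leibniz_inv]
    exact mul_mem (neg_mem (pow_mem (inv_mem h) 2)) ha
  | mul a b h1 h2 ha hb =>
    rw [Derivation.leibniz]
    exact add_mem (mul_mem h1 hb) (mul_mem h2 ha)

omit h in
theorem map_mem_adjoin_simple {z : K} (hz : z ∈ IntermediateField.adjoin ℂ {x}) (θ : K →+* K)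
    (hθ : ∀ c : ℂ, ∃ d : ℂ, θ (algebraMap ℂ K c) = algebraMap ℂ K d)
    (hx : θ x ∈ IntermediateField.adjoin ℂ {x}) :
    θ z ∈ IntermediateField.adjoin ℂ {x} := by
  induction hz using IntermediateField.adjoin_induction with
  | mem t ht =>
    rcases ht with rfl
    exact hx
  | algebraMap c =>
    obtain ⟨d, hd⟩ := hθ c
    rw [hd]; exact IntermediateField.algebraMap_mem _ d
  | add a b _ _ ha hb => rw [map_add]; exact add_mem ha hb
  | inv a h ha => rw [map_inv₀]; exact inv_mem ha
  | mul a b h1 h2 ha hb => rw [map_mul]; exact mul_mem ha hb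

theorem exists_coefficients (z : K) :
    ∃ S : Set ℂ, S.Finite ∧
      (∀ L : Subfield K, x ∈ L → y ∈ L → (∀ c ∈ S, algebraMap ℂ K c ∈ L) → z ∈ L) ∧
      (∀ D : Derivation ℤ K K, (∀ c : ℂ, ∃ d : ℂ, D (algebraMap ℂ K c) = algebraMap ℂ K d) →
        D x = 0 → D y = 0 → D z = 0 → ∀ c ∈ S, D (algebraMap ℂ K c) = 0) ∧
      (∀ θ : K →+* K, (∀ c : ℂ, ∃ d : ℂ, θ (algebraMap ℂ K c) = algebraMap ℂ K d) →
        θ x = x → θ y = y → θ z = z → ∀ c ∈ S, θ (algebraMap ℂ K c) = algebraMap ℂ K c) := by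
  obtain ⟨S, hS, h1, h2, h3⟩ := exists_coefficients_simple h.transcendental_adjoin
    (h.mem_adjoin_adjoin z)
  choose f hf k1 k2 k3 using fun s : IntermediateField.adjoin ℂ {x} =>
    exists_coefficients_simple h.transcendental_left s.2
  refine ⟨⋃ s ∈ S, f s, hS.biUnion fun s _ => hf s, ?_, ?_, ?_⟩
  · intro L hx hy hL
    refine h1 L hy fun c hc => k1 c L hx fun d hd => hL d (Set.mem_biUnion hc hd)
  · intro D hD hx hy hz c hc
    obtain ⟨s, hs, hc⟩ := Set.mem_iUnion₂.1 hc
    exact k2 s D hD hx (h2 D (fun c => ⟨⟨_, mem_adjoin_simple_of_maps c.2 D hD hx⟩, rfl⟩)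
      hy hz s hs) c hc
  · intro θ hθ hx hy hz c hc
    obtain ⟨s, hs, hc⟩ := Set.mem_iUnion₂.1 hc
    exact k3 s θ hθ hx (h3 θ (fun c => ⟨⟨_, map_mem_adjoin_simple c.2 θ hθ
      (by rw [hx]; exact IntermediateField.mem_adjoin_simple_self ℂ x)⟩, rfl⟩)
      hy hz s hs) c hc

omit h in
theorem derivation_adjoin_simple_eq_zero {z : K} (hz : z ∈ IntermediateField.adjoin ℂ {x})
    {D : Derivation ℤ K K} (hD : ∀ c : ℂ, D (algebraMap ℂ K c) = 0) (hx : D x = 0) : D z = 0 := by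
  have hz' : z ∈ IntermediateField.adjoin ℂ {x, x} := by simpa using hz
  exact derivation_eq_of_mem_adjoin hz' (g := 0) (by simpa using hD) hx hx

omit h in
theorem ringHom_adjoin_simple_eq {z : K} (hz : z ∈ IntermediateField.adjoin ℂ {x})
    {θ : K →+* K} (hθ : ∀ c : ℂ, θ (algebraMap ℂ K c) = algebraMap ℂ K c) (hx : θ x = x) :
    θ z = z := by
  have hz' : z ∈ IntermediateField.adjoin ℂ {x, x} := by simpa using hz
  exact ringHom_eq_of_mem_adjoin hz' (g := RingHom.id K) (by simpa using hθ) hx hx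

theorem mem_adjoin_of_derivation {z : K} {D : Derivation ℤ K K}
    (hD : ∀ c : ℂ, D (algebraMap ℂ K c) = 0) (hx : D x = 0) (hy : D y ≠ 0) (hz : D z = 0) :
    z ∈ IntermediateField.adjoin ℂ {x} := by
  obtain ⟨c, rfl⟩ := mem_range_of_derivation_eq_zero h.transcendental_adjoin
    (h.mem_adjoin_adjoin z) D (fun c => derivation_adjoin_simple_eq_zero c.2 hD hx) hy hz
  exact c.2

theorem mem_adjoin_of_translation {z : K} (θ : K ≃ₐ[ℂ] K) (hx : θ x = x) {a : ℂ} (ha : a ≠ 0)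
    (hy : θ y = y + algebraMap ℂ K a) (hz : θ z = z) :
    z ∈ IntermediateField.adjoin ℂ {x} := by
  obtain ⟨c, rfl⟩ := mem_range_of_translation h.transcendental_adjoin
    (h.mem_adjoin_adjoin z) θ.toRingEquiv.toRingHom
    (fun c => ringHom_adjoin_simple_eq c.2 (fun c => θ.commutes c) hx)
    (a := algebraMap ℂ _ a) (by simpa using ha) hy hz
  exact c.2

theorem mem_adjoin_of_dilation {z : K} (θ : K ≃ₐ[ℂ] K) (hx : θ x = x)
    {a : ℂ} (ha0 : a ≠ 0) (ha : ∀ n : ℕ, n ≠ 0 → a ^ n ≠ 1)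
    (hy : θ y = algebraMap ℂ K a * y) (hz : θ z = z) :
    z ∈ IntermediateField.adjoin ℂ {x} := by
  obtain ⟨c, rfl⟩ := mem_range_of_dilation h.transcendental_adjoin
    (h.mem_adjoin_adjoin z) θ.toRingEquiv.toRingHom
    (fun c => ringHom_adjoin_simple_eq c.2 (fun c => θ.commutes c) hx)
    (a := algebraMap ℂ _ a) (by simpa using ha0)
    (fun n hn h0 => ha n hn ((algebraMap ℂ (IntermediateField.adjoin ℂ {x})).injective
      (by simpa using h0))) hy hz
  exact c.2

theorem mem_range_of_mem_adjoin {z : K} (h1 : z ∈ IntermediateField.adjoin ℂ {x})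
    (h2 : z ∈ IntermediateField.adjoin ℂ {y}) : z ∈ Set.range (algebraMap ℂ K) := by
  obtain ⟨D, hc, hx, hy⟩ := h.exists_derivation 0 1 0
  have hD : ∀ c : ℂ, D (algebraMap ℂ K c) = 0 := by simpa using hc
  exact mem_range_of_derivation_eq_zero h.transcendental_left h1 D hD (by simp [hx])
    (derivation_adjoin_simple_eq_zero h2 hD hy)

end IsCoord

/-- The field `k(x, y)` inside `ℂ(x, y)`. -/
def coordField (x y : K) (k : Subfield ℂ) : Subfield K :=
  Subfield.closure (algebraMap ℂ K '' k ∪ {x, y})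

variable {x y : K}

theorem coordField_mono {k l : Subfield ℂ} (hkl : k ≤ l) : coordField x y k ≤ coordField x y l :=
  Subfield.closure_mono (Set.union_subset_union_left _ (Set.image_mono hkl))

theorem left_mem_coordField (k : Subfield ℂ) : x ∈ coordField x y k :=
  Subfield.subset_closure (by simp)

theorem right_mem_coordField (k : Subfield ℂ) : y ∈ coordField x y k :=
  Subfield.subset_closure (by simp)

theorem algebraMap_mem_coordField {k : Subfield ℂ} {c : ℂ} (hc : c ∈ k) :
    algebraMap ℂ K c ∈ coordField x y k :=
  Subfield.subset_closure (Or.inl ⟨c, hc, rfl⟩)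

theorem coordField_induction {k : Subfield ℂ} {p : K → Prop} (hk : ∀ c ∈ k, p (algebraMap ℂ K c))
    (hx : p x) (hy : p y) (hadd : ∀ a b, p a → p b → p (a + b)) (hneg : ∀ a, p a → p (-a))
    (hinv : ∀ a, p a → p a⁻¹) (hmul : ∀ a b, p a → p b → p (a * b)) {z : K}
    (hz : z ∈ coordField x y k) : p z := by
  refine Subfield.closure_induction (p := fun z _ => p z) ?_ ?_ (fun a b _ _ => hadd a b)
    (fun a _ => hneg a) (fun a _ => hinv a) (fun a b _ _ => hmul a b) hz
  · rintro _ (⟨c, hc, rfl⟩ | rfl | rfl)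
    · exact hk c hc
    · exact hx
    · exact hy
  · simpa using hk 1 (one_mem k)

theorem derivation_coordField_eq_zero {k : Subfield ℂ} {D : Derivation ℤ K K}
    (hk : ∀ c ∈ k, D (algebraMap ℂ K c) = 0) (hx : D x = 0) (hy : D y = 0) {z : K}
    (hz : z ∈ coordField x y k) : D z = 0 := by
  refine coordField_induction (p := fun z => D z = 0) hk hx hy ?_ ?_ ?_ ?_ hz
  · intro a b ha hb; simp [ha, hb]
  · intro a ha; simp [ha]
  · intro a ha; simp [Derivation.leibniz_inv, ha]
  · intro a b ha hb; simp [ha, hb]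

theorem ringHom_coordField_eq {k : Subfield ℂ} {θ : K →+* K}
    (hk : ∀ c ∈ k, θ (algebraMap ℂ K c) = algebraMap ℂ K c) (hx : θ x = x) (hy : θ y = y) {z : K}
    (hz : z ∈ coordField x y k) : θ z = z := by
  refine coordField_induction (p := fun z => θ z = z) hk hx hy ?_ ?_ ?_ ?_ hz
  · intro a b ha hb; simp [ha, hb]
  · intro a ha; simp [ha]
  · intro a ha; simp [ha]
  · intro a b ha hb; simp [ha, hb]

theorem countable_closure {E : Type*} [Field E] [CharZero E] {S : Set E} (hS : S.Countable) :
    (Subfield.closure S : Set E).Countable := by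
  have : Countable S := hS
  have h1 : Countable (MvPolynomial S ℚ) := by
    rw [← Cardinal.mk_le_aleph0_iff]
    refine MvPolynomial.cardinalMk_le_max_lift.trans ?_
    simp
  refine (Set.countable_range (fun p : MvPolynomial S ℚ × MvPolynomial S ℚ =>
    MvPolynomial.aeval (Subtype.val : S → E) p.1 /
      MvPolynomial.aeval (Subtype.val : S → E) p.2)).mono ?_
  intro z hz
  have h2 : Subfield.closure S ≤ (IntermediateField.adjoin ℚ S).toSubfield :=
    Subfield.closure_le.2 (IntermediateField.subset_adjoin ℚ S)
  obtain ⟨r, s, hrs⟩ := (IntermediateField.mem_adjoin_iff ℚ z).1 (h2 hz)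
  exact ⟨(r, s), hrs.symm⟩

theorem countable_coordField {k : Subfield ℂ} (hk : (k : Set ℂ).Countable) :
    (coordField x y k : Set K).Countable := by
  have : CharZero K := charZero_of_injective_algebraMap (algebraMap ℂ K).injective
  exact countable_closure ((hk.image _).union (Set.toFinite _).countable)

/-- The algebraic closure of `k` in `ℂ`. -/
def algClos (k : Subfield ℂ) : Subfield ℂ := (algebraicClosure k ℂ).toSubfield

theorem mem_algClos {k : Subfield ℂ} {c : ℂ} : c ∈ algClos k ↔ IsAlgebraic k c :=
  mem_algebraicClosure_iff

theorem countable_algClos {k : Subfield ℂ} (hk : (k : Set ℂ).Countable) :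
    (algClos k : Set ℂ).Countable := by
  have h1 : Countable k := hk
  have h2 : Countable (algebraicClosure k ℂ) := by
    rw [← Cardinal.mk_le_aleph0_iff]
    refine (Algebra.IsAlgebraic.cardinalMk_le_max k _).trans ?_
    simp
  exact h2

theorem IsCoord.exists_countable_subset_coordField (h : IsCoord x y) {Z : Set K}
    (hZ : Z.Countable) : ∃ k : Subfield ℂ, (k : Set ℂ).Countable ∧ Z ⊆ coordField x y k := by
  choose S hS h1 _ _ using h.exists_coefficients
  refine ⟨Subfield.closure (⋃ z ∈ Z, S z),
    countable_closure (hZ.biUnion fun z _ => (hS z).countable), fun z hz => ?_⟩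
  exact h1 z _ (left_mem_coordField _) (right_mem_coordField _) fun c hc =>
    algebraMap_mem_coordField (Subfield.subset_closure (Set.mem_biUnion hz hc))

namespace IsCoord

variable (h : IsCoord x y)

/-- The derivation of `ℂ(x, y)` extending `δ` and killing the coordinates. -/
def lift (δ : Derivation ℤ ℂ ℂ) : Derivation ℤ K K := (h.exists_derivation δ 0 0).choose

@[simp] theorem lift_algebraMap (δ : Derivation ℤ ℂ ℂ) (c : ℂ) :
    h.lift δ (algebraMap ℂ K c) = algebraMap ℂ K (δ c) :=
  (h.exists_derivation δ 0 0).choose_spec.1 c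

@[simp] theorem lift_left (δ : Derivation ℤ ℂ ℂ) : h.lift δ x = 0 :=
  (h.exists_derivation δ 0 0).choose_spec.2.1

@[simp] theorem lift_right (δ : Derivation ℤ ℂ ℂ) : h.lift δ y = 0 :=
  (h.exists_derivation δ 0 0).choose_spec.2.2

theorem lift_eq_zero {δ : Derivation ℤ ℂ ℂ} {k : Subfield ℂ} (hδ : ∀ c ∈ k, δ c = 0) {z : K}
    (hz : z ∈ coordField x y k) : h.lift δ z = 0 :=
  derivation_coordField_eq_zero (fun c hc => by simp [hδ c hc]) (by simp) (by simp) hz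

/-- The field automorphism of `ℂ(x, y)` extending `κ` and fixing the coordinates. -/
def liftEquiv (κ : ℂ ≃+* ℂ) : K ≃+* K := (h.exists_ringEquiv h κ).choose

@[simp] theorem liftEquiv_algebraMap (κ : ℂ ≃+* ℂ) (c : ℂ) :
    h.liftEquiv κ (algebraMap ℂ K c) = algebraMap ℂ K (κ c) :=
  (h.exists_ringEquiv h κ).choose_spec.1 c

@[simp] theorem liftEquiv_left (κ : ℂ ≃+* ℂ) : h.liftEquiv κ x = x :=
  (h.exists_ringEquiv h κ).choose_spec.2.1

@[simp] theorem liftEquiv_right (κ : ℂ ≃+* ℂ) : h.liftEquiv κ y = y :=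
  (h.exists_ringEquiv h κ).choose_spec.2.2

theorem liftEquiv_eq {κ : ℂ ≃+* ℂ} {k : Subfield ℂ} (hκ : ∀ c ∈ k, κ c = c) {z : K}
    (hz : z ∈ coordField x y k) : h.liftEquiv κ z = z :=
  ringHom_coordField_eq (θ := (h.liftEquiv κ).toRingHom) (fun c hc => by simp [hκ c hc])
    (by simp) (by simp) hz

theorem mem_coordField_algClos {k : Subfield ℂ} {z : K}
    (hz : ∀ δ : Derivation ℤ ℂ ℂ, (∀ c ∈ k, δ c = 0) → h.lift δ z = 0) :
    z ∈ coordField x y (algClos k) := by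
  obtain ⟨S, hS, h1, h2, h3⟩ := h.exists_coefficients z
  refine h1 _ (left_mem_coordField _) (right_mem_coordField _) fun c hc =>
    algebraMap_mem_coordField ?_
  by_contra hck
  obtain ⟨δ, hδ, hne⟩ := exists_derivation_ne_zero (fun ha => hck (mem_algClos.2 ha))
  have := h2 (h.lift δ) (fun c => ⟨δ c, by simp⟩) (by simp) (by simp) (hz δ hδ) c hc
  simp at this
  exact hne this

theorem mem_coordField {k : Subfield ℂ} {z : K}
    (hz : ∀ δ : Derivation ℤ ℂ ℂ, (∀ c ∈ k, δ c = 0) → h.lift δ z = 0)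
    (hz' : ∀ κ : ℂ ≃+* ℂ, (∀ c ∈ k, κ c = c) → h.liftEquiv κ z = z) :
    z ∈ coordField x y k := by
  obtain ⟨S, hS, h1, h2, h3⟩ := h.exists_coefficients z
  refine h1 _ (left_mem_coordField _) (right_mem_coordField _) fun c hc =>
    algebraMap_mem_coordField ?_
  have hc' : IsAlgebraic k c := by
    by_contra hck
    obtain ⟨δ, hδ, hne⟩ := exists_derivation_ne_zero hck
    have := h2 (h.lift δ) (fun c => ⟨δ c, by simp⟩) (by simp) (by simp) (hz δ hδ) c hc
    simp at this
    exact hne this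
  by_contra hck
  obtain ⟨κ, hκ, hne⟩ := exists_automorphism_ne hck hc'
  have := h3 (h.liftEquiv κ).toRingHom (fun c => ⟨κ c, by simp⟩) (by simp) (by simp) (hz' κ hκ) c hc
  simp at this
  exact hne this

end IsCoord

/-- Transport of a derivation along a field automorphism. -/
def conjD (f : K ≃+* K) (D : Derivation ℤ K K) : Derivation ℤ K K :=
  Derivation.mk' ((f.toAddMonoidHom.comp D.toLinearMap.toAddMonoidHom).comp
    f.symm.toAddMonoidHom).toIntLinearMap fun a b => by simp

end Coefficients

section MonomialSpans

variable {K : Type*} [Field K] [Algebra ℂ K]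

/-- The span of the monomials in `p, q` with exponents in `S`. -/
def monomialSpan (p q : K) (S : Set (ℕ × ℕ)) : Submodule ℂ K :=
  Submodule.span ℂ ((fun s : ℕ × ℕ => p ^ s.1 * q ^ s.2) '' S)

variable {p q p' q' : K} {S T : Set (ℕ × ℕ)}

theorem monomial_mem {i j : ℕ} (h : (i, j) ∈ S) : p ^ i * q ^ j ∈ monomialSpan p q S :=
  Submodule.subset_span ⟨(i, j), h, rfl⟩

theorem monomialSpan_mono (h : S ⊆ T) : monomialSpan p q S ≤ monomialSpan p q T :=
  Submodule.span_mono (Set.image_mono h)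

theorem mul_mem_of_monomials {c : K} {V : Submodule ℂ K}
    (h : ∀ i j, (i, j) ∈ S → c * (p ^ i * q ^ j) ∈ V) {z : K} (hz : z ∈ monomialSpan p q S) :
    c * z ∈ V := by
  have : monomialSpan p q S ≤ V.comap (LinearMap.mulLeft ℂ c) := by
    refine Submodule.span_le.2 ?_
    rintro _ ⟨⟨i, j⟩, hs, rfl⟩
    exact h i j hs
  exact this hz

theorem mem_of_monomials {V : Submodule ℂ K}
    (h : ∀ i j, (i, j) ∈ S → p ^ i * q ^ j ∈ V) {z : K} (hz : z ∈ monomialSpan p q S) :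
    z ∈ V := by
  have := mul_mem_of_monomials (c := 1) (V := V) (by simpa using h) hz
  simpa using this

theorem exists_add_of_mem {z : K} (hz : z ∈ monomialSpan p q S) (T : Set (ℕ × ℕ)) :
    ∃ a ∈ monomialSpan p q (S ∩ T), ∃ b ∈ monomialSpan p q (S \ T), a + b = z := by
  rw [← Submodule.mem_sup, monomialSpan, monomialSpan, ← Submodule.span_union, ← Set.image_union,
    Set.inter_union_sdiff]
  exact hz

theorem linearIndependent_monomials (h : IsCoord p q) :
    LinearIndependent ℂ (fun s : ℕ × ℕ => p ^ s.1 * q ^ s.2) := by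
  have h1 : LinearIndependent ℂ (fun m : Fin 2 →₀ ℕ => MvPolynomial.aeval ![p, q]
      (MvPolynomial.monomial m (1 : ℂ))) := by
    have := (MvPolynomial.basisMonomials (Fin 2) ℂ).linearIndependent
    rw [MvPolynomial.coe_basisMonomials] at this
    exact this.map_injOn (MvPolynomial.aeval ![p, q]).toLinearMap h.indep.injOn
  let e : ℕ × ℕ → (Fin 2 →₀ ℕ) := fun s => Finsupp.equivFunOnFinite.symm ![s.1, s.2]
  have he : Function.Injective e := by
    rintro ⟨a, b⟩ ⟨c, d⟩ hab
    have := Finsupp.equivFunOnFinite.symm.injective hab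
    simpa using And.intro (congrFun this 0) (congrFun this 1)
  have h2 := h1.comp e he
  convert! h2 using 2 with s
  simp [e, MvPolynomial.aeval_monomial, Finsupp.prod_fintype]

theorem mem_inter (h : IsCoord p q) {z : K} (hS : z ∈ monomialSpan p q S)
    (hT : z ∈ monomialSpan p q T) : z ∈ monomialSpan p q (S ∩ T) := by
  have hl := linearIndependent_monomials h
  rw [monomialSpan, Finsupp.mem_span_image_iff_linearCombination] at hS hT ⊢
  obtain ⟨l, hl1, rfl⟩ := hS
  obtain ⟨m, hm1, e⟩ := hT
  obtain rfl : m = l := hl e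
  exact ⟨m, by rw [Finsupp.supported_inter]; exact ⟨hl1, hm1⟩, rfl⟩

theorem monomialSpan_swap : monomialSpan q p (Prod.swap ⁻¹' S) = monomialSpan p q S := by
  have key : ∀ {p q : K} {S : Set (ℕ × ℕ)},
      monomialSpan q p (Prod.swap ⁻¹' S) ≤ monomialSpan p q S := by
    intro p q S z hz
    exact mem_of_monomials (fun i j hij => by rw [mul_comm]; exact monomial_mem hij) hz
  exact le_antisymm key fun z hz => key (S := Prod.swap ⁻¹' S) (p := q) (q := p) hz

theorem mem_translate_right (e : ℂ) (hS : ∀ i j j', (i, j) ∈ S → j' ≤ j → (i, j') ∈ S) {z : K}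
    (hz : z ∈ monomialSpan p q S) : z ∈ monomialSpan p (q - algebraMap ℂ K e) S := by
  refine mem_of_monomials (fun i j hij => ?_) hz
  have : p ^ i * q ^ j = p ^ i * ((q - algebraMap ℂ K e) + algebraMap ℂ K e) ^ j := by ring
  rw [this, add_pow, Finset.mul_sum]
  refine Submodule.sum_mem _ fun k hk => ?_
  have hk' : k ≤ j := by simpa [Nat.lt_succ_iff] using hk
  have e1 : p ^ i * ((q - algebraMap ℂ K e) ^ k * algebraMap ℂ K e ^ (j - k) * (j.choose k : K))
      = (e ^ (j - k) * j.choose k : ℂ) • (p ^ i * (q - algebraMap ℂ K e) ^ k) := by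
    rw [Algebra.smul_def, map_mul, map_pow, map_natCast]; ring
  rw [e1]
  exact Submodule.smul_mem _ _ (monomial_mem (hS i j k hij hk'))

theorem mem_translate_left (e : ℂ) (hS : ∀ i j i', (i, j) ∈ S → i' ≤ i → (i', j) ∈ S) {z : K}
    (hz : z ∈ monomialSpan p q S) : z ∈ monomialSpan (p - algebraMap ℂ K e) q S := by
  rw [← monomialSpan_swap] at hz ⊢
  exact mem_translate_right e (fun i j j' h h' => hS j i j' h h') hz

theorem exists_bound {z : K} (hz : z ∈ monomialSpan p q S) :
    ∃ b : ℕ, z ∈ monomialSpan p q (S ∩ {s | s.1 ≤ b}) := by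
  refine Submodule.span_induction
    (p := fun z _ => ∃ b : ℕ, z ∈ monomialSpan p q (S ∩ {s | s.1 ≤ b}))
    ?_ ⟨0, zero_mem _⟩ ?_ ?_ hz
  · rintro _ ⟨⟨i, j⟩, hs, rfl⟩
    exact ⟨i, monomial_mem ⟨hs, le_refl i⟩⟩
  · rintro a b _ _ ⟨m, hm⟩ ⟨n, hn⟩
    refine ⟨max m n, add_mem (monomialSpan_mono ?_ hm) (monomialSpan_mono ?_ hn)⟩
    · exact Set.inter_subset_inter_right _ fun s (hs : s.1 ≤ m) => le_trans hs (le_max_left m n)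
    · exact Set.inter_subset_inter_right _ fun s (hs : s.1 ≤ n) => le_trans hs (le_max_right m n)
  · rintro c a _ ⟨m, hm⟩
    exact ⟨m, Submodule.smul_mem _ _ hm⟩

end MonomialSpans

section Places

open WithZero

variable {K : Type*} [Field K] [Algebra ℂ K]

/-- The Jacobian determinant of `p, q` with respect to two derivations. -/
def jac (D E : Derivation ℤ K K) (p q : K) : K := D p * E q - E p * D q

omit [Algebra ℂ K] in
theorem jac_swap (D E : Derivation ℤ K K) (p q : K) : jac D E q p = -jac D E p q := by
  simp only [jac]; ring

omit [Algebra ℂ K] in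
theorem jac_mul_right (D E : Derivation ℤ K K) (p q : K) : jac D E p (p * q) = p * jac D E p q := by
  simp only [jac, Derivation.leibniz, smul_eq_mul]; ring

omit [Algebra ℂ K] in
theorem jac_inv_right (D E : Derivation ℤ K K) (p q : K) :
    jac D E p q⁻¹ = -(q⁻¹ ^ 2 * jac D E p q) := by
  simp only [jac, Derivation.leibniz_inv, smul_eq_mul]; ring

omit [Algebra ℂ K] in
theorem jac_inv_left (D E : Derivation ℤ K K) (p q : K) :
    jac D E p⁻¹ q = -(p⁻¹ ^ 2 * jac D E p q) := by
  simp only [jac, Derivation.leibniz_inv, smul_eq_mul]; ring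

omit [Algebra ℂ K] in
theorem jac_mul_zpow_right (D E : Derivation ℤ K K) {p : K} (hp : p ≠ 0) (q : K) (m : ℤ) :
    jac D E p (q * p ^ m) = p ^ m * jac D E p q := by
  induction m using Int.induction_on with
  | zero => simp
  | succ i ih =>
    rw [zpow_add_one₀ hp, show q * (p ^ (i : ℤ) * p) = p * (q * p ^ (i : ℤ)) by ring,
      jac_mul_right, ih]
    ring
  | pred i ih =>
    have h1 := jac_mul_right D E p (q * p ^ (-(i : ℤ) - 1))
    have h2 : p * (q * p ^ (-(i : ℤ) - 1)) = q * p ^ (-(i : ℤ)) := by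
      rw [zpow_sub_one₀ hp]; field_simp
    rw [h2, ih] at h1
    refine mul_left_cancel₀ hp (h1.symm.trans ?_)
    rw [← mul_assoc, ← zpow_one_add₀ hp]
    congr 2
    ring

/-- A discrete valuation of `K`, trivial on `ℂ` and on `u`, whose ring is stable under the
Jacobian determinant. -/
structure Place (u : K) (D E : Derivation ℤ K K) (w : Valuation K ℤᵐ⁰) : Prop where
  const : ∀ c : ℂ, c ≠ 0 → w (algebraMap ℂ K c) = 1
  base : w u = 1
  jac_le : ∀ X Y, w X ≤ 1 → w Y ≤ 1 → w (jac D E X Y) ≤ 1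
  left : ∀ c : ℂ, D (algebraMap ℂ K c) = 0
  right : ∀ c : ℂ, E (algebraMap ℂ K c) = 0

namespace Place

variable {u : K} {D E : Derivation ℤ K K} {w : Valuation K ℤᵐ⁰} (hw : Place u D E w)
include hw

theorem const_le (c : ℂ) : w (algebraMap ℂ K c) ≤ 1 := by
  by_cases hc : c = 0
  · simp [hc]
  · exact (hw.const c hc).le

theorem jac_sub_right (p q : K) (c : ℂ) : jac D E p (q - algebraMap ℂ K c) = jac D E p q := by
  simp [jac, hw.left, hw.right]

theorem jac_sub_left (p q : K) (c : ℂ) : jac D E (p - algebraMap ℂ K c) q = jac D E p q := by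
  simp [jac, hw.left, hw.right]

theorem residue (Z : K) : (∃ e : ℂ, w (Z - algebraMap ℂ K e) < 1) ∨ (1 < w Z) ∨
    ∀ P : Polynomial ℂ, P ≠ 0 → w (Polynomial.aeval Z P) = 1 := by
  by_cases h : ∃ e : ℂ, w (Z - algebraMap ℂ K e) < 1
  · exact Or.inl h
  by_cases hZ : 1 < w Z
  · exact Or.inr (Or.inl hZ)
  refine Or.inr (Or.inr fun P hP => ?_)
  push Not at h hZ
  have h1 : ∀ e : ℂ, w (Z - algebraMap ℂ K e) = 1 := fun e => le_antisymm
    ((w.map_sub _ _).trans (max_le hZ (hw.const_le e))) (h e)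
  rw [(IsAlgClosed.splits P).eq_prod_roots]
  rw [map_mul, map_mul, Polynomial.aeval_C, hw.const _ (Polynomial.leadingCoeff_ne_zero.2 hP),
    one_mul, map_multiset_prod, map_multiset_prod]
  refine Multiset.prod_eq_one fun x hx => ?_
  simp only [Multiset.map_map, Multiset.mem_map] at hx
  obtain ⟨e, _, rfl⟩ := hx
  simpa using h1 e

theorem le_one_of_mem {X Z : K} {S : Set (ℕ × ℕ)} (hX : w X ≤ 1) (hZ : w Z ≤ 1) {A : K}
    (hA : A ∈ monomialSpan X Z S) : w A ≤ 1 := by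
  refine Submodule.span_induction (p := fun A _ => w A ≤ 1) ?_ (by simp) ?_ ?_ hA
  · rintro _ ⟨⟨i, j⟩, _, rfl⟩
    simp only [map_mul, map_pow]
    exact mul_le_one' (pow_le_one' hX i) (pow_le_one' hZ j)
  · intro a b _ _ ha hb
    exact (w.map_add _ _).trans (max_le ha hb)
  · intro c a _ ha
    rw [Algebra.smul_def, map_mul]
    exact mul_le_one' (hw.const_le c) ha

theorem mem_of_lt_one {X Z : K} {S : Set (ℕ × ℕ)} (hX : w X < 1)
    (hZ : ∀ P : Polynomial ℂ, P ≠ 0 → w (Polynomial.aeval Z P) = 1) {A : K}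
    (hA : A ∈ monomialSpan X Z S) (hA1 : w A < 1) :
    A ∈ monomialSpan X Z (S ∩ {s | 1 ≤ s.1}) := by
  obtain ⟨a, ha, b, hb, rfl⟩ := exists_add_of_mem hA {s | 1 ≤ s.1}
  have hZ1 : w Z ≤ 1 := by
    have := hZ Polynomial.X Polynomial.X_ne_zero
    rw [Polynomial.aeval_X] at this; exact this.le
  have ha1 : w a < 1 := by
    have hX0 : X * (X⁻¹ * a) = a := by
      by_cases h0 : X = 0
      · have : a ∈ (⊥ : Submodule ℂ K) := mem_of_monomials
          (fun i j (hij : (i, j) ∈ S ∩ {s | 1 ≤ s.1}) => by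
            have hi : 1 ≤ i := hij.2
            rw [h0, zero_pow (by omega), zero_mul]
            exact Submodule.zero_mem _) ha
        rw [(Submodule.mem_bot ℂ).1 this, mul_zero, mul_zero]
      · field_simp
    have h2 : X⁻¹ * a ∈ monomialSpan X Z Set.univ := by
      by_cases h0 : X = 0
      · simp [h0]
      refine mul_mem_of_monomials (fun i j hij => ?_) ha
      have : 1 ≤ i := hij.2
      obtain ⟨k, rfl⟩ := Nat.exists_eq_add_of_le' this
      have : X⁻¹ * (X ^ (k + 1) * Z ^ j) = X ^ k * Z ^ j := by rw [pow_succ]; field_simp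
      rw [this]; exact monomial_mem trivial
    rw [← hX0, map_mul]
    exact mul_lt_one_of_lt_of_le hX (hw.le_one_of_mem hX.le hZ1 h2)
  have hb' : ∃ P : Polynomial ℂ, b = Polynomial.aeval Z P := by
    have : b ∈ LinearMap.range (Polynomial.aeval (R := ℂ) Z).toLinearMap := by
      refine mem_of_monomials (V := LinearMap.range (Polynomial.aeval (R := ℂ) Z).toLinearMap)
        (fun i j (hij : (i, j) ∈ S \ {s | 1 ≤ s.1}) =>
          LinearMap.mem_range.2 ⟨Polynomial.X ^ j, ?_⟩) hb
      have h1 : ¬ 1 ≤ i := hij.2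
      have : i = 0 := by omega
      simp [this]
    obtain ⟨P, hP⟩ := this
    exact ⟨P, hP.symm⟩
  obtain ⟨P, rfl⟩ := hb'
  by_cases hP : P = 0
  · simpa [hP] using ha
  have : w (Polynomial.aeval Z P) < 1 := by
    have h3 : Polynomial.aeval Z P = (a + Polynomial.aeval Z P) - a := by ring
    rw [h3]
    exact (w.map_sub _ _).trans_lt (max_lt hA1 ha1)
  exact absurd (hZ P hP) this.ne

omit hw in
theorem exists_maximal_order (N r : ℕ) (hr : 1 ≤ r) {X Y A B : K}
    (hA : A ∈ monomialSpan X Y Set.univ) (hB : B ∈ monomialSpan X Y Set.univ)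
    (ho : ∀ o : ℕ, A ∈ monomialSpan X Y {s | o ≤ s.1 + s.2} →
      B ∈ monomialSpan X Y {s | o ≤ s.1 + s.2} → r * o ≤ N) :
    ∃ o : ℕ, A ∈ monomialSpan X Y {s | o ≤ s.1 + s.2} ∧ B ∈ monomialSpan X Y {s | o ≤ s.1 + s.2} ∧
      ¬ (A ∈ monomialSpan X Y {s | o + 1 ≤ s.1 + s.2} ∧
        B ∈ monomialSpan X Y {s | o + 1 ≤ s.1 + s.2}) := by
  by_contra hcon
  push Not at hcon
  have h0 : ∀ {z : K}, z ∈ monomialSpan X Y Set.univ → z ∈ monomialSpan X Y {s | 0 ≤ s.1 + s.2} :=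
    fun hz => monomialSpan_mono (fun s _ => Nat.zero_le _) hz
  have h : ∀ o : ℕ, A ∈ monomialSpan X Y {s | o ≤ s.1 + s.2} ∧
      B ∈ monomialSpan X Y {s | o ≤ s.1 + s.2} := by
    intro o
    induction o with
    | zero => exact ⟨h0 hA, h0 hB⟩
    | succ o ih => exact hcon o ih.1 ih.2
  have h1 := ho (N + 1) (h _).1 (h _).2
  nlinarith

theorem local_bound (N r : ℕ) (hr : 1 ≤ r) (k : ℕ) : ∀ X Y A B : K, IsCoord X Y → w X < 1 →
    w Y < 1 → exp (-(k : ℤ)) < w (jac D E X Y) → w A = w B → A ≠ 0 →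
    A ∈ monomialSpan X Y Set.univ → B ∈ monomialSpan X Y Set.univ →
    (∀ o : ℕ, A ∈ monomialSpan X Y {s | o ≤ s.1 + s.2} →
      B ∈ monomialSpan X Y {s | o ≤ s.1 + s.2} → r * o ≤ N) →
    w (jac D E X Y) ^ N ≤ w A ^ r := by
  induction k with
  | zero =>
    intro X Y A B h hX hY hk
    have := hw.jac_le X Y hX.le hY.le
    rw [Nat.cast_zero, neg_zero, exp_zero] at hk
    exact absurd hk this.not_gt
  | succ k ih =>
    have main : ∀ X Y A B : K, IsCoord X Y → w X < 1 →
        w Y ≤ w X → exp (-((k + 1 : ℕ) : ℤ)) < w (jac D E X Y) → w A = w B → A ≠ 0 →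
        A ∈ monomialSpan X Y Set.univ → B ∈ monomialSpan X Y Set.univ →
        (∀ o : ℕ, A ∈ monomialSpan X Y {s | o ≤ s.1 + s.2} →
          B ∈ monomialSpan X Y {s | o ≤ s.1 + s.2} → r * o ≤ N) →
        w (jac D E X Y) ^ N ≤ w A ^ r := by
      intro X Y A B h hX hYX hk hAB hA0 hA hB ho
      obtain ⟨o, hAo, hBo, hmax⟩ := exists_maximal_order N r hr hA hB ho
      have hX0 : X ≠ 0 := fun h0 => h.transcendental_left (h0 ▸ isAlgebraic_zero)
      have hwX0 : w X ≠ 0 := (Valuation.ne_zero_iff _).2 hX0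
      set τ := X⁻¹ * Y with hτ
      have hY : Y = X * τ := by rw [hτ, mul_inv_cancel_left₀ hX0]
      have hwτ : w τ ≤ 1 := by
        rw [hτ, map_mul, map_inv₀, mul_comm, ← div_eq_mul_inv]
        exact (div_le_one₀ (zero_lt_iff.2 hwX0)).2 hYX
      have hJ : w (jac D E X Y) = w X * w (jac D E X τ) := by
        rw [hY, jac_mul_right, map_mul]
      have fwd : ∀ {z : K}, z ∈ monomialSpan X Y {s | o ≤ s.1 + s.2} →
          (X ^ o)⁻¹ * z ∈ monomialSpan X τ {s | s.2 ≤ s.1 + o} := by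
        intro z hz
        refine mul_mem_of_monomials (fun i j (hij : o ≤ i + j) => ?_) hz
        have e : (X ^ o)⁻¹ * (X ^ i * Y ^ j) = X ^ (i + j - o) * τ ^ j := by
          rw [inv_mul_eq_iff_eq_mul₀ (pow_ne_zero _ hX0), ← mul_assoc, ← pow_add,
            Nat.add_sub_cancel' hij, hY, mul_pow, pow_add, mul_assoc]
        rw [e]
        exact monomial_mem (show j ≤ i + j - o + o by omega)
      have bwd : ∀ {z : K}, z ∈ monomialSpan X τ ({s | s.2 ≤ s.1 + o} ∩ {s | 1 ≤ s.1}) →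
          X ^ o * z ∈ monomialSpan X Y {s | o + 1 ≤ s.1 + s.2} := by
        intro z hz
        refine mul_mem_of_monomials (fun i j (hij : j ≤ i + o ∧ 1 ≤ i) => ?_) hz
        have e : X ^ o * (X ^ i * τ ^ j) = X ^ (i + o - j) * Y ^ j := by
          have hYj : Y ^ j = X ^ j * τ ^ j := by rw [hY, mul_pow]
          rw [hYj, ← mul_assoc, ← mul_assoc, ← pow_add, ← pow_add,
            Nat.sub_add_cancel hij.1, add_comm]
        rw [e]
        exact monomial_mem (show o + 1 ≤ i + o - j + j by omega)
      have cancel : ∀ z, X ^ o * ((X ^ o)⁻¹ * z) = z := fun z =>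
        mul_inv_cancel_left₀ (pow_ne_zero _ hX0) z
      have hA1 := fwd hAo
      have hB1 := fwd hBo
      set A1 := (X ^ o)⁻¹ * A with hA1d
      set B1 := (X ^ o)⁻¹ * B with hB1d
      have hAB1 : w A1 = w B1 := by rw [hA1d, hB1d, map_mul, map_mul, hAB]
      have no : ¬ (A1 ∈ monomialSpan X τ ({s | s.2 ≤ s.1 + o} ∩ {s | 1 ≤ s.1}) ∧
          B1 ∈ monomialSpan X τ ({s | s.2 ≤ s.1 + o} ∩ {s | 1 ≤ s.1})) := by
        rintro ⟨h1, h2⟩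
        refine hmax ⟨?_, ?_⟩
        · rw [← cancel A]; exact bwd h1
        · rw [← cancel B]; exact bwd h2
      have hwA : w A = w X ^ o * w A1 := by rw [← map_pow, ← map_mul, hA1d, cancel]
      have hoN : r * o ≤ N := ho o hAo hBo
      have hXN : w X ^ N ≤ w X ^ (r * o) := pow_le_pow_right_of_le_one' hX.le hoN
      rcases hw.residue τ with ⟨e, he⟩ | h1 | h1
      · have hc : IsCoord X (τ - algebraMap ℂ K e) := by
          refine h.of_mem (IntermediateField.subset_adjoin _ _ (by simp)) ?_
          have : Y = X * ((τ - algebraMap ℂ K e) + algebraMap ℂ K e) := by rw [hY]; ring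
          rw [this]
          exact mul_mem (IntermediateField.subset_adjoin _ _ (by simp))
            (add_mem (IntermediateField.subset_adjoin _ _ (by simp))
              (IntermediateField.algebraMap_mem _ _))
        have hJ1 := hw.jac_sub_right X τ e
        have hk1 : exp (-(k : ℤ)) < w (jac D E X (τ - algebraMap ℂ K e)) := by
          rw [hJ1]
          rw [hJ] at hk
          by_contra hcon
          push Not at hcon
          have h2 : w X * w (jac D E X τ) ≤ exp (-1) * exp (-(k : ℤ)) := by
            refine mul_le_mul' ?_ hcon
            rw [← lt_mul_exp_iff_le (by simp), ← exp_add]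
            simpa using hX
          rw [← exp_add] at h2
          refine absurd (hk.trans_le h2) ?_
          have : -((k + 1 : ℕ) : ℤ) = -1 + -(k : ℤ) := by push_cast; ring
          rw [this]
          exact lt_irrefl _
        have tr : ∀ {z : K}, z ∈ monomialSpan X τ {s | s.2 ≤ s.1 + o} →
            z ∈ monomialSpan X (τ - algebraMap ℂ K e) {s | s.2 ≤ s.1 + o} := fun hz =>
          mem_translate_right e (fun i j j' (h1 : j ≤ i + o) h2 => h2.trans h1) hz
        have key := ih X (τ - algebraMap ℂ K e) A1 B1 hc hX he hk1 hAB1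
          (mul_ne_zero (inv_ne_zero (pow_ne_zero _ hX0)) hA0)
          (monomialSpan_mono (Set.subset_univ _) (tr hA1))
          (monomialSpan_mono (Set.subset_univ _) (tr hB1)) (fun o1 hA2 hB2 => by
            rcases Nat.lt_or_ge o o1 with hlt | hge
            · exfalso
              have back : ∀ {z : K}, z ∈ monomialSpan X τ {s | s.2 ≤ s.1 + o} →
                  z ∈ monomialSpan X (τ - algebraMap ℂ K e) {s | o1 ≤ s.1 + s.2} →
                  z ∈ monomialSpan X τ ({s | s.2 ≤ s.1 + o} ∩ {s | 1 ≤ s.1}) := by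
                intro z hz hz1
                have h3 := mem_inter hc (tr hz) hz1
                have h4 : z ∈ monomialSpan X (τ - algebraMap ℂ K e)
                    ({s | s.2 ≤ s.1 + o} ∩ {s | 1 ≤ s.1}) := by
                  refine monomialSpan_mono ?_ h3
                  rintro ⟨i, j⟩ ⟨h5, h6⟩
                  simp only [Set.mem_ofPred_eq] at h5 h6
                  exact ⟨h5, show 1 ≤ i by omega⟩
                have h5 := mem_translate_right (-e) (fun i j j' (h1 : j ≤ i + o ∧ 1 ≤ i) h2 =>
                  (⟨h2.trans h1.1, h1.2⟩ : j' ≤ i + o ∧ 1 ≤ i)) h4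
                rwa [map_neg, sub_neg_eq_add, sub_add_cancel] at h5
              exact no ⟨back hA1 hA2, back hB1 hB2⟩
            · exact (Nat.mul_le_mul_left r hge).trans hoN)
        rw [hJ1] at key
        rw [hJ, hwA, mul_pow, mul_pow, ← pow_mul, mul_comm o r]
        exact mul_le_mul' hXN key
      · exact absurd hwτ h1.not_ge
      · have hA11 : w A1 = 1 := by
          refine le_antisymm (hw.le_one_of_mem hX.le hwτ hA1) ?_
          by_contra hlt
          push Not at hlt
          exact no ⟨hw.mem_of_lt_one hX h1 hA1 hlt, hw.mem_of_lt_one hX h1 hB1 (hAB1 ▸ hlt)⟩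
        rw [hwA, hA11, mul_one, ← pow_mul, mul_comm o r]
        refine le_trans ?_ hXN
        refine pow_le_pow_left' ?_ N
        rw [hJ]
        exact mul_le_of_le_one_right' (hw.jac_le _ _ hX.le hwτ)
    intro X Y A B h hX hY hk hAB hA0 hA hB ho
    rcases le_total (w Y) (w X) with hle | hle
    · exact main X Y A B h hX hle hk hAB hA0 hA hB ho
    · have e1 : w (jac D E Y X) = w (jac D E X Y) := by rw [jac_swap, Valuation.map_neg]
      have e2 : ∀ (o : ℕ) z, z ∈ monomialSpan Y X {s | o ≤ s.1 + s.2} ↔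
          z ∈ monomialSpan X Y {s | o ≤ s.1 + s.2} := by
        intro o z
        rw [← monomialSpan_swap (S := {s | o ≤ s.1 + s.2})]
        simp [Set.preimage, add_comm]
      have e3 : ∀ z, z ∈ monomialSpan Y X Set.univ ↔ z ∈ monomialSpan X Y Set.univ := by
        intro z
        rw [← monomialSpan_swap (S := Set.univ), Set.preimage_univ]
      rw [← e1]
      exact main Y X A B h.symm hY hle (by rw [e1]; exact hk)
        hAB hA0 ((e3 _).2 hA) ((e3 _).2 hB) fun o h1 h2 => ho o ((e2 _ _).1 h1) ((e2 _ _).1 h2)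

end Place

end Places

section Bounds

open WithZero Polynomial IntermediateField IsDedekindDomain

variable {K : Type*} [Field K]

theorem valuation_aeval_le_one {F : Type*} [Field F] [Algebra F K] {w : Valuation K ℤᵐ⁰} {v : K}
    (hF : ∀ e : F, e ≠ 0 → w (algebraMap F K e) = 1) (hv : w v ≤ 1) (P : F[X]) :
    w (aeval v P) ≤ 1 := by
  rw [aeval_eq_sum_range]
  refine w.map_sum_le fun i _ => ?_
  rw [Algebra.smul_def, map_mul, map_pow]
  refine mul_le_one' ?_ (pow_le_one' hv i)
  by_cases h : P.coeff i = 0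
  · simp [h]
  · exact (hF _ h).le

theorem exists_coprime_of_valuation_le_one {F : Type*} [Field F] [Algebra F K]
    {w : Valuation K ℤᵐ⁰} {v z : K} (hF : ∀ e : F, e ≠ 0 → w (algebraMap F K e) = 1)
    (hv : w v ≤ 1) (hz : z ∈ adjoin F {v}) (hwz : w z ≤ 1) :
    ∃ P Q : F[X], w (aeval v Q) = 1 ∧ z = aeval v P / aeval v Q := by
  obtain ⟨P, Q, ⟨a, b, hab⟩, -, hQ0, h⟩ := exists_coprime_fraction hz
  have hle := valuation_aeval_le_one hF hv
  refine ⟨P, Q, le_antisymm (hle Q) ?_, eq_div_of_mul_eq hQ0 h⟩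
  by_contra hlt
  push Not at hlt
  have h1 : w (aeval v P) < 1 := by
    rw [← h, map_mul]
    exact mul_lt_one_of_nonneg_of_lt_one_right hwz zero_le hlt
  have h2 := congrArg (fun R => w (aeval v R)) hab
  simp only [map_add, map_mul, map_one] at h2
  refine absurd h2 (ne_of_lt ((w.map_add _ _).trans_lt (max_lt ?_ ?_)))
  · rw [map_mul]; exact mul_lt_one_of_nonneg_of_lt_one_right (hle a) zero_le h1
  · rw [map_mul]; exact mul_lt_one_of_nonneg_of_lt_one_right (hle b) zero_le hlt

variable [Algebra ℂ K]

theorem derivation_mem_adjoin_simple {u z : K} (D : Derivation ℤ K K)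
    (hD : ∀ c, D (algebraMap ℂ K c) = 0) (hu : D u ∈ adjoin ℂ {u}) (hz : z ∈ adjoin ℂ {u}) :
    D z ∈ adjoin ℂ {u} := by
  induction hz using adjoin_induction with
  | mem x hx => rw [Set.mem_singleton_iff.1 hx]; exact hu
  | algebraMap c => rw [hD]; exact zero_mem _
  | add x y hx hy h1 h2 => rw [map_add]; exact add_mem h1 h2
  | inv x hx h1 =>
    rw [Derivation.leibniz_inv, smul_eq_mul]
    exact mul_mem (neg_mem (pow_mem (inv_mem hx) 2)) h1
  | mul x y hx hy h1 h2 =>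
    rw [Derivation.leibniz, smul_eq_mul, smul_eq_mul]
    exact add_mem (mul_mem hx h2) (mul_mem hy h1)

theorem valuation_derivation_le_one {u v : K} {w : Valuation K ℤᵐ⁰}
    (hF : ∀ e : adjoin ℂ {u}, e ≠ 0 → w (e : K) = 1) (hv : w v ≤ 1) (D : Derivation ℤ K K)
    (hD : ∀ c, D (algebraMap ℂ K c) = 0) (hu : D u ∈ adjoin ℂ {u}) (hDv : w (D v) ≤ 1)
    {z : K} (hz : z ∈ adjoin (adjoin ℂ {u}) {v}) (hwz : w z ≤ 1) : w (D z) ≤ 1 := by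
  obtain ⟨P, Q, hQ, rfl⟩ := exists_coprime_of_valuation_le_one (F := adjoin ℂ {u}) hF hv hz hwz
  have hle := valuation_aeval_le_one (F := adjoin ℂ {u}) hF hv
  have hF' : ∀ e ∈ adjoin ℂ {u}, w e ≤ 1 := by
    intro e he
    by_cases h0 : e = 0
    · simp [h0]
    · exact (hF ⟨e, he⟩ (fun h => h0 (congrArg Subtype.val h))).le
  have hP : ∀ P : (adjoin ℂ {u})[X], w (D (aeval v P)) ≤ 1 := by
    intro P
    rw [aeval_eq_sum_range, map_sum]
    refine w.map_sum_le fun i _ => ?_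
    rw [Algebra.smul_def, Derivation.leibniz, Derivation.leibniz_pow]
    simp only [smul_eq_mul, nsmul_eq_mul]
    refine (w.map_add _ _).trans (max_le ?_ ?_)
    · rw [map_mul, map_mul, map_mul, map_pow]
      refine mul_le_one' (hF' _ (P.coeff i).2) (mul_le_one' ?_ (mul_le_one' (pow_le_one' hv _) hDv))
      exact hF' _ (_root_.natCast_mem _ i)
    · rw [map_mul, map_pow]
      exact mul_le_one' (pow_le_one' hv i)
        (hF' _ (derivation_mem_adjoin_simple D hD hu (P.coeff i).2))
  rw [Derivation.leibniz_div]
  simp only [smul_eq_mul]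
  rw [map_mul, map_pow, map_inv₀, hQ, inv_one, one_pow, one_mul]
  refine (w.map_sub _ _).trans (max_le ?_ ?_)
  · rw [map_mul]; exact mul_le_one' hQ.le (hP P)
  · rw [map_mul]; exact mul_le_one' (hle P) (hP Q)

theorem IsCoord.place {u v : K} (h : IsCoord u v) {w : Valuation K ℤᵐ⁰}
    (hF : ∀ e : adjoin ℂ {u}, e ≠ 0 → w (e : K) = 1) (hv : w v ≤ 1) {D E : Derivation ℤ K K}
    (hD : ∀ c, D (algebraMap ℂ K c) = 0) (hE : ∀ c, E (algebraMap ℂ K c) = 0)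
    (hDu : D u ∈ adjoin ℂ {u}) (hEu : E u ∈ adjoin ℂ {u}) (hDv : w (D v) ≤ 1)
    (hEv : w (E v) ≤ 1) : Place u D E w where
  const c hc := by
    have := hF (algebraMap ℂ _ c) (by simpa using hc)
    exact this
  base := by
    refine hF ⟨u, mem_adjoin_simple_self ℂ u⟩ fun h0 => ?_
    have h1 : u = 0 := congrArg Subtype.val h0
    exact h.transcendental_left (h1 ▸ isAlgebraic_zero)
  jac_le X Y hX hY := by
    have key := fun (T : Derivation ℤ K K) h1 h2 h3 (z : K) hz =>
      valuation_derivation_le_one hF hv T h1 h2 h3 (h.mem_adjoin_adjoin z) hz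
    refine (w.map_sub _ _).trans (max_le ?_ ?_) <;> rw [map_mul]
    · exact mul_le_one' (key D hD hDu hDv X hX) (key E hE hEu hEv Y hY)
    · exact mul_le_one' (key E hE hEu hEv X hX) (key D hD hDu hDv Y hY)
  left := hD
  right := hE

theorem IsCoord.exists_aeval_eq {u v : K} (h : IsCoord u v) {z : K}
    (hz : ∀ w : Valuation K ℤᵐ⁰, (∀ e : adjoin ℂ {u}, e ≠ 0 → w (e : K) = 1) → w v ≤ 1 → w z ≤ 1) :
    ∃ P : (adjoin ℂ {u})[X], aeval v P = z := by
  let F := adjoin ℂ {u}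
  let _ : Algebra F[X] K := (aeval v : F[X] →ₐ[F] K).toRingHom.toAlgebra
  have hm : ∀ P : F[X], algebraMap F[X] K P = aeval v P := fun P => rfl
  have hinj : Function.Injective (algebraMap F[X] K) :=
    transcendental_iff_injective.1 h.transcendental_adjoin
  have : FaithfulSMul F[X] K := (faithfulSMul_iff_algebraMap_injective _ _).2 hinj
  have : IsFractionRing F[X] K := by
    refine IsFractionRing.of_field _ _ fun z => ?_
    obtain ⟨P, Q, -, -, hQ0, h1⟩ := exists_coprime_fraction (h.mem_adjoin_adjoin z)
    exact ⟨P, Q, eq_div_of_mul_eq hQ0 h1⟩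
  obtain ⟨P, hP⟩ := HeightOneSpectrum.mem_integers_of_valuation_le_one (R := F[X]) K z fun p => by
    have hle : ∀ P : F[X], p.valuation K (aeval v P) ≤ 1 := fun P => p.valuation_le_one P
    refine hz _ (fun e he => ?_) (by simpa using hle X)
    have h1 : ∀ e : F, p.valuation K (e : K) ≤ 1 := fun e => by
      have := hle (C e)
      rwa [aeval_C] at this
    refine le_antisymm (h1 e) ?_
    have h2 := h1 e⁻¹
    rw [show ((e⁻¹ : F) : K) = (e : K)⁻¹ from rfl, map_inv₀] at h2
    have h3 : p.valuation K (e : K) ≠ 0 := (Valuation.ne_zero_iff _).2 (by simpa using he)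
    exact (inv_le_one₀ (zero_lt_iff.2 h3)).1 h2
  exact ⟨P, hP⟩

theorem IsCoord.jac_ne_zero {u v p q : K} (h' : IsCoord p q)
    {D E : Derivation ℤ K K} (hD : ∀ c, D (algebraMap ℂ K c) = 0)
    (hE : ∀ c, E (algebraMap ℂ K c) = 0) (hDu : D u = 1) (hEu : E u = 0) (hDv : D v = 0)
    (hEv : E v = 1) : jac D E p q ≠ 0 := by
  intro hJ
  rw [jac, sub_eq_zero] at hJ
  have key : ∀ r s : K, r * E p - s * D p = 0 → r * E q - s * D q = 0 → s = 0 ∧ r = 0 := by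
    intro r s h1 h2
    have : r • E - s • D = 0 := by
      refine h'.derivation_ext (fun c => by simp [hD, hE]) ?_ ?_
      · simpa using h1
      · simpa using h2
    have e1 := DFunLike.congr_fun this u
    have e2 := DFunLike.congr_fun this v
    simp [hDu, hEu, hDv, hEv] at e1 e2
    exact ⟨e1, e2⟩
  have h1 := key (D p) (E p) (by ring) (by rw [hJ]; ring)
  have h2 := key (D q) (E q) (by linear_combination -hJ) (by ring)
  have h3 := key 1 0 (by simp [h1.1]) (by simp [h2.1])
  exact one_ne_zero h3.2

omit [Algebra ℂ K] in
theorem absurd_reflect {F : Type*} [Field F] [Algebra F K] {v : K} (hv : Transcendental F v)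
    {P Q : F[X]} {n : ℕ} (hn : 1 ≤ n) (hP : P ≠ 0)
    (h : v ^ n * aeval v P = aeval v⁻¹ Q) : False := by
  have hv0 : v ≠ 0 := fun h0 => hv (h0 ▸ isAlgebraic_zero)
  let i : Invertible v⁻¹ := ⟨v, mul_inv_cancel₀ hv0, inv_mul_cancel₀ hv0⟩
  have h1 : aeval v (reflect Q.natDegree Q) * v⁻¹ ^ Q.natDegree = aeval v⁻¹ Q :=
    eval₂_reflect_mul_pow (algebraMap F K) v⁻¹ Q.natDegree Q le_rfl
  have h2 : aeval v (X ^ (n + Q.natDegree) * P) = aeval v (reflect Q.natDegree Q) := by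
    rw [← h, inv_pow, mul_inv_eq_iff_eq_mul₀ (pow_ne_zero _ hv0)] at h1
    rw [h1, map_mul, aeval_X_pow]
    ring
  have h3 := congrArg natDegree (transcendental_iff_injective.1 hv h2)
  rw [natDegree_X_pow_mul _ hP] at h3
  have h4 : (reflect Q.natDegree Q).natDegree ≤ Q.natDegree := by
    rw [natDegree_le_iff_coeff_eq_zero]
    intro m hm
    rw [coeff_reflect, revAt_eq_self_of_lt hm, coeff_eq_zero_of_natDegree_lt hm]
  omega

/-- A uniform bound for a Jacobian determinant at all places is impossible. -/
theorem IsCoord.no_bound {u v : K} (h : IsCoord u v) {p q A : K} (h' : IsCoord p q) (hA : A ≠ 0)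
    (N r : ℕ) (hN : 1 ≤ N)
    (H : ∀ (D E : Derivation ℤ K K) (w : Valuation K ℤᵐ⁰), Place u D E w →
      w (jac D E p q) ^ N ≤ w A ^ r) : False := by
  obtain ⟨D, hD, hDu, hDv⟩ := h.exists_derivation 0 1 0
  obtain ⟨E, hE, hEu, hEv⟩ := h.exists_derivation 0 0 1
  simp only [Derivation.coe_zero, Pi.zero_apply, map_zero] at hD hE
  have hJ := h'.jac_ne_zero hD hE hDu hEu hDv hEv
  have hv0 : v ≠ 0 := fun h0 => h.transcendental_right (h0 ▸ isAlgebraic_zero)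
  set J := jac D E p q with hJd
  have hR0 : J ^ N / A ^ r ≠ 0 := div_ne_zero (pow_ne_zero _ hJ) (pow_ne_zero _ hA)
  have hi : IsCoord u v⁻¹ := h.of_mem (subset_adjoin _ _ (by simp)) (by
    have : (v⁻¹)⁻¹ ∈ adjoin ℂ {u, v⁻¹} := inv_mem (subset_adjoin _ _ (by simp))
    rwa [inv_inv] at this)
  obtain ⟨P, hP⟩ := h.exists_aeval_eq (z := J ^ N / A ^ r) fun w hF hv => by
    have hw := h.place hF hv hD hE (by rw [hDu]; exact one_mem _) (by rw [hEu]; exact zero_mem _)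
      (by simp [hDv]) (by simp [hEv])
    rw [map_div₀, map_pow, map_pow]
    exact (div_le_one₀ (zero_lt_iff.2 (pow_ne_zero _ ((Valuation.ne_zero_iff _).2 hA)))).2
      (H D E w hw)
  have hJ' : jac D (v ^ 2 • E) p q = v ^ 2 * J := by
    simp only [hJd, jac, Derivation.smul_apply, smul_eq_mul]; ring
  obtain ⟨Q, hQ⟩ := hi.exists_aeval_eq (z := (v ^ 2 * J) ^ N / A ^ r) fun w hF hv => by
    have hw := hi.place hF hv hD (E := v ^ 2 • E) (by simp [hE]) (by rw [hDu]; exact one_mem _)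
      (by simp [hEu]) (by simp [Derivation.leibniz_inv, hDv])
      (by simp [Derivation.leibniz_inv, hEv, hv0])
    rw [map_div₀, map_pow, map_pow]
    refine (div_le_one₀ (zero_lt_iff.2 (pow_ne_zero _ ((Valuation.ne_zero_iff _).2 hA)))).2 ?_
    rw [← hJ']
    exact H _ _ w hw
  refine absurd_reflect h.transcendental_adjoin (P := P) (Q := Q) (n := 2 * N) (by omega)
    (by rintro rfl; exact hR0 (by rw [← hP, map_zero])) ?_
  rw [hP, hQ]
  ring

end Bounds

section Moebius

open Polynomial IntermediateField

variable {F E : Type*} [Field F] [Field E] [Algebra F E]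

/-- Two generators of a simple transcendental extension differ by a homography. -/
theorem exists_homography {t z : E} (ht : Transcendental F t) (hz : z ∈ adjoin F {t})
    (htz : t ∈ adjoin F {z}) : ∃ a b c d : F, a * d - b * c ≠ 0 ∧
      z * (algebraMap F E c * t + algebraMap F E d) = algebraMap F E a * t + algebraMap F E b := by
  let e := RatFunc.algEquivOfTranscendental t ht
  let φ : RatFunc F →ₐ[F] E := (adjoin F {t}).val.comp e.toAlgHom
  have hφX : φ RatFunc.X = t := RatFunc.algEquivOfTranscendental_X t ht
  have hφ : ∀ P : F[X], φ (algebraMap F[X] (RatFunc F) P) = aeval t P := fun P => by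
    have := congrArg Subtype.val (RatFunc.algEquivOfTranscendental_algebraMap t ht P)
    exact this.trans (by simp)
  obtain ⟨f, hf⟩ : ∃ f, φ f = z := ⟨e.symm ⟨z, hz⟩, by simp [φ]⟩
  have hX : RatFunc.X ∈ adjoin F {f} := by
    rw [mem_adjoin_simple_iff] at htz ⊢
    obtain ⟨r, s, h⟩ := htz
    refine ⟨r, s, φ.toRingHom.injective ?_⟩
    simp only [AlgHom.toRingHom_eq_coe, RingHom.coe_coe]
    rw [hφX, map_div₀, ← aeval_algHom_apply, ← aeval_algHom_apply, hf, h]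
  have htop : adjoin F {f} = ⊤ := by
    rw [eq_top_iff, ← RatFunc.adjoin_X, adjoin_simple_le_iff]
    exact hX
  have hdeg := RatFunc.finrank_eq_max_natDegree f
  rw [htop, IntermediateField.finrank_top] at hdeg
  have h1 : f.num.natDegree ≤ 1 := hdeg ▸ le_max_left _ _
  have h2 : f.denom.natDegree ≤ 1 := hdeg ▸ le_max_right _ _
  obtain ⟨a, b, hab⟩ := exists_eq_X_add_C_of_natDegree_le_one h1
  obtain ⟨c, d, hcd⟩ := exists_eq_X_add_C_of_natDegree_le_one h2
  have key : z * (algebraMap F E c * t + algebraMap F E d) =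
      algebraMap F E a * t + algebraMap F E b := by
    have h3 := congrArg φ
      ((div_eq_iff (RatFunc.algebraMap_ne_zero f.denom_ne_zero)).1 (RatFunc.num_div_denom f))
    rw [map_mul, hφ, hφ, hf, hab, hcd] at h3
    simpa using h3.symm
  refine ⟨a, b, c, d, fun hdet => ?_, key⟩
  have hne : ∀ x y : F, algebraMap F E x * t + algebraMap F E y = 0 → x = 0 ∧ y = 0 := by
    intro x y hxy
    have : C x * X + C y = 0 := by
      by_contra h0
      exact ht ⟨_, h0, by simpa using hxy⟩
    have e1 := congrArg (fun P => coeff P 1) this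
    have e2 := congrArg (fun P => coeff P 0) this
    simp at e1 e2
    exact ⟨e1, e2⟩
  have hcd0 : ¬ (c = 0 ∧ d = 0) := by
    rintro ⟨rfl, rfl⟩
    exact f.denom_ne_zero (by simpa using hcd)
  have hzr : ∃ r : F, z = algebraMap F E r := by
    have hu0 : algebraMap F E c * t + algebraMap F E d ≠ 0 := fun h0 => hcd0 (hne _ _ h0)
    have hdet' : algebraMap F E a * algebraMap F E d = algebraMap F E b * algebraMap F E c := by
      rw [← map_mul, ← map_mul, sub_eq_zero.1 hdet]
    by_cases hc : c = 0
    · subst hc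
      have hd : d ≠ 0 := fun hd => hcd0 ⟨rfl, hd⟩
      have ha : a = 0 := by simpa [hd] using hdet
      subst ha
      refine ⟨b / d, ?_⟩
      simp only [map_zero, zero_mul, zero_add] at key
      rw [map_div₀, eq_div_iff (by simpa using hd), key]
    · refine ⟨a / c, mul_right_cancel₀ hu0 (key.trans ?_)⟩
      have : algebraMap F E c ≠ 0 := by simpa using hc
      rw [map_div₀]
      field_simp
      linear_combination -hdet'
  obtain ⟨r, rfl⟩ := hzr
  have hbot : adjoin F {algebraMap F E r} = ⊥ := by
    rw [adjoin_simple_eq_bot_iff]; exact IntermediateField.algebraMap_mem _ _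
  rw [hbot, mem_bot] at htz
  obtain ⟨s, rfl⟩ := htz
  exact ht (isAlgebraic_algebraMap s)

end Moebius

section Good

open Polynomial IntermediateField

variable {K : Type*} [Field K] [Algebra ℂ K]

/-- A class of coordinate systems closed under the elementary coordinate changes. -/
structure GoodClass (Good : K → K → Prop) : Prop where
  coord : ∀ {p q}, Good p q → IsCoord p q
  swap : ∀ {p q}, Good p q → Good q p
  affine : ∀ {p q r b}, Good p q → r ∈ adjoin ℂ {p} → r ≠ 0 → b ∈ adjoin ℂ {p} →
    Good p (r * q + b)
  inv : ∀ {p q}, Good p q → Good p q⁻¹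

namespace IsCoord

variable {p q : K} (h : IsCoord p q)
include h

theorem left_ne_zero : p ≠ 0 := fun h0 => h.transcendental_left (h0 ▸ isAlgebraic_zero)

theorem right_ne_zero : q ≠ 0 := fun h0 => h.transcendental_right (h0 ▸ isAlgebraic_zero)

end IsCoord

namespace GoodClass

variable {Good : K → K → Prop} (hg : GoodClass Good) {p q : K}
include hg

theorem translate_right (h : Good p q) (c : ℂ) : Good p (q - algebraMap ℂ K c) := by
  have := hg.affine h (one_mem _) one_ne_zero
    (IntermediateField.algebraMap_mem (adjoin ℂ {p}) (-c))
  rwa [one_mul, map_neg, ← sub_eq_add_neg] at this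

theorem translate_left (h : Good p q) (c : ℂ) : Good (p - algebraMap ℂ K c) q :=
  hg.swap (hg.translate_right (hg.swap h) c)

theorem mul_zpow (h : Good p q) (m : ℤ) : Good p (q * p ^ m) := by
  have := hg.affine h (zpow_mem (mem_adjoin_simple_self ℂ p) m)
    (zpow_ne_zero m (hg.coord h).left_ne_zero) (zero_mem _)
  rwa [add_zero, mul_comm] at this

theorem inv_left (h : Good p q) : Good p⁻¹ q := hg.swap (hg.inv (hg.swap h))

theorem homography (h : Good p q) {z : K} {a b c d : adjoin ℂ {p}} (hdet : a * d - b * c ≠ 0)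
    (hz : z * (c * q + d) = a * q + b) : Good p z := by
  have ht := (hg.coord h).transcendental_adjoin
  have hne : (c : K) * q + d ≠ 0 := by
    intro h0
    have h1 : C c * X + C d = 0 := by
      by_contra h2
      exact ht ⟨_, h2, by simpa using h0⟩
    have e1 := congrArg (fun P => coeff P 1) h1
    have e2 := congrArg (fun P => coeff P 0) h1
    simp at e1 e2
    simp [e1, e2] at hdet
  have hdet' : (a : K) * d - b * c ≠ 0 := fun h0 => hdet (Subtype.ext h0)
  by_cases hc : (c : K) = 0
  · rw [hc, mul_zero, sub_zero] at hdet'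
    rw [hc, zero_mul, zero_add] at hz
    have hd : (d : K) ≠ 0 := right_ne_zero_of_mul hdet'
    have ha : (a : K) ≠ 0 := left_ne_zero_of_mul hdet'
    have := hg.affine h (div_mem a.2 d.2) (div_ne_zero ha hd) (div_mem b.2 d.2)
    convert this using 1
    field_simp
    exact hz
  · have h1 := hg.affine (hg.inv (hg.affine h c.2 hc d.2))
      (div_mem (sub_mem (mul_mem b.2 c.2) (mul_mem a.2 d.2)) c.2)
      (div_ne_zero (by rw [← neg_sub]; exact neg_ne_zero.2 hdet') hc) (div_mem a.2 c.2)
    convert h1 using 1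
    refine mul_right_cancel₀ hne (hz.trans ?_)
    rw [add_mul, mul_assoc, inv_mul_cancel₀ hne]
    field_simp
    ring

end GoodClass

/-- Exponents `(i, j)` with `j ≤ n` and `i + m j ≤ b`. -/
def region (n : ℕ) (m b : ℤ) : Set (ℕ × ℕ) := {s | s.2 ≤ n ∧ (s.1 : ℤ) + m * s.2 ≤ b}

/-- `u` is a quotient of two polynomials in `p, q` supported in a region. -/
def HasData (u p q : K) (n : ℕ) (m b : ℤ) : Prop :=
  ∃ A B, A ∈ monomialSpan p q (region n m b) ∧ B ∈ monomialSpan p q (region n m b) ∧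
    B ≠ 0 ∧ A = u * B

section Charts

variable {u p q A B z : K} {n : ℕ} {m b : ℤ}

theorem HasData.of_mul {c : K} (hc : c ≠ 0) (hA : c * A ∈ monomialSpan p q (region n m b))
    (hB : c * B ∈ monomialSpan p q (region n m b)) (hB0 : B ≠ 0) (h : A = u * B) :
    HasData u p q n m b :=
  ⟨c * A, c * B, hA, hB, mul_ne_zero hc hB0, by rw [h]; ring⟩

theorem chart_left_mem (hp : p ≠ 0) (hz : z ∈ monomialSpan p q (region n m b)) :
    p ^ (-b) * z ∈ monomialSpan p⁻¹ (q * p ^ (-m)) (region n m b) := by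
  refine mul_mem_of_monomials (fun i j (hij : j ≤ n ∧ (i : ℤ) + m * j ≤ b) => ?_) hz
  obtain ⟨k, hk⟩ := Int.eq_ofNat_of_zero_le (sub_nonneg.2 hij.2)
  have e : p ^ (-b) * (p ^ i * q ^ j) = p⁻¹ ^ k * (q * p ^ (-m)) ^ j := by
    rw [mul_pow, ← zpow_natCast p i, ← zpow_natCast p⁻¹ k, ← zpow_natCast (p ^ (-m)) j, ← zpow_mul,
      inv_zpow', mul_comm (q ^ j), ← mul_assoc, ← mul_assoc, ← zpow_add₀ hp, ← zpow_add₀ hp,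
      ← hk]
    congr 2
    ring
  rw [e]
  exact monomial_mem (show j ≤ n ∧ (k : ℤ) + m * j ≤ b from ⟨hij.1, by rw [← hk]; omega⟩)

theorem chart_right_mem (hq : q ≠ 0) (hz : z ∈ monomialSpan p q (region n m b)) :
    (q ^ n)⁻¹ * z ∈ monomialSpan p q⁻¹ (region n (-m) (b - m * n)) := by
  refine mul_mem_of_monomials (fun i j (hij : j ≤ n ∧ (i : ℤ) + m * j ≤ b) => ?_) hz
  obtain ⟨l, hl⟩ := Nat.exists_eq_add_of_le hij.1
  have e : (q ^ n)⁻¹ * (p ^ i * q ^ j) = p ^ i * q⁻¹ ^ l := by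
    rw [hl, pow_add, inv_pow]; field_simp
  rw [e]
  refine monomial_mem (show l ≤ n ∧ (i : ℤ) + -m * l ≤ b - m * n from ⟨by omega, ?_⟩)
  rw [hl]
  push_cast
  linarith [hij.2]

theorem chart_infinity_mem (hq : q ≠ 0) {d : ℕ} (hz : z ∈ monomialSpan p q {s | s.1 + s.2 ≤ d}) :
    (q ^ d)⁻¹ * z ∈ monomialSpan (q⁻¹) (p * q⁻¹) {s | s.1 + s.2 ≤ d} := by
  refine mul_mem_of_monomials (fun i j (hij : i + j ≤ d) => ?_) hz
  obtain ⟨l, hl⟩ := Nat.exists_eq_add_of_le hij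
  have e : (q ^ d)⁻¹ * (p ^ i * q ^ j) = q⁻¹ ^ l * (p * q⁻¹) ^ i := by
    rw [hl, pow_add, pow_add, mul_pow, inv_pow, inv_pow]; field_simp
  rw [e]
  exact monomial_mem (show l + i ≤ d by omega)

theorem blowup_mem (hp : p ≠ 0) {o : ℕ}
    (hz : z ∈ monomialSpan p q (region n m b ∩ {s | o ≤ s.1 + s.2})) :
    (p ^ o)⁻¹ * z ∈ monomialSpan p (q * p ^ (-1 : ℤ)) (region n (m - 1) (b - o)) := by
  refine mul_mem_of_monomials
    (fun i j (hij : (j ≤ n ∧ (i : ℤ) + m * j ≤ b) ∧ o ≤ i + j) => ?_) hz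
  obtain ⟨l, hl⟩ := Nat.exists_eq_add_of_le hij.2
  have e : (p ^ o)⁻¹ * (p ^ i * q ^ j) = p ^ l * (q * p ^ (-1 : ℤ)) ^ j := by
    rw [zpow_neg_one, inv_mul_eq_iff_eq_mul₀ (pow_ne_zero _ hp), ← mul_assoc, ← pow_add, ← hl,
      pow_add, mul_pow, inv_pow]
    field_simp
  rw [e]
  refine monomial_mem (show j ≤ n ∧ (l : ℤ) + (m - 1) * j ≤ b - o from ⟨hij.1.1, ?_⟩)
  have : (i : ℤ) + j = o + l := by exact_mod_cast hl
  linarith [hij.1.2]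

theorem blowup_plane_mem (hp : p ≠ 0) {o d : ℕ}
    (hz : z ∈ monomialSpan p q ({s | s.1 + s.2 ≤ d} ∩ {s | o ≤ s.1 + s.2})) :
    (p ^ o)⁻¹ * z ∈ monomialSpan (q * p ^ (-1 : ℤ)) p (region (d - o) 0 d) := by
  refine mul_mem_of_monomials
    (fun i j (hij : i + j ≤ d ∧ o ≤ i + j) => ?_) hz
  obtain ⟨l, hl⟩ := Nat.exists_eq_add_of_le hij.2
  have e : (p ^ o)⁻¹ * (p ^ i * q ^ j) = (q * p ^ (-1 : ℤ)) ^ j * p ^ l := by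
    rw [zpow_neg_one, inv_mul_eq_iff_eq_mul₀ (pow_ne_zero _ hp), mul_comm (_ ^ j), ← mul_assoc,
      ← pow_add, ← hl, pow_add, mul_pow, inv_pow]
    field_simp
  rw [e]
  refine monomial_mem (show l ≤ d - o ∧ (j : ℤ) + 0 * l ≤ d from ⟨by omega, ?_⟩)
  have := hij.1
  omega

theorem div_left_mem (hp : p ≠ 0)
    (hz : z ∈ monomialSpan p q (region n m b ∩ {s | 1 ≤ s.1})) :
    p⁻¹ * z ∈ monomialSpan p q (region n m (b - 1)) := by
  refine mul_mem_of_monomials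
    (fun i j (hij : (j ≤ n ∧ (i : ℤ) + m * j ≤ b) ∧ 1 ≤ i) => ?_) hz
  obtain ⟨l, hl⟩ := Nat.exists_eq_add_of_le hij.2
  have e : p⁻¹ * (p ^ i * q ^ j) = p ^ l * q ^ j := by
    rw [hl, pow_add]; field_simp
  rw [e]
  refine monomial_mem (show j ≤ n ∧ (l : ℤ) + m * j ≤ b - 1 from ⟨hij.1.1, ?_⟩)
  have : (i : ℤ) = 1 + l := by exact_mod_cast hl
  linarith [hij.1.2]

theorem div_right_mem (hq : q ≠ 0) (hb : b < 0) (hz : z ∈ monomialSpan p q (region n m b)) :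
    q⁻¹ * z ∈ monomialSpan p q (region (n - 1) m (b - m)) := by
  refine mul_mem_of_monomials
    (fun i j (hij : j ≤ n ∧ (i : ℤ) + m * j ≤ b) => ?_) hz
  have hj : 1 ≤ j := by
    by_contra h0
    have h1 : j = 0 := by omega
    subst h1
    have := hij.2
    push_cast at this
    omega
  obtain ⟨l, hl⟩ := Nat.exists_eq_add_of_le hj
  have e : q⁻¹ * (p ^ i * q ^ j) = p ^ i * q ^ l := by
    rw [hl, pow_add]; field_simp
  rw [e]
  refine monomial_mem (show l ≤ n - 1 ∧ (i : ℤ) + m * l ≤ b - m from ⟨by omega, ?_⟩)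
  have h2 := hij.2
  rw [hl] at h2
  push_cast at h2
  linarith

end Charts

section Polynomials

variable {u p q z : K} {n : ℕ}

theorem exists_aeval_of_mem (hz : z ∈ monomialSpan p q {s | s.2 ≤ n}) :
    ∃ P : (adjoin ℂ {p})[X], P.natDegree ≤ n ∧ aeval q P = z := by
  refine Submodule.span_induction (p := fun z _ => ∃ P : (adjoin ℂ {p})[X], P.natDegree ≤ n ∧
    aeval q P = z) ?_ ⟨0, by simp, by simp⟩ ?_ ?_ hz
  · rintro _ ⟨⟨i, j⟩, hs, rfl⟩
    refine ⟨C (AdjoinSimple.gen ℂ p ^ i) * X ^ j, (natDegree_C_mul_X_pow_le _ _).trans hs, ?_⟩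
    simp
  · rintro _ _ _ _ ⟨P, hP, rfl⟩ ⟨Q, hQ, rfl⟩
    exact ⟨P + Q, (natDegree_add_le _ _).trans (max_le hP hQ), by simp⟩
  · rintro c _ _ ⟨P, hP, rfl⟩
    refine ⟨C (algebraMap ℂ _ c) * P, (natDegree_C_mul_le _ _).trans hP, ?_⟩
    rw [map_mul, aeval_C, Algebra.smul_def]
    rfl

theorem aeval_mul_mem (s : ℂ[X]) (hz : z ∈ monomialSpan p q {s | s.2 ≤ n}) :
    aeval p s * z ∈ monomialSpan p q {s | s.2 ≤ n} := by
  refine mul_mem_of_monomials (fun i j (hij : j ≤ n) => ?_) hz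
  rw [aeval_eq_sum_range, Finset.sum_mul]
  refine Submodule.sum_mem _ fun k _ => ?_
  rw [smul_mul_assoc, ← mul_assoc, ← pow_add]
  exact Submodule.smul_mem _ _ (monomial_mem hij)

theorem exists_clear_denominators (P : (adjoin ℂ {p})[X]) (hP : P.natDegree ≤ n) :
    ∃ s : ℂ[X], aeval p s ≠ 0 ∧ aeval p s * aeval q P ∈ monomialSpan p q {s | s.2 ≤ n} := by
  rw [aeval_eq_sum_range]
  refine Finset.sum_induction _ (fun z => ∃ s : ℂ[X], aeval p s ≠ 0 ∧
    aeval p s * z ∈ monomialSpan p q {s | s.2 ≤ n}) ?_ ⟨1, by simp, by simp⟩ ?_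
  · rintro a b ⟨s, hs, hs'⟩ ⟨t, ht, ht'⟩
    refine ⟨s * t, by rw [map_mul]; exact mul_ne_zero hs ht, ?_⟩
    have := add_mem (aeval_mul_mem t hs') (aeval_mul_mem s ht')
    convert this using 1
    rw [map_mul]; ring
  · intro i hi
    have hin : i ≤ n := by
      have := Finset.mem_range.1 hi
      omega
    obtain ⟨r, s, hrs⟩ := (mem_adjoin_simple_iff ℂ _).1 (P.coeff i).2
    rw [Algebra.smul_def, show algebraMap (adjoin ℂ {p}) K (P.coeff i) = (P.coeff i : K) from rfl,
      hrs]
    have hmem : q ^ i ∈ monomialSpan p q {s | s.2 ≤ n} := by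
      have := monomial_mem (p := p) (q := q) (i := 0) (j := i) (S := {s | s.2 ≤ n}) hin
      simpa using this
    by_cases hs : aeval p s = 0
    · exact ⟨1, by simp, by simp [hs]⟩
    · refine ⟨s, hs, ?_⟩
      rw [← mul_assoc, mul_div_cancel₀ _ hs]
      exact aeval_mul_mem r hmem

theorem hasData_of_aeval {P Q : (adjoin ℂ {p})[X]} (hP : P.natDegree ≤ n) (hQ : Q.natDegree ≤ n)
    (hQ0 : aeval q Q ≠ 0) (h : aeval q P = u * aeval q Q) : ∃ b, HasData u p q n 0 b := by
  obtain ⟨s, hs, hs'⟩ := exists_clear_denominators (q := q) P hP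
  obtain ⟨t, ht, ht'⟩ := exists_clear_denominators (q := q) Q hQ
  obtain ⟨a, ha⟩ := exists_bound (aeval_mul_mem t hs')
  obtain ⟨b, hb⟩ := exists_bound (aeval_mul_mem s ht')
  have hsub : ∀ c, c ≤ max a b → {s : ℕ × ℕ | s.2 ≤ n} ∩ {s | s.1 ≤ c} ⊆
      region n 0 ((max a b : ℕ) : ℤ) := by
    rintro c hc ⟨i, j⟩ ⟨h1, h2⟩
    simp only [Set.mem_ofPred_eq] at h1 h2
    exact ⟨h1, show (i : ℤ) + 0 * j ≤ _ by rw [zero_mul, add_zero]; exact_mod_cast h2.trans hc⟩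
  refine ⟨_, HasData.of_mul (A := aeval q P) (mul_ne_zero hs ht)
    (monomialSpan_mono (hsub a (le_max_left _ _)) ?_)
    (monomialSpan_mono (hsub b (le_max_right _ _)) ?_) hQ0 h⟩
  · convert ha using 1; ring
  · convert hb using 1; ring

end Polynomials

end Good

section Noether

open Polynomial IntermediateField WithZero

variable {K : Type*} [Field K] [Algebra ℂ K]

/-- The degree `n` is minimal for presentations of `u`. -/
structure IsMinimalDegree (Good : K → K → Prop) (u : K) (n : ℕ) : Prop where
  good : GoodClass Good
  pos : 1 ≤ n
  minN : ∀ {p q n' m b}, Good p q → HasData u p q n' m b → n ≤ n'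

/-- The invariants `n` and `ρ` are minimal for presentations of `u`. -/
structure IsMinimalData (Good : K → K → Prop) (u : K) (n : ℕ) (ρ : ℤ) : Prop extends
    IsMinimalDegree Good u n where
  minR : ∀ {p q m b}, Good p q → HasData u p q n m b → ρ ≤ 2 * b - m * n

theorem one_le_of_isCoprime {p q : K} {w : Valuation K ℤᵐ⁰}
    (hp : ∀ P : ℂ[X], P ≠ 0 → w (aeval p P) = 1) (hq : w q ≤ 1)
    {P Q : (adjoin ℂ {p})[X]} (hPQ : IsCoprime P Q) (h : w (aeval q P) = w (aeval q Q)) :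
    1 ≤ w (aeval q P) := by
  have hF : ∀ e : adjoin ℂ {p}, e ≠ 0 → w (algebraMap _ K e) = 1 := by
    intro e he
    obtain ⟨r, s, hrs⟩ := (mem_adjoin_simple_iff ℂ _).1 e.2
    have he' : (e : K) ≠ 0 := fun h0 => he (Subtype.ext h0)
    rw [show algebraMap (adjoin ℂ {p}) K e = (e : K) from rfl, hrs, map_div₀, hp, hp, div_one]
    · rintro rfl; simp at hrs; exact he' (by simpa using hrs)
    · rintro rfl; simp at hrs; exact he' (by simpa using hrs)
  have hle := valuation_aeval_le_one hF hq
  obtain ⟨a, b, hab⟩ := hPQ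
  by_contra hlt
  push Not at hlt
  have h2 := congrArg (fun R => w (aeval q R)) hab
  simp only [map_add, map_mul, map_one] at h2
  refine absurd h2 (ne_of_lt ((w.map_add _ _).trans_lt (max_lt ?_ ?_)))
  · rw [map_mul]; exact mul_lt_one_of_nonneg_of_lt_one_right (hle a) zero_le hlt
  · rw [map_mul]; exact mul_lt_one_of_nonneg_of_lt_one_right (hle b) zero_le (h ▸ hlt)

theorem Place.local_bound' {u X Y A B : K} {D E : Derivation ℤ K K} {w : Valuation K ℤᵐ⁰}
    (hw : Place u D E w) {N r : ℕ} (hN : 1 ≤ N) (hr : 1 ≤ r) (h : IsCoord X Y) (hX : w X < 1)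
    (hY : w Y < 1) (hAB : w A = w B) (hA : A ≠ 0) {S : Set (ℕ × ℕ)}
    (hAS : A ∈ monomialSpan X Y S) (hBS : B ∈ monomialSpan X Y S)
    (ho : ∀ o : ℕ, A ∈ monomialSpan X Y (S ∩ {s | o ≤ s.1 + s.2}) →
      B ∈ monomialSpan X Y (S ∩ {s | o ≤ s.1 + s.2}) → r * o ≤ N) :
    w (jac D E X Y) ^ N ≤ w A ^ r := by
  by_cases h0 : w (jac D E X Y) = 0
  · rw [h0, zero_pow (by omega)]; exact zero_le
  · obtain ⟨k, hk⟩ := exists_exp_neg_natCast_lt h0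
    exact hw.local_bound N r hr k X Y A B h hX hY hk hAB hA
      (monomialSpan_mono (Set.subset_univ _) hAS) (monomialSpan_mono (Set.subset_univ _) hBS)
      fun o h1 h2 => ho o (mem_inter h hAS h1) (mem_inter h hBS h2)

namespace IsMinimalData

variable {Good : K → K → Prop} {u p q A B : K} {n : ℕ} {m b ρ : ℤ}
  (H : IsMinimalData Good u n ρ)
include H

theorem isCoprime {P Q : (adjoin ℂ {p})[X]} (h : Good p q) (hP : P.natDegree ≤ n)
    (hQ : Q.natDegree ≤ n) (hQ0 : aeval q Q ≠ 0) (hPQ : aeval q P = u * aeval q Q) :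
    IsCoprime P Q := by
  classical
  rw [← EuclideanDomain.gcd_isUnit_iff]
  obtain ⟨P', hP'⟩ := EuclideanDomain.gcd_dvd_left P Q
  obtain ⟨Q', hQ'⟩ := EuclideanDomain.gcd_dvd_right P Q
  set g := EuclideanDomain.gcd P Q
  by_contra hg
  have hQ00 : Q ≠ 0 := by rintro rfl; simp at hQ0
  have hg0 : g ≠ 0 := by intro h0; rw [h0, zero_mul] at hQ'; exact hQ00 hQ'
  have hQ'0 : Q' ≠ 0 := by intro h0; rw [h0, mul_zero] at hQ'; exact hQ00 hQ'
  have hd : 1 ≤ g.natDegree := by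
    by_contra hd
    have := natDegree_eq_zero_iff_degree_le_zero.1 (by omega : g.natDegree = 0)
    rw [eq_C_of_degree_le_zero this] at hg hg0
    exact hg (isUnit_C.2 (isUnit_iff_ne_zero.2 (by simpa using hg0)))
  have hdeg : ∀ R : (adjoin ℂ {p})[X], (g * R).natDegree ≤ n → R.natDegree ≤ n - 1 := by
    intro R hR
    by_cases hR0 : R = 0
    · simp [hR0]
    rw [natDegree_mul hg0 hR0] at hR
    omega
  have hgq : aeval q g ≠ 0 := by
    intro h0; rw [hQ', map_mul, h0, zero_mul] at hQ0; exact hQ0 rfl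
  obtain ⟨b, hb⟩ := hasData_of_aeval (q := q) (u := u) (n := n - 1) (hdeg P' (hP' ▸ hP))
    (hdeg Q' (hQ' ▸ hQ)) (fun h0 => hQ0 (by rw [hQ', map_mul, h0, mul_zero])) (by
      refine mul_left_cancel₀ hgq ?_
      rw [hP', hQ', map_mul, map_mul] at hPQ
      rw [hPQ]; ring)
  have := H.minN h hb
  have := H.pos
  omega

theorem bound_of_le {D E : Derivation ℤ K K} {w : Valuation K ℤᵐ⁰} (hw : Place u D E w)
    (N r : ℕ) (h : Good p q) (hρ : 2 * b - m * n = ρ)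
    (hA : A ∈ monomialSpan p q (region n m b)) (hB : B ∈ monomialSpan p q (region n m b))
    (hB0 : B ≠ 0) (hAB : A = u * B) (hp : w p ≤ 1) (hq : w q ≤ 1) (hm : 0 ≤ m ∨ w q < 1)
    (L : ∀ p q, Good p q → w p < 1 → w q < 1 → A ∈ monomialSpan p q (region n m b) →
      B ∈ monomialSpan p q (region n m b) → w (jac D E p q) ^ N ≤ w A ^ r) :
    w (jac D E p q) ^ N ≤ w A ^ r := by
  have hwAB : w A = w B := by rw [hAB, map_mul, hw.base, one_mul]
  have triv : 1 ≤ w A → w (jac D E p q) ^ N ≤ w A ^ r := fun h1 =>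
    (pow_le_one' (hw.jac_le p q hp hq) N).trans (one_le_pow₀ h1)
  rcases hw.residue p with ⟨e, he⟩ | h1 | h1
  · set p' := p - algebraMap ℂ K e with hp'
    have hg' : Good p' q := H.good.translate_left h e
    have hJ : jac D E p' q = jac D E p q := hw.jac_sub_left p q e
    have tr : ∀ {z}, z ∈ monomialSpan p q (region n m b) →
        z ∈ monomialSpan p' q (region n m b) := fun hz =>
      mem_translate_left e (fun i j i' (h1 : j ≤ n ∧ (i : ℤ) + m * j ≤ b) h2 =>
        (⟨h1.1, by omega⟩ : j ≤ n ∧ (i' : ℤ) + m * j ≤ b)) hz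
    rcases hw.residue q with ⟨e', he'⟩ | h2 | h2
    · rcases hm with hm | hm
      · have tr' : ∀ {z}, z ∈ monomialSpan p' q (region n m b) →
            z ∈ monomialSpan p' (q - algebraMap ℂ K e') (region n m b) := fun hz =>
          mem_translate_right e' (fun i j j' (h1 : j ≤ n ∧ (i : ℤ) + m * j ≤ b) h2 =>
            (⟨h2.trans h1.1, by
              have : (j' : ℤ) ≤ j := by exact_mod_cast h2
              nlinarith⟩ : j' ≤ n ∧ (i : ℤ) + m * j' ≤ b)) hz
        have := L p' (q - algebraMap ℂ K e') (H.good.translate_right hg' e') he he'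
          (tr' (tr hA)) (tr' (tr hB))
        rwa [hw.jac_sub_right, hJ] at this
      · rw [← hJ]
        exact L p' q hg' he hm (tr hA) (tr hB)
    · exact absurd hq h2.not_ge
    · refine triv ?_
      by_contra hlt
      push Not at hlt
      have hA' := hw.mem_of_lt_one he h2 (tr hA) hlt
      have hB' := hw.mem_of_lt_one he h2 (tr hB) (hwAB ▸ hlt)
      have hp0 := (H.good.coord hg').left_ne_zero
      have := H.minR hg' (HasData.of_mul (inv_ne_zero hp0) (div_left_mem hp0 hA')
        (div_left_mem hp0 hB') hB0 hAB)
      omega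
  · exact absurd hp h1.not_ge
  · refine triv ?_
    have hsub : region n m b ⊆ {s | s.2 ≤ n} := fun s hs => hs.1
    obtain ⟨P, hP, rfl⟩ := exists_aeval_of_mem (monomialSpan_mono hsub hA)
    obtain ⟨Q, hQ, rfl⟩ := exists_aeval_of_mem (monomialSpan_mono hsub hB)
    exact one_le_of_isCoprime h1 hq (H.isCoprime h hP hQ hB0 hAB) hwAB

end IsMinimalData

end Noether

section Noether

open Polynomial IntermediateField WithZero

variable {K : Type*} [Field K] [Algebra ℂ K]

theorem HasData.chart_right {u p q : K} {n : ℕ} {m b : ℤ} (hq : q ≠ 0)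
    (h : HasData u p q n m b) : HasData u p q⁻¹ n (-m) (b - m * n) := by
  obtain ⟨A, B, hA, hB, hB0, hAB⟩ := h
  exact HasData.of_mul (inv_ne_zero (pow_ne_zero n hq)) (chart_right_mem hq hA)
    (chart_right_mem hq hB) hB0 hAB

theorem region_one_subset {n d : ℕ} : region n 1 d ⊆ {s : ℕ × ℕ | s.1 + s.2 ≤ d} := by
  rintro ⟨i, j⟩ ⟨-, h⟩
  simp only [Set.mem_ofPred_eq] at h ⊢
  omega

namespace IsMinimalDegree

variable {Good : K → K → Prop} {u p q : K} {n : ℕ} {m b : ℤ} (H : IsMinimalDegree Good u n)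
include H

theorem mul_le (h : Good p q) (hd : HasData u p q n m b) : m * n ≤ b := by
  obtain ⟨A, B, hA, hB, hB0, hAB⟩ := hd
  by_contra hlt
  have hsub : region n m b ⊆ region (n - 1) m b := by
    rintro ⟨i, j⟩ ⟨h1, h2⟩
    simp only at h1 h2
    refine ⟨?_, h2⟩
    simp only
    by_contra h3
    have : j = n := by have := H.pos; omega
    subst this
    omega
  have := H.minN h ⟨A, B, monomialSpan_mono hsub hA, monomialSpan_mono hsub hB, hB0, hAB⟩
  have := H.pos
  omega

theorem nonneg (h : Good p q) (hd : HasData u p q n m b) : 0 ≤ b := by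
  obtain ⟨A, B, hA, hB, hB0, hAB⟩ := hd
  by_contra hlt
  push Not at hlt
  have hq0 := (H.good.coord h).right_ne_zero
  have := H.minN h (HasData.of_mul (inv_ne_zero hq0) (div_right_mem hq0 hlt hA)
    (div_right_mem hq0 hlt hB) hB0 hAB)
  have := H.pos
  omega

end IsMinimalDegree

namespace IsMinimalData

variable {Good : K → K → Prop} {u v p q A B : K} {n : ℕ} {m b ρ : ℤ}
  (H : IsMinimalData Good u n ρ) {D E : Derivation ℤ K K} {w : Valuation K ℤᵐ⁰}
include H

theorem bound_of_lt (hw : Place u D E w) (h : Good p q) (hρ : 2 * b - m * n = ρ)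
    (hA : A ∈ monomialSpan p q (region n m b)) (hB : B ∈ monomialSpan p q (region n m b))
    (hB0 : B ≠ 0) (hA0 : A ≠ 0) (hAB : A = u * B) (hp : w p < 1) (hq : w q < 1) :
    w (jac D E p q) ^ n ≤ w A ^ 2 := by
  have hp0 := (H.good.coord h).left_ne_zero
  refine hw.local_bound' H.pos (by norm_num) (H.good.coord h) hp hq
    (by rw [hAB, map_mul, hw.base, one_mul]) hA0 hA hB fun o h1 h2 => ?_
  have := H.minR (H.good.mul_zpow h (-1)) (HasData.of_mul (inv_ne_zero (pow_ne_zero o hp0))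
    (blowup_mem hp0 h1) (blowup_mem hp0 h2) hB0 hAB)
  have e : 2 * (b - o) - (m - 1) * n = ρ - 2 * o + n := by rw [← hρ]; ring
  omega

theorem bound_of_left_le (hw : Place u D E w) (h : Good p q) (hρ : 2 * b - m * n = ρ)
    (hA : A ∈ monomialSpan p q (region n m b)) (hB : B ∈ monomialSpan p q (region n m b))
    (hB0 : B ≠ 0) (hA0 : A ≠ 0) (hAB : A = u * B) (hp : w p ≤ 1) (hm : 0 ≤ m) :
    w (jac D E p q) ^ n ≤ w A ^ 2 := by
  rcases le_or_gt (w q) 1 with hq | hq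
  · exact H.bound_of_le hw n 2 h hρ hA hB hB0 hAB hp hq (Or.inl hm) fun p q hg h1 h2 h3 h4 =>
      H.bound_of_lt hw hg hρ h3 h4 hB0 hA0 hAB h1 h2
  · have hq0 := (H.good.coord h).right_ne_zero
    have hc : (q ^ n)⁻¹ ≠ 0 := inv_ne_zero (pow_ne_zero n hq0)
    have hq1 : w q⁻¹ < 1 := by rw [map_inv₀]; exact inv_lt_one_of_one_lt₀ hq
    have hρ' : 2 * (b - m * n) - -m * n = ρ := by rw [← hρ]; ring
    have hB0' := mul_ne_zero hc hB0
    have hA0' := mul_ne_zero hc hA0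
    have hAB' : (q ^ n)⁻¹ * A = u * ((q ^ n)⁻¹ * B) := by rw [hAB]; ring
    have key := H.bound_of_le hw n 2 (H.good.inv h) hρ' (chart_right_mem hq0 hA)
      (chart_right_mem hq0 hB) hB0' hAB' hp hq1.le (Or.inr hq1) fun p q hg h1 h2 h3 h4 =>
      H.bound_of_lt hw hg hρ' h3 h4 hB0' hA0' hAB' h1 h2
    rw [jac_inv_right, Valuation.map_neg] at key
    simp only [map_mul, map_pow, map_inv₀, mul_pow] at key
    rw [← inv_pow, ← pow_mul, ← pow_mul, mul_comm 2 n] at key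
    exact le_of_mul_le_mul_left key
      (pow_pos (inv_pos.2 ((Valuation.pos_iff _).2 hq0)) _)

theorem bound (hw : Place u D E w) (h : Good p q) (hρ : 2 * b - m * n = ρ) (hn : 2 * n ≤ ρ)
    (hA : A ∈ monomialSpan p q (region n m b)) (hB : B ∈ monomialSpan p q (region n m b))
    (hB0 : B ≠ 0) (hA0 : A ≠ 0) (hAB : A = u * B) (hm : 0 ≤ m) :
    w (jac D E p q) ^ n ≤ w A ^ 2 := by
  rcases le_or_gt (w p) 1 with hp | hp
  · exact H.bound_of_left_le hw h hρ hA hB hB0 hA0 hAB hp hm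
  · have hp0 := (H.good.coord h).left_ne_zero
    have hc : p ^ (-b) ≠ 0 := zpow_ne_zero _ hp0
    have hp1 : w p⁻¹ < 1 := by rw [map_inv₀]; exact inv_lt_one_of_one_lt₀ hp
    have key := H.bound_of_left_le hw (H.good.inv_left (H.good.mul_zpow h (-m))) hρ
      (chart_left_mem hp0 hA) (chart_left_mem hp0 hB) (mul_ne_zero hc hB0) (mul_ne_zero hc hA0)
      (by rw [hAB]; ring) hp1.le hm
    rw [jac_inv_left, jac_mul_zpow_right _ _ hp0, Valuation.map_neg] at key
    simp only [map_mul, map_pow, map_inv₀, map_zpow₀, mul_pow] at key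
    set x := w p
    have hx0 : x ≠ 0 := (Valuation.ne_zero_iff _).2 hp0
    have e1 : (x⁻¹ ^ 2) ^ n * ((x ^ (-m)) ^ n * w (jac D E p q) ^ n) =
        x ^ (-(2 * n + m * n)) * w (jac D E p q) ^ n := by
      rw [← mul_assoc]
      congr 1
      rw [← zpow_natCast (_ ^ 2), ← zpow_natCast (x⁻¹), ← zpow_natCast (x ^ (-m)), inv_zpow',
        ← zpow_mul, ← zpow_mul, ← zpow_add₀ hx0]
      congr 1
      push_cast
      ring
    have e2 : (x ^ (-b)) ^ 2 = x ^ (-(2 * b)) := by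
      rw [← zpow_natCast, ← zpow_mul]; congr 1; push_cast; ring
    rw [e1, e2] at key
    have hx : x ^ (-(2 * b)) ≤ x ^ (-(2 * n + m * n)) :=
      zpow_le_zpow_right₀ hp.le (by linarith)
    exact le_of_mul_le_mul_left (key.trans (mul_le_mul_left hx _))
      (zpow_pos (zero_lt_iff.2 hx0) _)

theorem lt_two_mul (huv : IsCoord u v) (h : Good p q) (hρ : 2 * b - m * n = ρ) (hm : 0 ≤ m)
    (hd : HasData u p q n m b) : ρ < 2 * n := by
  by_contra hn
  obtain ⟨A, B, hA, hB, hB0, hAB⟩ := hd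
  have hA0 : A ≠ 0 := by rw [hAB]; exact mul_ne_zero huv.left_ne_zero hB0
  exact huv.no_bound (H.good.coord h) hA0 n 2 H.pos fun D E w hw =>
    H.bound hw h hρ (not_lt.1 hn) hA hB hB0 hA0 hAB hm

theorem plane_bound_of_lt (hw : Place u D E w) {d : ℕ} (hd : 1 ≤ d) (h : Good p q)
    (hdn : 2 * d < 3 * n)
    (hA : A ∈ monomialSpan p q {s | s.1 + s.2 ≤ d}) (hB : B ∈ monomialSpan p q {s | s.1 + s.2 ≤ d})
    (hB0 : B ≠ 0) (hA0 : A ≠ 0) (hAB : A = u * B) (hp : w p < 1) (hq : w q < 1) :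
    w (jac D E p q) ^ d ≤ w A ^ 3 := by
  have hp0 := (H.good.coord h).left_ne_zero
  refine hw.local_bound' hd (by norm_num) (H.good.coord h) hp hq
    (by rw [hAB, map_mul, hw.base, one_mul]) hA0 hA hB fun o h1 h2 => ?_
  have := H.minN (H.good.swap (H.good.mul_zpow h (-1)))
    (HasData.of_mul (inv_ne_zero (pow_ne_zero o hp0))
    (blowup_plane_mem hp0 h1) (blowup_plane_mem hp0 h2) hB0 hAB)
  omega

theorem plane_bound (hw : Place u D E w) {d : ℕ} (hd : 1 ≤ d) (h : Good p q)
    (hρ : 2 * (d : ℤ) - 1 * n = ρ) (hdn : 2 * d < 3 * n)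
    (hA : A ∈ monomialSpan p q (region n 1 d)) (hB : B ∈ monomialSpan p q (region n 1 d))
    (hB0 : B ≠ 0) (hA0 : A ≠ 0) (hAB : A = u * B) :
    w (jac D E p q) ^ d ≤ w A ^ 3 := by
  have hp0 := (H.good.coord h).left_ne_zero
  have hq0 := (H.good.coord h).right_ne_zero
  rcases le_or_gt (w q) (max 1 (w p)) with hqp | hqp
  · rcases le_or_gt (w p) 1 with hp | hp
    · rw [max_eq_left hp] at hqp
      exact H.bound_of_le hw d 3 h hρ hA hB hB0 hAB hp hqp (Or.inl zero_le_one)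
        fun p q hg h1 h2 h3 h4 => H.plane_bound_of_lt hw hd hg hdn
          (monomialSpan_mono region_one_subset h3) (monomialSpan_mono region_one_subset h4)
          hB0 hA0 hAB h1 h2
    · rw [max_eq_right hp.le] at hqp
      have hc : p ^ (-(d : ℤ)) ≠ 0 := zpow_ne_zero _ hp0
      have hp1 : w p⁻¹ < 1 := by rw [map_inv₀]; exact inv_lt_one_of_one_lt₀ hp
      have hq1 : w (q * p ^ (-1 : ℤ)) ≤ 1 := by
        rw [map_mul, zpow_neg_one, map_inv₀]
        exact mul_inv_le_one_of_le₀ hqp zero_le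
      have hB0' := mul_ne_zero hc hB0
      have hA0' := mul_ne_zero hc hA0
      have hAB' : p ^ (-(d : ℤ)) * A = u * (p ^ (-(d : ℤ)) * B) := by rw [hAB]; ring
      have key := H.bound_of_le hw d 3 (H.good.inv_left (H.good.mul_zpow h (-1))) hρ
        (chart_left_mem hp0 hA) (chart_left_mem hp0 hB) hB0' hAB' hp1.le hq1
        (Or.inl zero_le_one) fun p q hg h1 h2 h3 h4 => H.plane_bound_of_lt hw hd hg hdn
          (monomialSpan_mono region_one_subset h3) (monomialSpan_mono region_one_subset h4)
          hB0' hA0' hAB' h1 h2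
      rw [jac_inv_left, jac_mul_zpow_right _ _ hp0, Valuation.map_neg, zpow_neg_one, zpow_neg,
        zpow_natCast, ← inv_pow, ← mul_assoc, ← pow_succ] at key
      simp only [map_mul, map_pow, mul_pow] at key
      rw [← pow_mul, ← pow_mul, mul_comm d] at key
      exact le_of_mul_le_mul_left key (pow_pos ((Valuation.pos_iff _).2 (inv_ne_zero hp0)) _)
  · have hc : (q ^ d)⁻¹ ≠ 0 := inv_ne_zero (pow_ne_zero d hq0)
    have hq1 : w q⁻¹ < 1 := by
      rw [map_inv₀]; exact inv_lt_one_of_one_lt₀ ((le_max_left _ _).trans_lt hqp)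
    have hp1 : w (p * q⁻¹) < 1 := by
      rw [map_mul, map_inv₀, ← div_eq_mul_inv]
      exact (div_lt_one₀ ((Valuation.pos_iff _).2 hq0)).2 ((le_max_right _ _).trans_lt hqp)
    have hg : Good q⁻¹ (p * q⁻¹) := by
      have := H.good.inv_left (H.good.mul_zpow (H.good.swap h) (-1))
      rwa [zpow_neg_one] at this
    have key := H.plane_bound_of_lt hw hd hg hdn
      (chart_infinity_mem hq0 (monomialSpan_mono region_one_subset hA))
      (chart_infinity_mem hq0 (monomialSpan_mono region_one_subset hB))
      (mul_ne_zero hc hB0) (mul_ne_zero hc hA0) (by rw [hAB]; ring) hq1 hp1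
    rw [mul_comm p, jac_mul_right, jac_inv_left, jac_swap] at key
    rw [show q⁻¹ * -(q⁻¹ ^ 2 * -jac D E p q) = q⁻¹ ^ 3 * jac D E p q by ring, ← inv_pow] at key
    simp only [map_mul, map_pow, mul_pow] at key
    rw [← pow_mul, ← pow_mul, mul_comm d] at key
    exact le_of_mul_le_mul_left key (pow_pos ((Valuation.pos_iff _).2 (inv_ne_zero hq0)) _)

theorem false_of_nonneg (huv : IsCoord u v) (h : Good p q) (hρ : 2 * b - m * n = ρ)
    (hm : 0 ≤ m) (hd : HasData u p q n m b) : False := by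
  have h1 := H.lt_two_mul huv h hρ hm hd
  have h2 := H.mul_le h hd
  have hn : (1 : ℤ) ≤ n := by exact_mod_cast H.pos
  have hm2 : m < 2 := by
    by_contra h3
    push Not at h3
    nlinarith
  obtain ⟨d, rfl⟩ := Int.eq_ofNat_of_zero_le (H.nonneg h hd)
  obtain ⟨A, B, hA, hB, hB0, hAB⟩ := hd
  obtain rfl | rfl : m = 0 ∨ m = 1 := by omega
  · have hsub : region n 0 d ⊆ Prod.swap ⁻¹' region d 0 n := by
      rintro ⟨i, j⟩ ⟨h1, h2⟩
      simp only [zero_mul, add_zero] at h1 h2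
      exact ⟨by simpa using h2, by simpa using h1⟩
    have := H.minN (H.good.swap h) ⟨A, B, monomialSpan_swap.le (monomialSpan_mono hsub hA),
      monomialSpan_swap.le (monomialSpan_mono hsub hB), hB0, hAB⟩
    omega
  · have hA0 : A ≠ 0 := by rw [hAB]; exact mul_ne_zero huv.left_ne_zero hB0
    exact huv.no_bound (H.good.coord h) hA0 d 3 (by omega) fun D E w hw =>
      H.plane_bound hw (by omega) h hρ (by omega) hA hB hB0 hA0 hAB

theorem false_of_hasData (huv : IsCoord u v) (h : Good p q) (hρ : 2 * b - m * n = ρ)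
    (hd : HasData u p q n m b) : False := by
  rcases le_total 0 m with hm | hm
  · exact H.false_of_nonneg huv h hρ hm hd
  · exact H.false_of_nonneg huv (H.good.inv h) (by rw [← hρ]; ring) (neg_nonneg.2 hm)
      (hd.chart_right (H.good.coord h).right_ne_zero)

end IsMinimalData

end Noether

section Noether

open Polynomial IntermediateField

variable {K : Type*} [Field K] [Algebra ℂ K]

namespace GoodClass

variable {Good : K → K → Prop} (hg : GoodClass Good) {u v p q : K}
include hg

theorem exists_mem_adjoin (h : Good p q) (huv : IsCoord u v) :
    ∃ p q, Good p q ∧ u ∈ adjoin ℂ {p} := by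
  classical
  have hex : ∃ n : ℕ, ∃ p q m b, Good p q ∧ HasData u p q n m b := by
    obtain ⟨P, Q, -, -, hQ, hPQ⟩ := exists_coprime_fraction ((hg.coord h).mem_adjoin_adjoin u)
    obtain ⟨b, hb⟩ := hasData_of_aeval (u := u) (le_max_left P.natDegree Q.natDegree)
      (le_max_right _ _) hQ hPQ.symm
    exact ⟨_, p, q, 0, b, h, hb⟩
  obtain ⟨n, hn⟩ : ∃ n, n = Nat.find hex := ⟨_, rfl⟩
  obtain ⟨p₁, q₁, m₁, b₁, h₁, hd₁⟩ := hn ▸ Nat.find_spec hex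
  rcases Nat.eq_zero_or_pos n with h0 | hpos
  · refine ⟨p₁, q₁, h₁, ?_⟩
    obtain ⟨A, B, hA, hB, hB0, hAB⟩ := hd₁
    have key : ∀ {z}, z ∈ monomialSpan p₁ q₁ (region n m₁ b₁) → z ∈ adjoin ℂ {p₁} := by
      intro z hz
      obtain ⟨P, hP, rfl⟩ := exists_aeval_of_mem
        (monomialSpan_mono (fun s (hs : s ∈ region n m₁ b₁) => hs.1) hz)
      rw [eq_C_of_natDegree_le_zero (hP.trans h0.le), aeval_C]
      exact (P.coeff 0).2
    rw [eq_div_of_mul_eq hB0 hAB.symm]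
    exact div_mem (key hA) (key hB)
  · have H : IsMinimalDegree Good u n :=
      ⟨hg, hpos, fun h' hd => hn ▸ Nat.find_min' hex ⟨_, _, _, _, h', hd⟩⟩
    obtain ⟨ρ, ⟨p₂, q₂, m₂, b₂, h₂, hd₂, e₂⟩, hρ⟩ := Int.exists_least_of_bdd
      (P := fun ρ : ℤ => ∃ p q m b, Good p q ∧ HasData u p q n m b ∧ 2 * b - m * n = ρ)
      ⟨0, by
        rintro _ ⟨p, q, m, b, h', hd, rfl⟩
        linarith [H.mul_le h' hd, H.nonneg h' hd]⟩ ⟨_, p₁, q₁, m₁, b₁, h₁, hd₁, rfl⟩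
    exact (IsMinimalData.false_of_hasData
      ⟨H, fun h' hd => hρ _ ⟨_, _, _, _, h', hd, rfl⟩⟩ huv h₂ e₂ hd₂).elim

/-- Every coordinate system is obtained from a given one by elementary changes. -/
theorem good (h : Good p q) (huv : IsCoord u v) : Good u v := by
  obtain ⟨p, q, h, hu⟩ := hg.exists_mem_adjoin h huv
  obtain ⟨E, hE, hEu, hEv⟩ := huv.exists_derivation 0 0 1
  simp only [Derivation.coe_zero, Pi.zero_apply, map_zero] at hE
  have hEp : E p = 0 := by
    by_contra h0
    obtain ⟨c, hc⟩ :=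
      mem_range_of_derivation_eq_zero (hg.coord h).transcendental_left hu E hE h0 hEu
    exact huv.transcendental_left (hc ▸ isAlgebraic_algebraMap c)
  have hp := huv.mem_adjoin_of_derivation hE hEu (by rw [hEv]; exact one_ne_zero) hEp
  obtain ⟨a, b, c, d, hdet, e⟩ := exists_homography (hg.coord h).transcendental_left hu hp
  have h1 : Good u q := by
    refine hg.swap (hg.homography (hg.swap h) (a := algebraMap ℂ _ a) (b := algebraMap ℂ _ b)
      (c := algebraMap ℂ _ c) (d := algebraMap ℂ _ d) ?_ e)
    rw [← map_mul, ← map_mul, ← map_sub]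
    exact (_root_.map_ne_zero _).2 hdet
  obtain ⟨a, b, c, d, hdet, e⟩ := exists_homography (hg.coord h1).transcendental_adjoin
    ((hg.coord h1).mem_adjoin_adjoin v) (huv.mem_adjoin_adjoin q)
  exact hg.homography h1 hdet e

end GoodClass

end Noether

section Elementary

open IntermediateField

variable {K : Type*} [Field K] [Algebra ℂ K] {x y p q : K}

namespace IsCoord

variable (h : IsCoord x y)

/-- The automorphism taking the coordinates `x, y` to `p, q`. -/
def equiv (h : IsCoord x y) (h' : IsCoord p q) : K ≃ₐ[ℂ] K := (h.exists_algEquiv h').choose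

@[simp] theorem equiv_left (h' : IsCoord p q) : h.equiv h' x = p :=
  (h.exists_algEquiv h').choose_spec.1

@[simp] theorem equiv_right (h' : IsCoord p q) : h.equiv h' y = q :=
  (h.exists_algEquiv h').choose_spec.2

include h in
theorem affine {r b : K} (hr : r ∈ adjoin ℂ {x}) (hr0 : r ≠ 0) (hb : b ∈ adjoin ℂ {x}) :
    IsCoord x (r * y + b) := by
  have hle : adjoin ℂ {x} ≤ adjoin ℂ {x, r * y + b} := adjoin.mono _ _ _ (by simp)
  refine h.of_mem (hle (mem_adjoin_simple_self ℂ x)) ?_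
  have := div_mem (sub_mem (subset_adjoin ℂ {x, r * y + b} (Set.mem_insert_of_mem _ rfl)) (hle hb))
    (hle hr)
  rwa [add_sub_cancel_right, mul_div_cancel_left₀ _ hr0] at this

include h in
theorem inv_right : IsCoord x y⁻¹ := by
  refine h.of_mem (subset_adjoin _ _ (by simp)) ?_
  rw [← inv_inv y]
  exact inv_mem (subset_adjoin _ _ (by simp))

include h in
theorem exists_elem {r b : K} (hr : r ∈ adjoin ℂ {x}) (hr0 : r ≠ 0) (hb : b ∈ adjoin ℂ {x}) :
    ∃ f : K ≃ₐ[ℂ] K, f x = x ∧ f y = r * y + b :=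
  h.exists_algEquiv (h.affine hr hr0 hb)

end IsCoord

theorem AlgEquiv.eq_of_mem_adjoin {f : K ≃ₐ[ℂ] K} (hx : f x = x) {z : K} (hz : z ∈ adjoin ℂ {x}) :
    f z = z :=
  IsCoord.ringHom_adjoin_simple_eq (θ := f.toRingEquiv.toRingHom) hz f.commutes hx

/-- `f` is an affine transformation in the coordinates `x, y`. -/
def IsAffine (x y : K) (f : K ≃ₐ[ℂ] K) : Prop :=
  ∃ a b c d e g : ℂ, f x = algebraMap ℂ K a * x + algebraMap ℂ K b * y + algebraMap ℂ K e ∧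
    f y = algebraMap ℂ K c * x + algebraMap ℂ K d * y + algebraMap ℂ K g

namespace IsCoord

variable (h : IsCoord x y)
include h

theorem mem_adjoin_of_commute {f g : K ≃ₐ[ℂ] K} (hfg : f * g = g * f)
    (hx : g x = x) (hy : g y = y + 1) : f x ∈ adjoin ℂ {x} ∧ f y - y ∈ adjoin ℂ {x} := by
  have e1 := DFunLike.congr_fun hfg x
  have e2 := DFunLike.congr_fun hfg y
  simp only [AlgEquiv.mul_apply, hx, hy, map_add, map_one] at e1 e2
  exact ⟨h.mem_adjoin_of_translation g hx one_ne_zero (by simpa using hy) e1.symm,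
    h.mem_adjoin_of_translation g hx one_ne_zero (by simpa using hy) (by
      rw [map_sub, ← e2, hy]; ring)⟩

theorem exists_shear_of_commute {f g e : K ≃ₐ[ℂ] K} (hfg : f * g = g * f)
    (hx : g x = x) (hy : g y = y + 1) (hfe : f * e = e * f) (hex : e x = x) (hey : e y = y + x) :
    ∃ b : adjoin ℂ {x}, f x = x ∧ f y = y + b := by
  obtain ⟨h1, h2⟩ := h.mem_adjoin_of_commute hfg hx hy
  have e2 := DFunLike.congr_fun hfe y
  simp only [AlgEquiv.mul_apply, hey, map_add] at e2
  have e3 := AlgEquiv.eq_of_mem_adjoin hex h2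
  rw [map_sub, hey, ← e2] at e3
  exact ⟨⟨_, h2⟩, by linear_combination e3, by simp⟩

theorem mem_adjoin_of_conj_dilation {f g g' : K ≃ₐ[ℂ] K} {c c' : ℂ} (hfg : f * g = g' * f)
    (hc0 : c' ≠ 0) (hc : ∀ n : ℕ, n ≠ 0 → c' ^ n ≠ 1)
    (hx : g x = x) (hy : g y = algebraMap ℂ K c * y)
    (hx' : g' x = x) (hy' : g' y = algebraMap ℂ K c' * y) : f x ∈ adjoin ℂ {x} ∧
      (c = c' → f y * y⁻¹ ∈ adjoin ℂ {x}) ∧ (c = c'⁻¹ → f y * y ∈ adjoin ℂ {x}) := by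
  have e1 := DFunLike.congr_fun hfg x
  have e2 := DFunLike.congr_fun hfg y
  simp only [AlgEquiv.mul_apply, hx, hy, map_mul, AlgEquiv.commutes] at e1 e2
  have hc1 : algebraMap ℂ K c' ≠ 0 := (map_ne_zero _).2 hc0
  have hy0 := h.right_ne_zero
  refine ⟨h.mem_adjoin_of_dilation g' hx' hc0 hc hy' e1.symm, ?_, ?_⟩
  · rintro rfl
    refine h.mem_adjoin_of_dilation g' hx' hc0 hc hy' ?_
    rw [map_mul, ← e2, map_inv₀, hy']
    field_simp
  · rintro rfl
    refine h.mem_adjoin_of_dilation g' hx' hc0 hc hy' ?_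
    rw [map_mul, ← e2, hy', map_inv₀]
    field_simp

end IsCoord

theorem map_mul_eq_of_fixed {G : Type*} [Group G] {Φ : G ≃* G} {f g g' : G} (hg : Φ g = g)
    (hg' : Φ g' = g') (h : f * g = g' * f) : Φ f * g = g' * Φ f := by
  have := congrArg Φ h
  rwa [map_mul, map_mul, hg, hg'] at this

/-- An automorphism of the Cremona group which fixes the affine transformations. -/
structure FixesAffine (x y : K) (Φ : (K ≃ₐ[ℂ] K) ≃* (K ≃ₐ[ℂ] K)) : Prop where
  coord : IsCoord x y
  fix : ∀ f, IsAffine x y f → Φ f = f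

namespace FixesAffine

variable {Φ : (K ≃ₐ[ℂ] K) ≃* (K ≃ₐ[ℂ] K)} (H : FixesAffine x y Φ)
include H

/-- The automorphism `Φ` maps one given shear to another. -/
def _root_.MapsShear (x y : K) (Φ : (K ≃ₐ[ℂ] K) ≃* (K ≃ₐ[ℂ] K)) (b b' : K) : Prop :=
  ∃ f, f x = x ∧ f y = y + b ∧ Φ f x = x ∧ Φ f y = y + b'

theorem exists_mapsShear {b : K} (hb : b ∈ adjoin ℂ {x}) :
    ∃ b' ∈ adjoin ℂ {x}, MapsShear x y Φ b b' := by
  obtain ⟨f, hx, hy⟩ := H.coord.exists_elem (one_mem _) one_ne_zero hb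
  rw [one_mul] at hy
  obtain ⟨g, gx, gy⟩ := H.coord.exists_elem (one_mem _) one_ne_zero (one_mem _)
  obtain ⟨e, ex, ey⟩ := H.coord.exists_elem (one_mem _) one_ne_zero (mem_adjoin_simple_self ℂ x)
  rw [one_mul] at gy ey
  have hg : Φ g = g := H.fix g ⟨1, 0, 0, 1, 0, 1, by simp [gx], by simp [gy]⟩
  have he : Φ e = e := H.fix e ⟨1, 0, 1, 1, 0, 0, by simp [ex], by simp [ey]; ring⟩
  have c1 : f * g = g * f := H.coord.algEquiv_ext (by simp [hx, gx]) (by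
    simp only [AlgEquiv.mul_apply, hy, gy, map_add, map_one, AlgEquiv.eq_of_mem_adjoin gx hb]
    ring)
  have c2 : f * e = e * f := H.coord.algEquiv_ext (by simp [hx, ex]) (by
    simp only [AlgEquiv.mul_apply, hy, ey, map_add, hx, AlgEquiv.eq_of_mem_adjoin ex hb]
    ring)
  obtain ⟨b', h1, h2⟩ := H.coord.exists_shear_of_commute
    (map_mul_eq_of_fixed hg hg c1) gx gy (map_mul_eq_of_fixed he he c2) ex ey
  exact ⟨b', b'.2, f, hx, hy, h1, h2⟩

end FixesAffine

end Elementary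

section Elementary

open IntermediateField

variable {K : Type*} [Field K] [Algebra ℂ K] {x y p q : K}

theorem two_pow_ne_one (n : ℕ) (hn : n ≠ 0) : (2 : ℂ) ^ n ≠ 1 := by
  have := (Nat.one_lt_two_pow hn).ne'
  exact_mod_cast this

namespace FixesAffine

variable {Φ : (K ≃ₐ[ℂ] K) ≃* (K ≃ₐ[ℂ] K)} (H : FixesAffine x y Φ)
include H

theorem mapsShear_unique {b b' b'' : K} (h1 : MapsShear x y Φ b b') (h2 : MapsShear x y Φ b b'') :
    b' = b'' := by
  obtain ⟨f, fx, fy, -, e1⟩ := h1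
  obtain ⟨g, gx, gy, -, e2⟩ := h2
  obtain rfl : f = g := H.coord.algEquiv_ext (fx.trans gx.symm) (fy.trans gy.symm)
  exact add_left_cancel (e1.symm.trans e2)

omit H in
theorem mapsShear_add {b b' c c' : K} (hc : c ∈ adjoin ℂ {x}) (hc' : c' ∈ adjoin ℂ {x})
    (h1 : MapsShear x y Φ b b') (h2 : MapsShear x y Φ c c') :
    MapsShear x y Φ (b + c) (b' + c') := by
  obtain ⟨f, fx, fy, ex, ey⟩ := h1
  obtain ⟨g, gx, gy, ex', ey'⟩ := h2
  refine ⟨f * g, by simp [fx, gx], ?_, by simp [ex, ex'], ?_⟩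
  · simp [gy, fy, AlgEquiv.eq_of_mem_adjoin fx hc, add_assoc]
  · simp [ey', ey, AlgEquiv.eq_of_mem_adjoin ex hc', add_assoc]

theorem mapsShear_affine (a b : ℂ) : MapsShear x y Φ (algebraMap ℂ K a * x + algebraMap ℂ K b)
    (algebraMap ℂ K a * x + algebraMap ℂ K b) := by
  obtain ⟨f, fx, fy⟩ := H.coord.exists_elem (one_mem _) one_ne_zero
    (add_mem (mul_mem (IntermediateField.algebraMap_mem (adjoin ℂ {x}) a)
      (mem_adjoin_simple_self ℂ x)) (IntermediateField.algebraMap_mem (adjoin ℂ {x}) b))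
  rw [one_mul] at fy
  have hf : Φ f = f := H.fix f ⟨1, 0, a, 1, 0, b, by simp [fx], by simp [fy]; ring⟩
  exact ⟨f, fx, fy, hf.symm ▸ fx, hf.symm ▸ fy⟩

/-- Conjugation of shears by an affine transformation in `x`. -/
theorem mapsShear_comp {b b' : K} {a c : ℂ} {g : K ≃ₐ[ℂ] K} (gx : g x = algebraMap ℂ K a * x +
    algebraMap ℂ K c) (gy : g y = y)
    (h1 : MapsShear x y Φ b b') : MapsShear x y Φ (g b) (g b') := by
  have hg : Φ g = g := H.fix g ⟨a, 0, 0, 1, c, 0, by simp [gx], by simp [gy]⟩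
  obtain ⟨f, fx, fy, ex, ey⟩ := h1
  have gy' : g⁻¹ y = y := (AlgEquiv.symm_apply_eq g).2 gy.symm
  have key : ∀ (f : K ≃ₐ[ℂ] K) {b : K}, f x = x → f y = y + b →
      (g * f * g⁻¹) x = x ∧ (g * f * g⁻¹) y = y + g b := by
    intro f b fx fy
    constructor
    · have hx : g⁻¹ x ∈ adjoin ℂ {x} := by
        have ha : algebraMap ℂ K a ≠ 0 := by
          intro h0
          rw [h0, zero_mul, zero_add] at gx
          have h1 : x = algebraMap ℂ K c := g.injective (gx.trans (g.commutes c).symm)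
          exact H.coord.transcendental_left (h1 ▸ isAlgebraic_algebraMap c)
        have : g⁻¹ x = (x - algebraMap ℂ K c) / algebraMap ℂ K a := by
          change g.symm x = _
          rw [AlgEquiv.symm_apply_eq, map_div₀, map_sub, gx, g.commutes, g.commutes]
          field_simp
          ring
        rw [this]
        exact div_mem (sub_mem (mem_adjoin_simple_self ℂ x) (IntermediateField.algebraMap_mem _ _))
          (IntermediateField.algebraMap_mem _ _)
      rw [AlgEquiv.mul_apply, AlgEquiv.mul_apply, AlgEquiv.eq_of_mem_adjoin fx hx]
      exact g.apply_symm_apply x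
    · simp [gy', fy, gy]
  refine ⟨g * f * g⁻¹, (key f fx fy).1, (key f fx fy).2, ?_⟩
  rw [map_mul, map_mul, map_inv, hg]
  exact key _ ex ey

theorem mapsShear_sq : MapsShear x y Φ (x ^ 2) (x ^ 2) := by
  have hx := mem_adjoin_simple_self ℂ x
  obtain ⟨z, hz, h1⟩ := H.exists_mapsShear (pow_mem hx 2)
  obtain ⟨t, ty, tx⟩ := H.coord.symm.exists_elem (one_mem _) one_ne_zero (one_mem _)
  obtain ⟨s, sy, sx⟩ := H.coord.symm.exists_elem (IntermediateField.algebraMap_mem _ 2)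
    ((map_ne_zero _).2 two_ne_zero) (zero_mem _)
  rw [one_mul] at tx
  have e1 : t z = z + (2 * x + 1) := by
    refine H.mapsShear_unique (H.mapsShear_comp (a := 1) (c := 1) (by simp [tx]) ty
      h1) ?_
    have hm := add_mem (mul_mem (IntermediateField.algebraMap_mem (adjoin ℂ {x}) 2) hx)
      (IntermediateField.algebraMap_mem (adjoin ℂ {x}) 1)
    have := mapsShear_add hm hm h1 (H.mapsShear_affine 2 1)
    rw [map_ofNat, map_one] at this
    convert this using 1
    rw [map_pow, tx]
    ring
  have e2 : s z = z + z + (z + z) := by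
    refine H.mapsShear_unique (H.mapsShear_comp (a := 2) (c := 0) (by simp [sx]) sy
      h1) ?_
    have h2 := mapsShear_add (pow_mem hx 2) hz h1 h1
    have := mapsShear_add (add_mem (pow_mem hx 2) (pow_mem hx 2)) (add_mem hz hz) h2 h2
    convert this using 1
    rw [map_pow, sx, map_ofNat]
    ring
  obtain ⟨c, hc⟩ := H.coord.mem_range_of_mem_adjoin (sub_mem hz (pow_mem hx 2))
    (H.coord.symm.mem_adjoin_of_translation t ty one_ne_zero (by simpa using tx) (by
      rw [map_sub, e1, map_pow, tx]; ring))
  have e3 : s (z - x ^ 2) = 4 * (z - x ^ 2) := by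
    rw [map_sub, e2, map_pow, sx, map_ofNat]; ring
  rw [← hc, s.commutes] at e3
  have h3 : (3 : K) ≠ 0 := by
    rw [← map_ofNat (algebraMap ℂ K) 3]; exact (map_ne_zero _).2 three_ne_zero
  have e4 : algebraMap ℂ K c = 0 := by
    have : (3 : K) * algebraMap ℂ K c = 0 := by linear_combination -e3
    exact (mul_eq_zero.1 this).resolve_left h3
  rw [e4] at hc
  rwa [← sub_eq_zero.1 hc.symm] at h1 ⊢

theorem exists_dilation {r : K} (hr : r ∈ adjoin ℂ {x}) (hr0 : r ≠ 0) :
    ∃ (d : K ≃ₐ[ℂ] K) (r' : K), d x = x ∧ d y = r * y ∧ Φ d x ∈ adjoin ℂ {x} ∧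
      r' ∈ adjoin ℂ {x} ∧ Φ d y = r' * y := by
  obtain ⟨d, dx, dy⟩ := H.coord.exists_elem hr hr0 (zero_mem _)
  obtain ⟨g, gx, gy⟩ := H.coord.exists_elem (IntermediateField.algebraMap_mem _ 2)
    ((map_ne_zero _).2 two_ne_zero) (zero_mem _)
  rw [add_zero] at dy gy
  have hg : Φ g = g := H.fix g ⟨1, 0, 0, 2, 0, 0, by simp [gx], by simp [gy]⟩
  have c1 : d * g = g * d := H.coord.algEquiv_ext (by simp [dx, gx]) (by
    simp only [AlgEquiv.mul_apply, dy, gy, map_mul, AlgEquiv.eq_of_mem_adjoin gx hr, d.commutes]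
    ring)
  obtain ⟨h1, h2, -⟩ := H.coord.mem_adjoin_of_conj_dilation (f := Φ d) (g := g) (g' := g)
    (map_mul_eq_of_fixed hg hg c1) two_ne_zero two_pow_ne_one gx gy gx gy
  exact ⟨d, _, dx, dy, h1, h2 rfl, by rw [inv_mul_cancel_right₀ H.coord.right_ne_zero]⟩

theorem mapsShear_dilation {d : K ≃ₐ[ℂ] K} {r r' b b' c c' : K} (dx : d x = x) (dy : d y = r * y)
    (hr : r ∈ adjoin ℂ {x}) (hb : b ∈ adjoin ℂ {x}) (hc : r * c = b) (dy' : Φ d y = r' * y)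
    (h1 : MapsShear x y Φ b b') (h2 : MapsShear x y Φ c c') (hr' : r' ∈ adjoin ℂ {x}) :
    Φ d b' = r' * c' := by
  obtain ⟨f, fx, fy, ex, ey⟩ := h1
  obtain ⟨g, gx, gy, ex', ey'⟩ := h2
  have hdb := (AlgEquiv.eq_of_mem_adjoin dx hb).trans hc.symm
  have c1 : d * f = g * d := H.coord.algEquiv_ext (by simp [dx, gx, fx]) (by
    simp only [AlgEquiv.mul_apply, dy, gy, fy, map_mul, map_add, AlgEquiv.eq_of_mem_adjoin gx hr,
      hdb]
    ring)
  have e1 := DFunLike.congr_fun (congrArg Φ c1) y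
  simp only [map_mul, AlgEquiv.mul_apply, ey, ey', dy', map_add,
    AlgEquiv.eq_of_mem_adjoin ex' hr'] at e1
  linear_combination e1

end FixesAffine

end Elementary

section Elementary

open IntermediateField

variable {K : Type*} [Field K] [Algebra ℂ K] {x y p q : K}

namespace FixesAffine

variable {Φ : (K ≃ₐ[ℂ] K) ≃* (K ≃ₐ[ℂ] K)} (H : FixesAffine x y Φ)
include H

theorem mapsShear_one : MapsShear x y Φ 1 1 := by
  simpa using H.mapsShear_affine 0 1

theorem mapsShear_self : MapsShear x y Φ x x := by
  simpa using H.mapsShear_affine 1 0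

theorem mapsShear_mul_left {b b' c' : K} (hb : b ∈ adjoin ℂ {x}) (h1 : MapsShear x y Φ b b')
    (h2 : MapsShear x y Φ (x * b) c') : c' = x * b' := by
  have hx := mem_adjoin_simple_self ℂ x
  have hx0 := H.coord.left_ne_zero
  obtain ⟨d, r', dx, dy, hd, hr', dy'⟩ := H.exists_dilation (inv_mem hx) (inv_ne_zero hx0)
  have key : ∀ {b b' c c' : K}, b ∈ adjoin ℂ {x} → x * b = c → MapsShear x y Φ b b' →
      MapsShear x y Φ c c' → Φ d b' = r' * c' := by
    rintro b b' _ c' hb rfl h1 h2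
    exact H.mapsShear_dilation dx dy (inv_mem hx) hb (by field_simp) dy' h1 h2 hr'
  have e1 := key (one_mem _) (mul_one x) H.mapsShear_one H.mapsShear_self
  have e2 := key hx (pow_two x).symm H.mapsShear_self H.mapsShear_sq
  rw [map_one] at e1
  have e3 : Φ d x = x := by rw [e2]; linear_combination -x * e1
  have e4 := key hb rfl h1 h2
  obtain ⟨z, hz, h3⟩ := H.exists_mapsShear hb
  obtain rfl := H.mapsShear_unique h3 h1
  rw [AlgEquiv.eq_of_mem_adjoin e3 hz] at e4
  rw [e4]
  linear_combination c' * e1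

theorem exists_dilation_map {r r' : K} (hr : r ∈ adjoin ℂ {x}) (hr0 : r ≠ 0)
    (h : MapsShear x y Φ r r') :
    ∃ (d : K ≃ₐ[ℂ] K), d x = x ∧ d y = r * y ∧ Φ d x = x ∧ Φ d y = r' * y := by
  have hx := mem_adjoin_simple_self ℂ x
  obtain ⟨d, s, dx, dy, hd, hs, dy'⟩ := H.exists_dilation hr hr0
  have e1 := H.mapsShear_dilation dx dy hr hr (mul_one r) dy' h H.mapsShear_one hs
  obtain ⟨z, hz, h2⟩ := H.exists_mapsShear (mul_mem hx hr)
  have e2 := H.mapsShear_dilation dx dy hr (mul_mem hx hr) (mul_comm r x) dy' h2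
    H.mapsShear_self hs
  rw [H.mapsShear_mul_left hr h h2, map_mul, e1, mul_one, mul_comm s] at e2
  have hs0 : s ≠ 0 := by
    rintro rfl
    rw [zero_mul, map_eq_zero] at dy'
    exact H.coord.right_ne_zero dy'
  have e3 := mul_right_cancel₀ hs0 e2
  obtain ⟨w, hw, h3⟩ := H.exists_mapsShear hr
  obtain rfl := H.mapsShear_unique h3 h
  rw [AlgEquiv.eq_of_mem_adjoin e3 hw, mul_one] at e1
  exact ⟨d, dx, dy, e3, by rw [dy', e1]⟩

theorem mapsShear_same {b : K} (hb : b ∈ adjoin ℂ {x}) : MapsShear x y Φ b b := by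
  induction hb using IntermediateField.adjoin_induction with
  | mem z hz => obtain rfl : z = x := hz; exact H.mapsShear_self
  | algebraMap c => simpa using H.mapsShear_affine 0 c
  | add a b ha hb h1 h2 => exact mapsShear_add hb hb h1 h2
  | inv a ha h1 =>
    by_cases ha0 : a = 0
    · rwa [ha0, inv_zero, ← ha0]
    obtain ⟨d, dx, dy, dx', dy'⟩ := H.exists_dilation_map ha ha0 h1
    obtain ⟨z, hz, h2⟩ := H.exists_mapsShear (inv_mem ha)
    have := H.mapsShear_dilation dx dy ha (one_mem _) (mul_inv_cancel₀ ha0) dy' H.mapsShear_one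
      h2 ha
    rw [map_one] at this
    rwa [eq_inv_of_mul_eq_one_right this.symm] at h2
  | mul a b ha hb h1 h2 =>
    by_cases ha0 : a = 0
    · rwa [ha0, zero_mul, ← ha0]
    obtain ⟨d, dx, dy, dx', dy'⟩ := H.exists_dilation_map ha ha0 h1
    obtain ⟨z, hz, h3⟩ := H.exists_mapsShear (mul_mem ha hb)
    have := H.mapsShear_dilation dx dy ha (mul_mem ha hb) rfl dy' h3 h2 ha
    rw [AlgEquiv.eq_of_mem_adjoin dx' hz] at this
    rwa [this] at h3

theorem map_eq_of_elementary {f : K ≃ₐ[ℂ] K} {r b : K} (hr : r ∈ adjoin ℂ {x}) (hr0 : r ≠ 0)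
    (hb : b ∈ adjoin ℂ {x}) (fx : f x = x) (fy : f y = r * y + b) : Φ f = f := by
  obtain ⟨d, dx, dy, dx', dy'⟩ := H.exists_dilation_map hr hr0 (H.mapsShear_same hr)
  obtain ⟨e, ex, ey, ex', ey'⟩ := H.mapsShear_same (mul_mem (inv_mem hr) hb)
  have hd : Φ d = d := H.coord.algEquiv_ext (dx'.trans dx.symm) (dy'.trans dy.symm)
  have he : Φ e = e := H.coord.algEquiv_ext (ex'.trans ex.symm) (ey'.trans ey.symm)
  have : f = e * d := H.coord.algEquiv_ext (by simp [fx, dx, ex]) (by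
    simp only [AlgEquiv.mul_apply, dy, map_mul, ey, AlgEquiv.eq_of_mem_adjoin ex hr, fy]
    field_simp)
  rw [this, map_mul, hd, he]

end FixesAffine

end Elementary

section Elementary

open IntermediateField

variable {K : Type*} [Field K] [Algebra ℂ K] {x y p q : K}

namespace FixesAffine

variable {Φ : (K ≃ₐ[ℂ] K) ≃* (K ≃ₐ[ℂ] K)} (H : FixesAffine x y Φ)
include H

theorem exists_map_inversion : ∃ (i : K ≃ₐ[ℂ] K) (c : ℂ), i x = x ∧ i y = y⁻¹ ∧ Φ i x = x ∧
    Φ i y * y = algebraMap ℂ K c := by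
  have hx := mem_adjoin_simple_self ℂ x
  have hx0 := H.coord.left_ne_zero
  have hy0 := H.coord.right_ne_zero
  obtain ⟨i, ix, iy⟩ := H.coord.exists_algEquiv H.coord.inv_right
  have key : ∀ {r : K} {d d' : K ≃ₐ[ℂ] K}, r ∈ adjoin ℂ {x} → r ≠ 0 → d x = x → d y = r * y →
      d' x = x → d' y = r⁻¹ * y → Φ i * d = d' * Φ i := by
    intro r d d' hr hr0 dx dy dx' dy'
    refine map_mul_eq_of_fixed
      (H.map_eq_of_elementary hr hr0 (zero_mem _) dx (by rw [dy, add_zero]))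
      (H.map_eq_of_elementary (inv_mem hr) (inv_ne_zero hr0) (zero_mem _) dx'
        (by rw [dy', add_zero])) ?_
    refine H.coord.algEquiv_ext (by simp [dx, dx', ix]) ?_
    simp only [AlgEquiv.mul_apply, dy, iy, map_mul, AlgEquiv.eq_of_mem_adjoin ix hr, map_inv₀, dy']
    field_simp
  obtain ⟨d, dx, dy⟩ := H.coord.exists_elem (IntermediateField.algebraMap_mem _ (2 : ℂ))
    ((map_ne_zero _).2 two_ne_zero) (zero_mem _)
  obtain ⟨d', dx', dy'⟩ := H.coord.exists_elem (IntermediateField.algebraMap_mem _ (2 : ℂ)⁻¹)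
    ((map_ne_zero _).2 (inv_ne_zero two_ne_zero)) (zero_mem _)
  rw [add_zero] at dy dy'
  obtain ⟨-, -, h2⟩ := H.coord.mem_adjoin_of_conj_dilation
    (key (IntermediateField.algebraMap_mem _ (2 : ℂ)) ((map_ne_zero _).2 two_ne_zero) dx dy dx'
      (by rw [dy', map_inv₀])) (inv_ne_zero two_ne_zero)
    (fun n hn => by rw [inv_pow, Ne, inv_eq_one]; exact two_pow_ne_one n hn) dx dy dx' dy'
  have hs := h2 (by rw [inv_inv])
  clear h2 dx dy dx' dy' d d'
  set s := Φ i y * y with hs'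
  have hiy : Φ i y = s * y⁻¹ := by rw [hs', mul_inv_cancel_right₀ hy0]
  have hjx : Φ i x = x := by
    obtain ⟨d, dx, dy⟩ := H.coord.exists_elem hx hx0 (zero_mem _)
    obtain ⟨d', dx', dy'⟩ := H.coord.exists_elem (inv_mem hx) (inv_ne_zero hx0) (zero_mem _)
    rw [add_zero] at dy dy'
    have e := DFunLike.congr_fun (key hx hx0 dx dy dx' dy') y
    simp only [AlgEquiv.mul_apply, dy, map_mul, hiy, AlgEquiv.eq_of_mem_adjoin dx' hs, map_inv₀,
      dy'] at e
    have hs0 : s ≠ 0 := mul_ne_zero ((map_ne_zero _).2 hy0) hy0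
    field_simp at e
    exact e
  obtain ⟨t, ty, tx⟩ := H.coord.symm.exists_elem (one_mem _) one_ne_zero (one_mem _)
  rw [one_mul] at tx
  have ht : Φ t = t := H.fix t ⟨1, 0, 0, 1, 1, 0, by simp [tx], by simp [ty]⟩
  have e := DFunLike.congr_fun (map_mul_eq_of_fixed (f := i) ht ht (H.coord.algEquiv_ext
    (by simp [tx, ix]) (by simp [ty, iy]))) y
  simp only [AlgEquiv.mul_apply, ty, hiy, map_mul, map_inv₀] at e
  have hts := mul_right_cancel₀ (inv_ne_zero hy0) e
  obtain ⟨c, hc⟩ := H.coord.mem_range_of_mem_adjoin hs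
    (H.coord.symm.mem_adjoin_of_translation t ty one_ne_zero (by simpa using tx) hts.symm)
  exact ⟨i, c, ix, iy, hjx, hc.symm⟩

theorem map_inversion {i : K ≃ₐ[ℂ] K} (ix : i x = x) (iy : i y = y⁻¹) : Φ i = i := by
  have hy0 := H.coord.right_ne_zero
  obtain ⟨i', c, ix', iy', jx, jy⟩ := H.exists_map_inversion
  obtain rfl : i' = i := H.coord.algEquiv_ext (ix'.trans ix.symm) (iy'.trans iy.symm)
  obtain ⟨e, ex, ey⟩ := H.coord.exists_elem (one_mem _) one_ne_zero (one_mem _)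
  obtain ⟨m, mx, my⟩ := H.coord.exists_elem (r := -1) (neg_mem (one_mem _))
    (neg_ne_zero.2 one_ne_zero) (zero_mem _)
  have he : Φ e = e := H.map_eq_of_elementary (one_mem _) one_ne_zero (one_mem _) ex ey
  have hm : Φ m = m := H.map_eq_of_elementary (neg_mem (one_mem _)) (neg_ne_zero.2 one_ne_zero)
    (zero_mem _) mx my
  rw [one_mul] at ey
  rw [add_zero, neg_one_mul] at my
  have h3 : (m * i' * e) * ((m * i' * e) * (m * i' * e)) = 1 := by
    refine H.coord.algEquiv_ext (by simp [ex, mx, ix]) ?_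
    set τ := m * i' * e with hτ
    have t1 : τ y * y = y - 1 := by
      simp only [hτ, AlgEquiv.mul_apply, ey, map_add, iy, map_inv₀, my, map_one]
      field_simp
      ring
    have t2 := congrArg τ t1
    have t3 := congrArg τ t2
    simp only [map_mul, map_sub, map_one] at t2 t3
    change τ (τ (τ y)) = y
    have : τ (τ y) ≠ 0 := (map_ne_zero τ).2 ((map_ne_zero τ).2 hy0)
    refine mul_right_cancel₀ this ?_
    rw [t3]
    have : τ y ≠ 0 := (map_ne_zero τ).2 hy0
    refine mul_right_cancel₀ this ?_
    linear_combination (1 - y) * t2 - t1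
  have h4 := congrArg Φ h3
  simp only [map_mul, hm, he, map_one] at h4
  set τ := m * Φ i' * e with hτ
  set s := algebraMap ℂ K c
  have hiy : Φ i' y = s * y⁻¹ := by rw [← jy, mul_inv_cancel_right₀ hy0]
  have t1 : τ y * y = y - s := by
    simp only [hτ, AlgEquiv.mul_apply, ey, map_add, hiy, map_mul, map_inv₀, my, map_one,
      AlgEquiv.commutes, s]
    field_simp
    ring
  have t2 := congrArg τ t1
  have t3 := congrArg τ t2
  simp only [map_mul, map_sub, AlgEquiv.commutes, s] at t2 t3
  have t4 : τ (τ (τ y)) = y := DFunLike.congr_fun h4 y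
  rw [t4] at t3
  have h5 : (1 - s) * (y ^ 2 - y + s) = 0 := by
    linear_combination (1 - y) * y * t2 + y * (τ y) * t3 - (s - 1 + y) * t1
  have h6 : y ^ 2 - y + s ≠ 0 := by
    intro h0
    have h1 := congrArg e h0
    simp only [map_add, map_sub, map_pow, ey, s, AlgEquiv.commutes, map_zero] at h1
    have h2 : algebraMap ℂ K 2 * y = 0 := by rw [map_ofNat]; linear_combination h1 - h0
    exact mul_ne_zero ((map_ne_zero _).2 two_ne_zero) hy0 h2
  have h7 : s = 1 := (sub_eq_zero.1 ((mul_eq_zero.1 h5).resolve_right h6)).symm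
  exact H.coord.algEquiv_ext (jx.trans ix.symm) (by rw [hiy, h7, one_mul, iy])

theorem map_eq (f : K ≃ₐ[ℂ] K) : Φ f = f := by
  have hg : GoodClass fun p q : K => ∃ g : K ≃ₐ[ℂ] K, Φ g = g ∧ g x = p ∧ g y = q := by
    refine ⟨?_, ?_, ?_, ?_⟩
    · rintro p q ⟨g, -, rfl, rfl⟩
      exact H.coord.map g
    · rintro p q ⟨g, hg, rfl, rfl⟩
      obtain ⟨w, wx, wy⟩ := H.coord.exists_algEquiv H.coord.symm
      have hw : Φ w = w := H.fix w ⟨0, 1, 1, 0, 0, 0, by simp [wx], by simp [wy]⟩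
      exact ⟨g * w, by rw [map_mul, hg, hw], by simp [wx], by simp [wy]⟩
    · rintro p q r b ⟨g, hg, rfl, rfl⟩ hr hr0 hb
      have key : ∀ {z : K}, z ∈ adjoin ℂ {g x} → g.symm z ∈ adjoin ℂ {x} := by
        intro z hz
        have := IntermediateField.adjoin_map ℂ {g x} (g.symm : K →ₐ[ℂ] K)
        rw [Set.image_singleton, show (g.symm : K →ₐ[ℂ] K) (g x) = x from g.symm_apply_apply x]
          at this
        exact this ▸ ⟨z, hz, rfl⟩
      have hr1 : g.symm r ≠ 0 := (map_ne_zero _).2 hr0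
      obtain ⟨e, ex, ey⟩ := H.coord.exists_elem (key hr) hr1 (key hb)
      exact ⟨g * e, by rw [map_mul, hg, H.map_eq_of_elementary (key hr) hr1 (key hb) ex ey],
        by simp [ex], by simp [ey]⟩
    · rintro p q ⟨g, hg, rfl, rfl⟩
      obtain ⟨i, ix, iy⟩ := H.coord.exists_algEquiv H.coord.inv_right
      exact ⟨g * i, by rw [map_mul, hg, H.map_inversion ix iy], by simp [ix], by simp [iy]⟩
  obtain ⟨g, hg, gx, gy⟩ := hg.good ⟨1, map_one Φ, rfl, rfl⟩ (H.coord.map f)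
  obtain rfl : g = f := H.coord.algEquiv_ext gx gy
  exact hg

end FixesAffine

end Elementary

section Twist

open IntermediateField

variable {K : Type*} [Field K] [Algebra ℂ K]

/-- The derivation `D` commutes with the automorphism `g`. -/
def Equivariant (D : Derivation ℤ K K) (g : K ≃ₐ[ℂ] K) : Prop := ∀ z, g (D z) = D (g z)

/-- The failure `c⁻¹ D c - D` of the derivation `D` to commute with the automorphism `c`. -/
def twist (D : Derivation ℤ K K) (c : K ≃ₐ[ℂ] K) : Derivation ℤ K K :=
  conjD c.symm.toRingEquiv D - D

variable {D D' : Derivation ℤ K K} {c c' g g' : K ≃ₐ[ℂ] K}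

theorem map_twist (z : K) : c (twist D c z) = D (c z) - c (D z) := by
  change c (c.symm (D (c z)) - D z) = _
  rw [map_sub, AlgEquiv.apply_symm_apply]

theorem twist_eq_zero_iff : twist D c = 0 ↔ Equivariant D c := by
  constructor
  · intro h z
    have := map_twist (D := D) (c := c) z
    rw [h, Derivation.zero_apply, map_zero] at this
    exact (sub_eq_zero.1 this.symm).symm
  · intro h
    ext z
    apply c.injective
    rw [map_twist, h z, sub_self, Derivation.zero_apply, map_zero]

theorem map_twist_mul (z : K) :
    c' (twist D (c * c') z) = twist D c (c' z) + c' (twist D c' z) := by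
  apply c.injective
  rw [map_add, map_twist, ← AlgEquiv.mul_apply, map_twist, map_twist, map_sub]
  simp only [AlgEquiv.mul_apply]
  ring

theorem twist_mul (h : Equivariant (twist D c) c') :
    twist D (c * c') = twist D c + twist D c' := by
  ext z
  apply c'.injective
  rw [map_twist_mul, Derivation.add_apply, map_add, h]

theorem map_twist_conj (hg : Equivariant D g) (h : g * c = c' * g) (z : K) :
    g (twist D c z) = twist D c' (g z) := by
  have h' : ∀ z, g (c z) = c' (g z) := DFunLike.congr_fun h
  apply c'.injective
  rw [← h', map_twist, map_twist, map_sub, hg, h', h', hg]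

theorem Equivariant.twist (hg : Equivariant D g) (h : g * c = c * g) :
    Equivariant (_root_.twist D c) g := map_twist_conj hg h

theorem Equivariant.smul {f : K} (h : Equivariant D g) (hf : g f = f) :
    Equivariant (f • D) g := fun z => by simp [h z, hf]

theorem twist_algebraMap {δ : ℂ → ℂ} (hD : ∀ a, D (algebraMap ℂ K a) = algebraMap ℂ K (δ a))
    (a : ℂ) : twist D c (algebraMap ℂ K a) = 0 := by
  apply c.injective
  rw [map_twist, c.commutes, hD, c.commutes, sub_self, map_zero]

variable {x y : K}

/-- The automorphism `g` of `ℂ(x, y)` is defined over `k`. -/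
def DefinedOver (x y : K) (k : Subfield ℂ) (g : K ≃ₐ[ℂ] K) : Prop :=
  g x ∈ coordField x y k ∧ g y ∈ coordField x y k

theorem DefinedOver.mono {k l : Subfield ℂ} (h : DefinedOver x y k g) (hkl : k ≤ l) :
    DefinedOver x y l g := ⟨coordField_mono hkl h.1, coordField_mono hkl h.2⟩

namespace IsCoord

variable (h : IsCoord x y)

theorem twist_lift_algebraMap (δ : Derivation ℤ ℂ ℂ) (a : ℂ) :
    twist (h.lift δ) c (algebraMap ℂ K a) = 0 :=
  twist_algebraMap (h.lift_algebraMap δ) a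

theorem equivariant_lift {k : Subfield ℂ} (hg : DefinedOver x y k g) {δ : Derivation ℤ ℂ ℂ}
    (hδ : ∀ c ∈ k, δ c = 0) : Equivariant (h.lift δ) g := by
  refine twist_eq_zero_iff.1 (h.derivation_ext (fun a => ?_) ?_ ?_)
  · rw [h.twist_lift_algebraMap, Derivation.zero_apply]
  · apply g.injective
    rw [map_twist, h.lift_eq_zero hδ hg.1, lift_left, map_zero, sub_self, Derivation.zero_apply,
      map_zero]
  · apply g.injective
    rw [map_twist, h.lift_eq_zero hδ hg.2, lift_right, map_zero, sub_self, Derivation.zero_apply,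
      map_zero]

include h in
/-- A countable field of definition. -/
theorem exists_definedOver {k : Subfield ℂ} (hk : (k : Set ℂ).Countable)
    {S : Set (K ≃ₐ[ℂ] K)} (hS : S.Countable) {Z : Set K} (hZ : Z.Countable) :
    ∃ l : Subfield ℂ, (l : Set ℂ).Countable ∧ k ≤ l ∧ (∀ g ∈ S, DefinedOver x y l g) ∧
      Z ⊆ coordField x y l := by
  obtain ⟨l, hl, h1⟩ := h.exists_countable_subset_coordField
    (((hS.image fun g => g x).union (hS.image fun g => g y)).union hZ)
  refine ⟨Subfield.closure (k ∪ l), countable_closure (hk.union hl),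
    fun c hc => Subfield.subset_closure (Or.inl hc), fun g hg => ?_, fun z hz => ?_⟩
  · have hll : l ≤ Subfield.closure (k ∪ l) := fun c hc => Subfield.subset_closure (Or.inr hc)
    exact ⟨coordField_mono hll (h1 (Or.inl (Or.inl ⟨g, hg, rfl⟩))),
      coordField_mono hll (h1 (Or.inl (Or.inr ⟨g, hg, rfl⟩)))⟩
  · exact coordField_mono (fun c hc => Subfield.subset_closure (Or.inr hc)) (h1 (Or.inr hz))

include h in
theorem exists_definedOver_of_countable {S : Set (K ≃ₐ[ℂ] K)} (hS : S.Countable) {Z : Set K}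
    (hZ : Z.Countable) : ∃ l : Subfield ℂ, (l : Set ℂ).Countable ∧
      (∀ g ∈ S, DefinedOver x y l g) ∧ Z ⊆ coordField x y l := by
  obtain ⟨l, h1, -, h2⟩ := h.exists_definedOver (k := Subfield.closure ∅)
    (countable_closure Set.countable_empty) hS hZ
  exact ⟨l, h1, h2⟩

/-- Only countably many automorphisms commute with all lifts of derivations over `k`. -/
theorem exists_twist_ne_zero {k : Subfield ℂ} (hk : (k : Set ℂ).Countable)
    {f : ℂ → K ≃ₐ[ℂ] K} (hf : Function.Injective f) :
    ∃ (a : ℂ) (δ : Derivation ℤ ℂ ℂ), (∀ c ∈ k, δ c = 0) ∧ twist (h.lift δ) (f a) ≠ 0 := by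
  by_contra! H
  have key : ∀ a, f a x ∈ coordField x y (algClos k) ∧ f a y ∈ coordField x y (algClos k) := by
    intro a
    constructor
    · exact h.mem_coordField_algClos fun δ hδ => by
        rw [← twist_eq_zero_iff.1 (H a δ hδ) x, lift_left, map_zero]
    · exact h.mem_coordField_algClos fun δ hδ => by
        rw [← twist_eq_zero_iff.1 (H a δ hδ) y, lift_right, map_zero]
  have hc := countable_coordField (x := x) (y := y) (countable_algClos hk)
  have : Countable (coordField x y (algClos k)) := hc
  have hi : Function.Injective fun a => ((⟨f a x, (key a).1⟩, ⟨f a y, (key a).2⟩) :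
      coordField x y (algClos k) × coordField x y (algClos k)) := by
    intro a b hab
    simp only [Prod.mk.injEq, Subtype.mk.injEq] at hab
    exact hf (h.algEquiv_ext hab.1 hab.2)
  have h2 : Countable ℂ := hi.countable
  exact not_countable_complex (Set.countable_univ_iff.2 h2)

include h in
theorem translate (a b : ℂ) : IsCoord (x + algebraMap ℂ K a) (y + algebraMap ℂ K b) := by
  have h1 := h.affine (one_mem _) one_ne_zero (IntermediateField.algebraMap_mem _ b)
  have h2 := h1.symm.affine (one_mem _) one_ne_zero (IntermediateField.algebraMap_mem _ a)
  simpa using h2.symm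

/-- Translations in the coordinates `x, y`. -/
def trans (a b : ℂ) : K ≃ₐ[ℂ] K := h.equiv (h.translate a b)

@[simp] theorem trans_left (a b : ℂ) : h.trans a b x = x + algebraMap ℂ K a := h.equiv_left _

@[simp] theorem trans_right (a b : ℂ) : h.trans a b y = y + algebraMap ℂ K b := h.equiv_right _

theorem trans_mul (a b c d : ℂ) : h.trans a b * h.trans c d = h.trans (a + c) (b + d) :=
  h.algEquiv_ext (by simp [add_assoc]) (by simp [add_assoc])

theorem trans_commute (a b c d : ℂ) :
    h.trans a b * h.trans c d = h.trans c d * h.trans a b := by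
  rw [trans_mul, trans_mul, add_comm a, add_comm b]

theorem trans_zero : h.trans 0 0 = 1 := h.algEquiv_ext (by simp) (by simp)

theorem trans_injective {a b c d : ℂ} (hab : h.trans a b = h.trans c d) : a = c ∧ b = d := by
  have h1 := DFunLike.congr_fun hab x
  have h2 := DFunLike.congr_fun hab y
  simp only [trans_left, trans_right, add_right_inj] at h1 h2
  exact ⟨(algebraMap ℂ K).injective h1, (algebraMap ℂ K).injective h2⟩

/-- The centralizer of the rational translations consists of translations. -/
theorem exists_eq_trans (hg : ∀ r s : ℚ, g * h.trans r s = h.trans r s * g) :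
    ∃ a b : ℂ, g = h.trans a b := by
  have key : ∀ z, (∀ r s : ℚ, h.trans r s z = z) → z ∈ Set.range (algebraMap ℂ K) := by
    intro z hz
    refine h.mem_range_of_mem_adjoin ?_ ?_
    · refine h.mem_adjoin_of_translation (h.trans 0 1) (by simp) one_ne_zero (by simp) ?_
      simpa using hz 0 1
    · refine h.symm.mem_adjoin_of_translation (h.trans 1 0) (by simp) one_ne_zero (by simp) ?_
      simpa using hz 1 0
  have hg' : ∀ (r s : ℚ) z, g (h.trans r s z) = h.trans r s (g z) := fun r s =>
    DFunLike.congr_fun (hg r s)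
  obtain ⟨a, ha⟩ := key (g x - x) fun r s => by
    rw [map_sub, ← hg', trans_left, map_add, g.commutes]; ring
  obtain ⟨b, hb⟩ := key (g y - y) fun r s => by
    rw [map_sub, ← hg', trans_right, map_add, g.commutes]; ring
  exact ⟨a, b, h.algEquiv_ext (by rw [trans_left, ha]; ring) (by rw [trans_right, hb]; ring)⟩

end IsCoord

end Twist

section Divisible

open IntermediateField

variable {K : Type*} [Field K] [Algebra ℂ K]

theorem iterate_factorial_apply_eq {α : Type*} {f : α → α} (hf : Function.Injective f)
    {R : Finset α} {w : α} (hw : ∀ n : ℕ, f^[n] w ∈ R) : f^[R.card.factorial] w = w := by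
  have h1 : R.card < (Finset.range (R.card + 1)).card := by simp
  obtain ⟨i, hi, j, hj, hij, he⟩ := Finset.exists_ne_map_eq_of_card_lt_of_maps_to h1
    (f := fun n => f^[n] w) (fun n _ => hw n)
  have key : ∀ i j : ℕ, i < j → j < R.card + 1 → f^[i] w = f^[j] w →
      f^[R.card.factorial] w = w := by
    intro i j hij hj he
    obtain ⟨m, rfl⟩ := Nat.exists_eq_add_of_lt hij
    rw [show i + m + 1 = i + (m + 1) by ring, Function.iterate_add_apply] at he
    have h2 : f^[m + 1] w = w := (hf.iterate i he).symm
    obtain ⟨c, hc⟩ := Nat.dvd_factorial (Nat.succ_pos m) (show m + 1 ≤ R.card by omega)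
    rw [hc, Function.iterate_mul]
    exact Function.iterate_fixed h2 c
  rw [Finset.mem_range] at hi hj
  rcases lt_or_gt_of_ne hij with h | h
  · exact key i j h hj he
  · exact key j i h hi he.symm

/-- A divisible group of automorphisms acts trivially on the elements which are algebraic over
its fixed field. -/
theorem apply_eq_of_isAlgebraic {ρ : ℚ → K ≃ₐ[ℂ] K} (hρ : ∀ a b, ρ (a + b) = ρ a * ρ b)
    {Z : Set K} (hZ : ∀ q, ∀ z ∈ Z, ρ q z = z) {w : K} (hw : IsAlgebraic (adjoin ℂ Z) w) (q : ℚ) :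
    ρ q w = w := by
  classical
  obtain ⟨P, hP0, hP⟩ := hw
  let R := (P.aroots K).toFinset
  have hfix : ∀ q, ∀ z ∈ adjoin ℂ Z, ρ q z = z := by
    intro q z hz
    induction hz using IntermediateField.adjoin_induction with
    | mem z hz => exact hZ q z hz
    | algebraMap c => exact (ρ q).commutes c
    | add a b _ _ h1 h2 => rw [map_add, h1, h2]
    | inv a _ h1 => rw [map_inv₀, h1]
    | mul a b _ _ h1 h2 => rw [map_mul, h1, h2]
  have hR : ∀ (q : ℚ) (v : K), v ∈ R → ρ q v ∈ R := by
    intro q v hv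
    simp only [R, Multiset.mem_toFinset, Polynomial.mem_aroots] at hv ⊢
    refine ⟨hP0, ?_⟩
    have := congrArg (ρ q) hv.2
    rw [map_zero, Polynomial.aeval_eq_sum_range, map_sum] at this
    rw [← this, Polynomial.aeval_eq_sum_range]
    refine Finset.sum_congr rfl fun i _ => ?_
    rw [Algebra.smul_def, Algebra.smul_def, map_mul, map_pow]
    congr 1
    exact (hfix q _ (P.coeff i).2).symm
  have hpow : ∀ (q : ℚ) (n : ℕ), ∀ v, ρ (n * q) v = (ρ q)^[n] v := by
    intro q n
    induction n with
    | zero =>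
      intro v
      have h0 : ρ 0 = 1 := by simpa using hρ 0 0
      simp [h0]
    | succ n ih =>
      intro v
      rw [Nat.cast_succ, add_mul, one_mul, hρ, AlgEquiv.mul_apply, ih, Function.iterate_succ_apply]
  have hq : ρ q w = (ρ (q / R.card.factorial))^[R.card.factorial] w := by
    rw [← hpow, mul_div_cancel₀]
    exact_mod_cast Nat.factorial_ne_zero _
  rw [hq]
  refine iterate_factorial_apply_eq (ρ _).injective fun n => ?_
  induction n with
  | zero =>
    simp only [R, Multiset.mem_toFinset, Polynomial.mem_aroots, Function.iterate_zero, id]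
    exact ⟨hP0, hP⟩
  | succ n ih =>
    rw [Function.iterate_succ_apply']
    exact hR _ _ ih

theorem IsCoord.isAlgebraic_adjoin_pair {x y : K} (h : IsCoord x y) {z w : K}
    (hz : Transcendental ℂ z) (hw : Transcendental (adjoin ℂ {z}) w) (v : K) :
    IsAlgebraic (adjoin ℂ {z, w}) v := by
  have h1 : IsTranscendenceBasis ℂ ![x, y] := by
    rw [h.indep.isTranscendenceBasis_iff_isAlgebraic,
      ← IntermediateField.isAlgebraic_adjoin_iff_top, range_pair, h.gen]
    exact ⟨fun z => isAlgebraic_algebraMap (⟨z, trivial⟩ : (⊤ : IntermediateField ℂ K))⟩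
  have hi : AlgebraicIndependent ℂ ![z, w] := by
    have h2 : AlgebraicIndepOn ℂ ![z, w] {0} :=
      (algebraicIndependent_singleton_iff (x := fun i : ({0} : Set (Fin 2)) => ![z, w] i)
        ⟨0, rfl⟩).2 hz
    have h3 := h2.insert (i := 1) (by
      rw [Set.image_singleton]
      exact fun h3 => hw ((IntermediateField.isAlgebraic_adjoin_iff).2 h3))
    exact h3.comp (fun i : Fin 2 => ⟨i, by fin_cases i <;> simp⟩) fun i j hij => by simpa using hij
  have h2 := hi.isTranscendenceBasis_of_lift_trdeg_le_of_finite
    (by rw [← h1.lift_cardinalMk_eq_trdeg])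
  rw [hi.isTranscendenceBasis_iff_isAlgebraic,
      ← IntermediateField.isAlgebraic_adjoin_iff_top, range_pair] at h2
  exact h2.isAlgebraic v

end Divisible

section FixedField

open IntermediateField

variable {K : Type*} [Field K] [Algebra ℂ K] {x y : K}

theorem transcendental_of_notMem_range {z : K} (hz : z ∉ Set.range (algebraMap ℂ K)) :
    Transcendental ℂ z := fun h =>
  hz (minpoly.mem_range_of_degree_eq_one ℂ z
    (IsAlgClosed.degree_eq_one_of_irreducible ℂ (minpoly.irreducible h.isIntegral)))

theorem Equivariant.apply_eq_of_smul {D : Derivation ℤ K K} {g : K ≃ₐ[ℂ] K} {f : K} (hD0 : D ≠ 0)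
    (hD : Equivariant D g) (hfD : Equivariant (f • D) g) : g f = f := by
  obtain ⟨u, hu⟩ : ∃ u, D u ≠ 0 := by
    by_contra! H
    exact hD0 (Derivation.ext H)
  have h1 := hfD u
  simp only [Derivation.smul_apply, smul_eq_mul, map_mul, hD u] at h1
  exact mul_right_cancel₀ (by rwa [← hD u, Ne, map_eq_zero]) h1

namespace IsCoord

variable (h : IsCoord x y)
include h

/-- The partial derivatives of an element of `ℂ(x, y)`. -/
theorem exists_partials (z : K) : ∃ p q : K, (∀ D : Derivation ℤ K K,
    (∀ c : ℂ, D (algebraMap ℂ K c) = 0) → D z = D x * p + D y * q) ∧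
    (p = 0 → q = 0 → z ∈ Set.range (algebraMap ℂ K)) := by
  obtain ⟨P, hPc, hPx, hPy⟩ := h.exists_derivation 0 1 0
  obtain ⟨Q, hQc, hQx, hQy⟩ := h.exists_derivation 0 0 1
  simp only [Derivation.zero_apply, map_zero] at hPc hQc
  refine ⟨P z, Q z, fun D hD => ?_, fun hp hq => ?_⟩
  · have : D = D x • P + D y • Q := h.derivation_ext (fun c => by simp [hD, hPc, hQc])
      (by simp [hPx, hQx]) (by simp [hPy, hQy])
    simpa using DFunLike.congr_fun this z
  · exact h.mem_range_of_mem_adjoin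
      (h.mem_adjoin_of_derivation hQc hQx (by simp [hQy]) hq)
      (h.symm.mem_adjoin_of_derivation hPc hPy (by simp [hPx]) hp)

theorem exists_eq_smul {D D' : Derivation ℤ K K} (hD : ∀ c : ℂ, D (algebraMap ℂ K c) = 0)
    (hD' : ∀ c : ℂ, D' (algebraMap ℂ K c) = 0) (hD0 : D ≠ 0) (hdet : D x * D' y = D y * D' x) :
    ∃ f : K, D' = f • D := by
  by_cases hx : D x = 0
  · have hy : D y ≠ 0 := fun hy => hD0 (h.derivation_ext (by simpa using hD) (by simpa using hx)
      (by simpa using hy))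
    have hx' : D' x = 0 := by
      rw [hx, zero_mul] at hdet
      exact (mul_eq_zero.1 hdet.symm).resolve_left hy
    refine ⟨D' y / D y, h.derivation_ext (fun c => by simp [hD, hD']) (by simp [hx, hx']) ?_⟩
    simp [hy]
  · refine ⟨D' x / D x, h.derivation_ext (fun c => by simp [hD, hD']) (by simp [hx]) ?_⟩
    simp only [Derivation.smul_apply, smul_eq_mul]
    field_simp
    linear_combination hdet

theorem exists_eq_smul_of_apply_eq_zero {z : K} (hz : z ∉ Set.range (algebraMap ℂ K))
    {D D' : Derivation ℤ K K} (hD : ∀ c : ℂ, D (algebraMap ℂ K c) = 0)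
    (hD' : ∀ c : ℂ, D' (algebraMap ℂ K c) = 0) (hD0 : D ≠ 0) (h1 : D z = 0) (h2 : D' z = 0) :
    ∃ f : K, D' = f • D := by
  obtain ⟨p, q, hpq, h0⟩ := h.exists_partials z
  rw [hpq D hD] at h1
  rw [hpq D' hD'] at h2
  refine h.exists_eq_smul hD hD' hD0 ?_
  by_cases hp : p = 0
  · have hq : q ≠ 0 := fun hq => hz (h0 hp hq)
    rw [hp, mul_zero, zero_add] at h1 h2
    rw [(mul_eq_zero.1 h1).resolve_right hq, (mul_eq_zero.1 h2).resolve_right hq]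
    ring
  · refine mul_right_cancel₀ hp ?_
    linear_combination D' y * h1 - D y * h2

theorem apply_eq_of_apply_eq {z ζ : K} (hz : z ∉ Set.range (algebraMap ℂ K))
    {ρ ρ' : ℚ → K ≃ₐ[ℂ] K} (hρ : ∀ a b, ρ (a + b) = ρ a * ρ b)
    (hρ' : ∀ a b, ρ' (a + b) = ρ' a * ρ' b) (hne : ρ 1 ≠ 1) (h1 : ∀ q, ρ q z = z)
    (h2 : ∀ q, ρ' q z = z) (hζ : ∀ q, ρ q ζ = ζ) (q : ℚ) : ρ' q ζ = ζ := by
  by_cases ha : IsAlgebraic (adjoin ℂ {z}) ζ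
  · exact apply_eq_of_isAlgebraic hρ' (by rintro q _ rfl; exact h2 q) ha q
  · refine absurd (AlgEquiv.ext fun w => ?_) hne
    refine apply_eq_of_isAlgebraic hρ (Z := {z, ζ}) ?_
      (h.isAlgebraic_adjoin_pair (transcendental_of_notMem_range hz) ha w) 1
    rintro q _ (rfl | rfl)
    exacts [h1 q, hζ q]

end IsCoord

end FixedField

section FixedByTranslations

variable {K : Type*} [Field K] [Algebra ℂ K] {x y : K}

namespace IsCoord

variable (h : IsCoord x y)

theorem trans_symm (a b : ℂ) : h.symm.trans a b = h.trans b a := h.algEquiv_ext (by simp) (by simp)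

/-- The element `w` is fixed by the images of the rational translations. -/
def FixedByTrans (Φ : (K ≃ₐ[ℂ] K) ≃* (K ≃ₐ[ℂ] K)) (w : K) : Prop :=
  ∀ r s : ℚ, Φ (h.trans r s) w = w

variable {h} {Φ : (K ≃ₐ[ℂ] K) ≃* (K ≃ₐ[ℂ] K)} {z w : K}

theorem fixedByTrans_symm : h.symm.FixedByTrans Φ w ↔ h.FixedByTrans Φ w := by
  constructor
  · intro H r s
    rw [← trans_symm]
    exact H s r
  · intro H r s
    rw [trans_symm]
    exact H s r

theorem fixedByTrans_of_right (hz : z ∉ Set.range (algebraMap ℂ K)) (hzf : h.FixedByTrans Φ z)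
    (hw : ∀ s : ℚ, Φ (h.trans 0 s) w = w) : h.FixedByTrans Φ w := by
  intro r s
  have := h.apply_eq_of_apply_eq hz (ζ := w) (ρ := fun q => Φ (h.trans 0 q))
    (ρ' := fun q => Φ (h.trans ((q * r : ℚ) : ℂ) ((q * s : ℚ) : ℂ)))
    (fun a b => by rw [← map_mul, trans_mul]; simp)
    (fun a b => by rw [← map_mul, trans_mul]; simp [add_mul])
    (fun h1 => by
      rw [← map_one Φ, Φ.injective.eq_iff, ← h.trans_zero] at h1
      simpa using (h.trans_injective h1).2)
    (fun q => by simpa using hzf 0 q) (fun q => hzf _ _) hw 1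
  simpa using this

theorem FixedByTrans.map (hw : h.FixedByTrans Φ w) (hz : z ∉ Set.range (algebraMap ℂ K))
    (hzf : h.FixedByTrans Φ z) {g : K ≃ₐ[ℂ] K} (hg : ∀ s : ℚ, Commute g (h.trans 0 s)) :
    h.FixedByTrans Φ (Φ g w) := by
  refine fixedByTrans_of_right hz hzf fun s => ?_
  have h0 : Φ (h.trans 0 s) w = w := by simpa using hw 0 s
  rw [← AlgEquiv.mul_apply, ← map_mul, ← (hg s).eq, map_mul, AlgEquiv.mul_apply, h0]

theorem FixedByTrans.apply_eq (hw : h.FixedByTrans Φ w) (hz : z ∉ Set.range (algebraMap ℂ K))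
    (hzf : h.FixedByTrans Φ z) {g τ : K ≃ₐ[ℂ] K} (hg : ∀ s : ℚ, Commute g (h.trans 0 s))
    (hτ : h.trans 1 0 * g = τ * (g * h.trans 1 0)) : Φ τ w = w := by
  have h1 : h.FixedByTrans Φ (Φ g⁻¹ w) := hw.map hz hzf fun s => (hg s).inv_left
  have h2 : Φ g (Φ g⁻¹ w) = w := by
    rw [← AlgEquiv.mul_apply, ← map_mul, mul_inv_cancel, map_one, AlgEquiv.one_apply]
  have h3 := DFunLike.congr_fun (congrArg Φ hτ) (Φ g⁻¹ w)
  have h4 : Φ (h.trans 1 0) (Φ g⁻¹ w) = Φ g⁻¹ w := by simpa using h1 1 0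
  have h5 : Φ (h.trans 1 0) w = w := by simpa using hw 1 0
  simp only [map_mul Φ, AlgEquiv.mul_apply, h4, h2, h5] at h3
  exact h3.symm

variable (h) in
include h in
theorem exists_shear {b : K} (hb : b ∈ IntermediateField.adjoin ℂ {x}) :
    ∃ g : K ≃ₐ[ℂ] K, g x = x ∧ g y = y + b := by
  simpa using h.exists_elem (one_mem _) one_ne_zero hb

theorem commute_trans_of_shear {g : K ≃ₐ[ℂ] K} {b : K} (hb : b ∈ IntermediateField.adjoin ℂ {x})
    (hx : g x = x) (hy : g y = y + b) (s : ℂ) : Commute g (h.trans 0 s) := by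
  have hb' : h.trans 0 s b = b := AlgEquiv.eq_of_mem_adjoin (by simp) hb
  exact h.algEquiv_ext (by simp [hx]) (by simp [hy, hb']; ring)

theorem FixedByTrans.trans_right (hw : h.FixedByTrans Φ w)
    (hz : z ∉ Set.range (algebraMap ℂ K)) (hzf : h.FixedByTrans Φ z) (c : ℂ) :
    Φ (h.trans 0 c) w = w := by
  have hb : algebraMap ℂ K c * x ∈ IntermediateField.adjoin ℂ {x} :=
    mul_mem (IntermediateField.algebraMap_mem _ c) (IntermediateField.mem_adjoin_simple_self ℂ x)
  obtain ⟨g, hgx, hgy⟩ := h.exists_shear hb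
  refine hw.apply_eq hz hzf (fun s => commute_trans_of_shear hb hgx hgy s) ?_
  exact h.algEquiv_ext (by simp [hgx]) (by simp [hgy]; ring)

theorem FixedByTrans.trans_left (hw : h.FixedByTrans Φ w)
    (hz : z ∉ Set.range (algebraMap ℂ K)) (hzf : h.FixedByTrans Φ z) (c : ℂ) :
    Φ (h.trans c 0) w = w := by
  rw [← h.trans_symm]
  exact (fixedByTrans_symm.2 hw).trans_right hz (fixedByTrans_symm.2 hzf) c

theorem FixedByTrans.twist_eq_zero (hw : h.FixedByTrans Φ w) {k : Subfield ℂ}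
    (hk : ∀ r s : ℚ, DefinedOver x y k (Φ (h.trans r s))) {δ : Derivation ℤ ℂ ℂ}
    (hδ : ∀ c ∈ k, δ c = 0) {τ : K ≃ₐ[ℂ] K} (hτ : ∀ w, h.FixedByTrans Φ w → Φ τ w = w) :
    twist (h.lift δ) (Φ τ) w = 0 := by
  have h1 : h.FixedByTrans Φ (h.lift δ w) := fun r s => by
    rw [h.equivariant_lift (hk r s) hδ, hw r s]
  apply (Φ τ).injective
  rw [map_twist, hτ w hw, hτ _ h1, sub_self, map_zero]

/-- The images of the rational translations have no common invariants. -/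
theorem FixedByTrans.mem_range (hz : h.FixedByTrans Φ z) : z ∈ Set.range (algebraMap ℂ K) := by
  by_contra hzr
  have hx := IntermediateField.mem_adjoin_simple_self ℂ x
  have hb1 : algebraMap ℂ K (1 / 2) * x ^ 2 ∈ IntermediateField.adjoin ℂ {x} :=
    mul_mem (IntermediateField.algebraMap_mem _ _) (pow_mem hx 2)
  have hb2 : x + algebraMap ℂ K (1 / 2) ∈ IntermediateField.adjoin ℂ {x} :=
    add_mem hx (IntermediateField.algebraMap_mem _ _)
  have hhalf : algebraMap ℂ K (1 / 2) * 2 = 1 := by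
    rw [← map_ofNat (algebraMap ℂ K) 2, ← map_mul]
    simp
  obtain ⟨g, hgx, hgy⟩ := h.exists_shear hb1
  obtain ⟨ε, hεx, hεy⟩ := h.exists_shear hb2
  have hε : ∀ w, h.FixedByTrans Φ w → Φ ε w = w := fun w hw =>
    hw.apply_eq hzr hz (fun s => commute_trans_of_shear hb1 hgx hgy s)
      (h.algEquiv_ext (by simp [hgx, hεx]) (by
        simp only [AlgEquiv.mul_apply, hgy, map_add, map_mul, map_pow, AlgEquiv.commutes,
          IsCoord.trans_left, IsCoord.trans_right, hεx, hεy, map_one, map_zero]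
        linear_combination x * hhalf))
  obtain ⟨k, hkc, hk, -⟩ := h.exists_definedOver_of_countable
    (S := insert (Φ ε) (Set.range fun p : ℚ × ℚ => Φ (h.trans p.1 p.2)))
    ((Set.countable_range _).insert _) Set.countable_empty
  have hkΦ : ∀ r s : ℚ, DefinedOver x y k (Φ (h.trans r s)) := fun r s =>
    hk _ (Or.inr ⟨(r, s), rfl⟩)
  obtain ⟨s, δ, hδ, hne⟩ := h.exists_twist_ne_zero hkc (f := fun s => Φ (h.trans 0 s))
    (Φ.injective.comp fun a b hab => (h.trans_injective hab).2)
  have hE : Equivariant (h.lift δ) (Φ ε) := h.equivariant_lift (hk _ (Or.inl rfl)) hδ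
  obtain ⟨f, hf⟩ := h.exists_eq_smul_of_apply_eq_zero hzr (h.twist_lift_algebraMap δ)
    (h.twist_lift_algebraMap (c := Φ (h.trans s 0)) δ) hne
    (hz.twist_eq_zero hkΦ hδ fun w hw => hw.trans_right hzr hz s)
    (hz.twist_eq_zero hkΦ hδ fun w hw => hw.trans_left hzr hz s)
  have hcomm : ∀ (r r' : ℚ) (a b : ℂ), Φ (h.trans r r') * Φ (h.trans a b) =
      Φ (h.trans a b) * Φ (h.trans r r') := fun r r' a b => by
    rw [← map_mul, ← map_mul, h.trans_commute]
  have hfL : h.FixedByTrans Φ f := fun r r' => by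
    refine Equivariant.apply_eq_of_smul hne
      ((h.equivariant_lift (hkΦ r r') hδ).twist (hcomm r r' 0 s)) ?_
    rw [← hf]
    exact (h.equivariant_lift (hkΦ r r') hδ).twist (hcomm r r' s 0)
  have hE1 : Equivariant (twist (h.lift δ) (Φ (h.trans s 0))) (Φ ε) := by
    rw [hf]
    refine Equivariant.smul (hE.twist ?_) (hε f hfL)
    rw [← map_mul, ← map_mul, (commute_trans_of_shear hb2 hεx hεy s).eq]
  have hrel : h.trans s 0 * ε = h.trans 0 s * (ε * h.trans s 0) :=
    h.algEquiv_ext (by simp [hεx]) (by simp [hεy]; ring)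
  replace hrel := congrArg Φ hrel
  simp only [map_mul Φ] at hrel
  have h1 : twist (h.lift δ) (Φ (h.trans s 0) * Φ ε) = twist (h.lift δ) (Φ (h.trans s 0)) := by
    rw [twist_mul hE1, twist_eq_zero_iff.2 hE, add_zero]
  have h2 : ∀ w, twist (h.lift δ) (Φ ε * Φ (h.trans s 0)) w =
      twist (h.lift δ) (Φ (h.trans s 0)) w := fun w => by
    apply (Φ (h.trans s 0)).injective
    rw [map_twist_mul, twist_eq_zero_iff.2 hE, Derivation.zero_apply, zero_add]
  refine hne (Derivation.ext fun w => ?_)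
  have h3 := map_twist_mul (D := h.lift δ) (c := Φ (h.trans 0 s))
    (c' := Φ ε * Φ (h.trans s 0)) ((Φ ε * Φ (h.trans s 0)).symm w)
  rw [← hrel, h1, h2, AlgEquiv.apply_symm_apply] at h3
  simpa using h3

end IsCoord

end FixedByTranslations

section Frame

variable {K : Type*} [Field K] [Algebra ℂ K] {x y : K}

theorem Equivariant.add {D D' : Derivation ℤ K K} {g : K ≃ₐ[ℂ] K} (h : Equivariant D g)
    (h' : Equivariant D' g) : Equivariant (D + D') g := fun z => by simp [h z, h' z]

namespace IsCoord

variable (h : IsCoord x y)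

include h in
theorem scale_isCoord (μ ν : ℂˣ) :
    IsCoord (algebraMap ℂ K μ * x) (algebraMap ℂ K ν * y) := by
  have h1 := h.affine (IntermediateField.algebraMap_mem _ (ν : ℂ))
    ((_root_.map_ne_zero _).2 ν.ne_zero) (zero_mem _)
  have h2 := h1.symm.affine (IntermediateField.algebraMap_mem _ (μ : ℂ))
    ((_root_.map_ne_zero _).2 μ.ne_zero) (zero_mem _)
  simpa using h2.symm

/-- The diagonal linear map `(x, y) ↦ (μ x, ν y)`. -/
def scale (μ ν : ℂˣ) : K ≃ₐ[ℂ] K := h.equiv (h.scale_isCoord μ ν)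

/-- The involution exchanging the coordinates. -/
def swap : K ≃ₐ[ℂ] K := h.equiv h.symm

@[simp] theorem scale_left (μ ν : ℂˣ) : h.scale μ ν x = algebraMap ℂ K μ * x := h.equiv_left _

@[simp] theorem scale_right (μ ν : ℂˣ) : h.scale μ ν y = algebraMap ℂ K ν * y := h.equiv_right _

@[simp] theorem swap_left : h.swap x = y := h.equiv_left _

@[simp] theorem swap_right : h.swap y = x := h.equiv_right _

theorem scale_mul_trans (μ ν : ℂˣ) (a b : ℂ) :
    h.scale μ ν * h.trans (μ * a) (ν * b) = h.trans a b * h.scale μ ν :=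
  h.algEquiv_ext (by simp; ring) (by simp; ring)

theorem swap_mul_trans (a b : ℂ) : h.swap * h.trans a b = h.trans b a * h.swap :=
  h.algEquiv_ext (by simp) (by simp)

theorem scale_commute (μ ν μ' ν' : ℂˣ) :
    h.scale μ ν * h.scale μ' ν' = h.scale μ' ν' * h.scale μ ν :=
  h.algEquiv_ext (by simp; ring) (by simp; ring)

theorem scale_mul_swap (μ : ℂˣ) : h.scale μ μ * h.swap = h.swap * h.scale μ μ :=
  h.algEquiv_ext (by simp) (by simp)

/-- The dilation `(x, y) ↦ (2 x, y)`. -/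
def double : K ≃ₐ[ℂ] K := h.scale (Units.mk0 2 two_ne_zero) 1

theorem double_mul_trans (a b : ℂ) : h.double * h.trans (2 * a) b = h.trans a b * h.double := by
  simpa [double] using h.scale_mul_trans (Units.mk0 2 two_ne_zero) 1 a b

variable {Φ : (K ≃ₐ[ℂ] K) ≃* (K ≃ₐ[ℂ] K)} {D D' D₁ D₂ : Derivation ℤ K K}

include h in
theorem eq_add_of_det_ne_zero (h₁ : ∀ c : ℂ, D₁ (algebraMap ℂ K c) = 0)
    (h₂ : ∀ c : ℂ, D₂ (algebraMap ℂ K c) = 0) (hD : ∀ c : ℂ, D (algebraMap ℂ K c) = 0)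
    (hdet : D₁ x * D₂ y - D₁ y * D₂ x ≠ 0) : ∃ e e' : K, D = e • D₁ + e' • D₂ := by
  refine ⟨(D x * D₂ y - D y * D₂ x) / (D₁ x * D₂ y - D₁ y * D₂ x),
    (D₁ x * D y - D₁ y * D x) / (D₁ x * D₂ y - D₁ y * D₂ x),
    h.derivation_ext (fun c => by simp [h₁, h₂, hD]) ?_ ?_⟩
  all_goals
    rw [Derivation.add_apply, Derivation.smul_apply, Derivation.smul_apply, smul_eq_mul,
      smul_eq_mul, div_mul_eq_mul_div, div_mul_eq_mul_div, ← add_div, eq_div_iff hdet]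
    ring

omit [Algebra ℂ K] in
theorem eq_zero_of_det_ne_zero {a b c d e e' : K} (hdet : a * d - b * c ≠ 0)
    (h1 : e * a + e' * c = 0) (h2 : e * b + e' * d = 0) : e = 0 ∧ e' = 0 := by
  constructor
  · refine (mul_eq_zero.1 (?_ : e * (a * d - b * c) = 0)).resolve_right hdet
    linear_combination d * h1 - c * h2
  · refine (mul_eq_zero.1 (?_ : e' * (a * d - b * c) = 0)).resolve_right hdet
    linear_combination a * h2 - b * h1

theorem mem_range_of_equivariant_smul {f : K} (hD0 : D ≠ 0)
    (hD : ∀ r s : ℚ, Equivariant D (Φ (h.trans r s)))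
    (hfD : ∀ r s : ℚ, Equivariant (f • D) (Φ (h.trans r s))) :
    f ∈ Set.range (algebraMap ℂ K) :=
  FixedByTrans.mem_range (h := h) (Φ := Φ)
    fun r s => Equivariant.apply_eq_of_smul hD0 (hD r s) (hfD r s)

theorem eq_add_of_equivariant (h₁ : ∀ c : ℂ, D₁ (algebraMap ℂ K c) = 0)
    (h₂ : ∀ c : ℂ, D₂ (algebraMap ℂ K c) = 0) (hD : ∀ c : ℂ, D (algebraMap ℂ K c) = 0)
    (hdet : D₁ x * D₂ y - D₁ y * D₂ x ≠ 0)
    (h₁' : ∀ r s : ℚ, Equivariant D₁ (Φ (h.trans r s)))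
    (h₂' : ∀ r s : ℚ, Equivariant D₂ (Φ (h.trans r s)))
    (hD' : ∀ r s : ℚ, Equivariant D (Φ (h.trans r s))) :
    ∃ e e' : ℂ, D = algebraMap ℂ K e • D₁ + algebraMap ℂ K e' • D₂ := by
  obtain ⟨e, e', he⟩ := h.eq_add_of_det_ne_zero h₁ h₂ hD hdet
  have key : ∀ r s : ℚ, Φ (h.trans r s) e = e ∧ Φ (h.trans r s) e' = e' := by
    intro r s
    set g := Φ (h.trans r s)
    have hz : ∀ z, (g e - e) * g (D₁ z) + (g e' - e') * g (D₂ z) = 0 := fun z => by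
      have h3 := hD' r s z
      rw [he] at h3
      simp only [Derivation.add_apply, Derivation.smul_apply, smul_eq_mul, map_add, map_mul,
        ← h₁' r s z, ← h₂' r s z] at h3
      linear_combination h3
    have hdet' : g (D₁ x) * g (D₂ y) - g (D₁ y) * g (D₂ x) ≠ 0 := by
      rw [← map_mul, ← map_mul, ← map_sub]
      exact (_root_.map_ne_zero g).2 hdet
    have h4 := eq_zero_of_det_ne_zero hdet' (hz x) (hz y)
    exact ⟨sub_eq_zero.1 h4.1, sub_eq_zero.1 h4.2⟩
  obtain ⟨a, ha⟩ := FixedByTrans.mem_range (h := h) (Φ := Φ) fun r s => (key r s).1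
  obtain ⟨b, hb⟩ := FixedByTrans.mem_range (h := h) (Φ := Φ) fun r s => (key r s).2
  exact ⟨a, b, by rw [ha, hb, he]⟩

variable (Φ) in
/-- The images of the translations commute with the twists of derivations over `k`. -/
structure Adapted (k : Subfield ℂ) : Prop where
  countable : (k : Set ℂ).Countable
  definedOver_trans : ∀ r s : ℚ, DefinedOver x y k (Φ (h.trans r s))
  definedOver_double : DefinedOver x y k (Φ h.double)
  definedOver_swap : DefinedOver x y k (Φ h.swap)
  equivariant : ∀ δ : Derivation ℤ ℂ ℂ, (∀ c ∈ k, δ c = 0) → ∀ a b a' b',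
    Equivariant (twist (h.lift δ) (Φ (h.trans a b))) (Φ (h.trans a' b'))

variable {h}

theorem Adapted.mono {k l : Subfield ℂ} (H : h.Adapted Φ k) (hl : (l : Set ℂ).Countable)
    (hkl : k ≤ l) : h.Adapted Φ l where
  countable := hl
  definedOver_trans r s := (H.definedOver_trans r s).mono hkl
  definedOver_double := H.definedOver_double.mono hkl
  definedOver_swap := H.definedOver_swap.mono hkl
  equivariant δ hδ := H.equivariant δ fun c hc => hδ c (hkl hc)

theorem equivariant_twist_trans {k : Subfield ℂ} {δ : Derivation ℤ ℂ ℂ} (hδ : ∀ c ∈ k, δ c = 0)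
    {a b a' b' : ℂ} (hk : DefinedOver x y k (Φ (h.trans a' b'))) :
    Equivariant (twist (h.lift δ) (Φ (h.trans a b))) (Φ (h.trans a' b')) :=
  (h.equivariant_lift hk hδ).twist (by rw [← map_mul, ← map_mul, h.trans_commute])

variable (h Φ) in
theorem exists_adapted : ∃ k, h.Adapted Φ k := by
  obtain ⟨k₀, hk₀, hk, -⟩ := h.exists_definedOver_of_countable
    (S := insert (Φ h.double) (insert (Φ h.swap)
      (Set.range fun p : ℚ × ℚ => Φ (h.trans p.1 p.2))))
    (((Set.countable_range _).insert _).insert _) Set.countable_empty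
  have hkt : ∀ r s : ℚ, DefinedOver x y k₀ (Φ (h.trans r s)) := fun r s =>
    hk _ (Or.inr (Or.inr ⟨(r, s), rfl⟩))
  have hkd : DefinedOver x y k₀ (Φ h.double) := hk _ (Or.inl rfl)
  have hkw : DefinedOver x y k₀ (Φ h.swap) := hk _ (Or.inr (Or.inl rfl))
  let S : Subfield ℂ → Set (Derivation ℤ K K) := fun k =>
    {D | ∃ (δ : Derivation ℤ ℂ ℂ) (a b : ℂ), (∀ c ∈ k, δ c = 0) ∧
      D = twist (h.lift δ) (Φ (h.trans a b))}
  have hSm : ∀ {k l : Subfield ℂ}, k ≤ l → S l ⊆ S k := by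
    rintro k l hkl D ⟨δ, a, b, hδ, rfl⟩
    exact ⟨δ, a, b, fun c hc => hδ c (hkl hc), rfl⟩
  have hSc : ∀ {k : Subfield ℂ} {D}, D ∈ S k → ∀ c : ℂ, D (algebraMap ℂ K c) = 0 := by
    rintro k D ⟨δ, a, b, hδ, rfl⟩
    exact h.twist_lift_algebraMap δ
  have hSe : ∀ {k : Subfield ℂ} {D}, D ∈ S k → ∀ {a b}, DefinedOver x y k (Φ (h.trans a b)) →
      Equivariant D (Φ (h.trans a b)) := by
    rintro k D ⟨δ, a, b, hδ, rfl⟩ a' b' hk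
    exact equivariant_twist_trans hδ hk
  by_cases hcase : ∃ k : Subfield ℂ, (k : Set ℂ).Countable ∧ k₀ ≤ k ∧
      ∀ D ∈ S k, ∀ D' ∈ S k, D x * D' y = D y * D' x
  · obtain ⟨k, hkc, hkk, hdet⟩ := hcase
    refine ⟨k, hkc, fun r s => (hkt r s).mono hkk, hkd.mono hkk, hkw.mono hkk, ?_⟩
    intro δ hδ a b a' b'
    set D := twist (h.lift δ) (Φ (h.trans a b)) with hDdef
    have hDS : D ∈ S k := ⟨δ, a, b, hδ, rfl⟩
    obtain ⟨l, hlc, hkl, hl, -⟩ := h.exists_definedOver hkc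
      (Set.countable_singleton (Φ (h.trans a' b'))) Set.countable_empty
    obtain ⟨s, δ', hδ', hne⟩ := h.exists_twist_ne_zero hlc (f := fun s => Φ (h.trans 0 s))
      (Φ.injective.comp fun a b hab => (h.trans_injective hab).2)
    have hD'S : twist (h.lift δ') (Φ (h.trans 0 s)) ∈ S l := ⟨δ', 0, s, hδ', rfl⟩
    obtain ⟨f, hf⟩ := h.exists_eq_smul (hSc hD'S) (hSc hDS) hne (hdet _ (hSm hkl hD'S) _ hDS)
    obtain ⟨c, rfl⟩ := h.mem_range_of_equivariant_smul (Φ := Φ) hne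
      (fun r s => hSe (hSm (hkk.trans hkl) hD'S) (hkt r s))
      (fun r s => by rw [← hf]; exact hSe (hSm hkk hDS) (hkt r s))
    rw [hf]
    exact (hSe hD'S (hl _ rfl)).smul (AlgEquiv.commutes _ _)
  · push Not at hcase
    refine ⟨k₀, hk₀, hkt, hkd, hkw, ?_⟩
    intro δ hδ a b a' b'
    set D := twist (h.lift δ) (Φ (h.trans a b)) with hDdef
    have hDS : D ∈ S k₀ := ⟨δ, a, b, hδ, rfl⟩
    obtain ⟨l, hlc, hkl, hl, -⟩ := h.exists_definedOver hk₀
      (Set.countable_singleton (Φ (h.trans a' b'))) Set.countable_empty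
    obtain ⟨D₁, h₁, D₂, h₂, hne⟩ := hcase l hlc hkl
    obtain ⟨e, e', he⟩ := h.eq_add_of_equivariant (Φ := Φ) (hSc h₁) (hSc h₂) (hSc hDS)
      (sub_ne_zero.2 hne) (fun r s => hSe (hSm hkl h₁) (hkt r s))
      (fun r s => hSe (hSm hkl h₂) (hkt r s)) (fun r s => hSe hDS (hkt r s))
    rw [he]
    exact ((hSe h₁ (hl _ rfl)).smul (AlgEquiv.commutes _ _)).add
      ((hSe h₂ (hl _ rfl)).smul (AlgEquiv.commutes _ _))

end IsCoord

end Frame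

section Frame

variable {K : Type*} [Field K] [Algebra ℂ K] {x y : K}

namespace IsCoord

variable (h : IsCoord x y) {Φ : (K ≃ₐ[ℂ] K) ≃* (K ≃ₐ[ℂ] K)} {D D₁ D₂ : Derivation ℤ K K}

variable (Φ D₁ D₂) in
/-- Two independent derivations commuting with the images of the translations. -/
structure Frame : Prop where
  alg₁ : ∀ c : ℂ, D₁ (algebraMap ℂ K c) = 0
  alg₂ : ∀ c : ℂ, D₂ (algebraMap ℂ K c) = 0
  equivariant₁ : ∀ a b, Equivariant D₁ (Φ (h.trans a b))
  equivariant₂ : ∀ a b, Equivariant D₂ (Φ (h.trans a b))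
  double₁ : ∀ z, D₁ (Φ h.double z) = 2 * Φ h.double (D₁ z)
  double₂ : ∀ z, D₂ (Φ h.double z) = Φ h.double (D₂ z)
  swap₁ : ∀ z, Φ h.swap (D₁ z) = D₂ (Φ h.swap z)
  swap₂ : ∀ z, Φ h.swap (D₂ z) = D₁ (Φ h.swap z)
  det_ne_zero : D₁ x * D₂ y - D₁ y * D₂ x ≠ 0

variable {h} {k : Subfield ℂ} {δ : Derivation ℤ ℂ ℂ}

theorem Adapted.twist_add (H : h.Adapted Φ k) (hδ : ∀ c ∈ k, δ c = 0) (a b a' b' : ℂ) :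
    twist (h.lift δ) (Φ (h.trans (a + a') (b + b'))) =
      twist (h.lift δ) (Φ (h.trans a b)) + twist (h.lift δ) (Φ (h.trans a' b')) := by
  rw [← h.trans_mul, map_mul, twist_mul (H.equivariant δ hδ a b a' b')]

theorem Adapted.double_twist (H : h.Adapted Φ k) (hδ : ∀ c ∈ k, δ c = 0) (a b : ℂ) (z : K) :
    Φ h.double (twist (h.lift δ) (Φ (h.trans (2 * a) b)) z) =
      twist (h.lift δ) (Φ (h.trans a b)) (Φ h.double z) :=
  map_twist_conj (h.equivariant_lift H.definedOver_double hδ)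
    (by rw [← map_mul, ← map_mul, h.double_mul_trans]) z

theorem Adapted.double_twist_left (H : h.Adapted Φ k) (hδ : ∀ c ∈ k, δ c = 0) (a : ℂ) (z : K) :
    twist (h.lift δ) (Φ (h.trans a 0)) (Φ h.double z) =
      2 * Φ h.double (twist (h.lift δ) (Φ (h.trans a 0)) z) := by
  have h1 := H.twist_add hδ a 0 a 0
  rw [add_zero, ← two_mul] at h1
  rw [← H.double_twist hδ, h1, Derivation.add_apply, map_add, two_mul]

theorem Adapted.swap_twist (H : h.Adapted Φ k) (hδ : ∀ c ∈ k, δ c = 0) (a b : ℂ) (z : K) :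
    Φ h.swap (twist (h.lift δ) (Φ (h.trans a b)) z) =
      twist (h.lift δ) (Φ (h.trans b a)) (Φ h.swap z) :=
  map_twist_conj (h.equivariant_lift H.definedOver_swap hδ)
    (by rw [← map_mul, ← map_mul, h.swap_mul_trans]) z

theorem Adapted.exists_frame (H : h.Adapted Φ k) : ∃ D₁ D₂, h.Frame Φ D₁ D₂ := by
  obtain ⟨s, δ, hδ, hne⟩ := h.exists_twist_ne_zero H.countable (f := fun s => Φ (h.trans s 0))
    (Φ.injective.comp fun a b hab => (h.trans_injective hab).1)
  have hd₂ : ∀ z, twist (h.lift δ) (Φ (h.trans 0 s)) (Φ h.double z) =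
      Φ h.double (twist (h.lift δ) (Φ (h.trans 0 s)) z) := fun z => by
    rw [← H.double_twist hδ 0 s, mul_zero]
  refine ⟨twist (h.lift δ) (Φ (h.trans s 0)), twist (h.lift δ) (Φ (h.trans 0 s)),
    h.twist_lift_algebraMap δ, h.twist_lift_algebraMap δ, H.equivariant δ hδ s 0,
    H.equivariant δ hδ 0 s, H.double_twist_left hδ s, hd₂, H.swap_twist hδ s 0,
    H.swap_twist hδ 0 s, fun hdet => hne ?_⟩
  obtain ⟨f, hf⟩ := h.exists_eq_smul (h.twist_lift_algebraMap δ)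
    (h.twist_lift_algebraMap (c := Φ (h.trans 0 s)) δ) hne (sub_eq_zero.1 hdet)
  obtain ⟨c, rfl⟩ := h.mem_range_of_equivariant_smul (Φ := Φ) hne
    (fun r r' => H.equivariant δ hδ s 0 _ _)
    (fun r r' => by rw [← hf]; exact H.equivariant δ hδ 0 s _ _)
  ext z
  apply (Φ h.swap).injective
  rw [H.swap_twist hδ, Derivation.zero_apply, map_zero]
  generalize Φ h.swap z = v
  apply (Φ h.double).injective
  have h1 := hd₂ v
  rw [hf] at h1 ⊢
  simp only [Derivation.smul_apply, smul_eq_mul, H.double_twist_left hδ, map_mul,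
    AlgEquiv.commutes, map_zero] at h1 ⊢
  linear_combination h1

namespace Frame

variable (F : h.Frame Φ D₁ D₂)
include F

theorem eq_zero_of_add_eq_zero {e e' : K} (he : ∀ z, e * D₁ z + e' * D₂ z = 0) :
    e = 0 ∧ e' = 0 :=
  eq_zero_of_det_ne_zero F.det_ne_zero (he x) (he y)

theorem exists_eq_smul (hD : ∀ c : ℂ, D (algebraMap ℂ K c) = 0)
    (hD' : ∀ r s : ℚ, Equivariant D (Φ (h.trans r s)))
    (hd : ∀ z, D (Φ h.double z) = 2 * Φ h.double (D z)) :
    ∃ e : ℂ, ∀ z, D z = algebraMap ℂ K e * D₁ z := by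
  obtain ⟨e, e', he⟩ := h.eq_add_of_equivariant F.alg₁ F.alg₂ hD F.det_ne_zero
    (fun r s => F.equivariant₁ r s) (fun r s => F.equivariant₂ r s) hD'
  have h1 : ∀ z, 0 * D₁ z + algebraMap ℂ K e' * D₂ z = 0 := fun z => by
    apply (Φ h.double).injective
    have h2 := hd z
    rw [he] at h2
    simp only [Derivation.add_apply, Derivation.smul_apply, smul_eq_mul, F.double₁, F.double₂,
      map_add, map_mul, AlgEquiv.commutes, map_zero] at h2 ⊢
    linear_combination -h2
  refine ⟨e, fun z => ?_⟩
  rw [he, (F.eq_zero_of_add_eq_zero h1).2]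
  simp [Algebra.smul_def]

theorem commute (z : K) : D₁ (D₂ z) = D₂ (D₁ z) := by
  obtain ⟨e, he⟩ := F.exists_eq_smul (D := ⁅D₁, D₂⁆)
    (fun c => by simp [Derivation.commutator_apply, F.alg₁, F.alg₂])
    (fun r s z => by
      simp only [Derivation.commutator_apply, map_sub]
      rw [F.equivariant₁, F.equivariant₂, F.equivariant₂, F.equivariant₁])
    (fun z => by
      have h2 : ∀ D : Derivation ℤ K K, D 2 = 0 := fun D => by
        exact_mod_cast D.map_natCast 2
      simp only [Derivation.commutator_apply, map_sub, F.double₁, F.double₂, Derivation.leibniz,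
        smul_eq_mul, h2]
      ring)
  have h1 : ∀ z, algebraMap ℂ K e * D₁ z + algebraMap ℂ K e * D₂ z = 0 := fun z => by
    have h2 := congrArg (Φ h.swap) (he ((Φ h.swap).symm z))
    have h3 := he z
    simp only [Derivation.commutator_apply, map_sub, map_mul, F.swap₁, F.swap₂,
      AlgEquiv.commutes, AlgEquiv.apply_symm_apply] at h2 h3
    linear_combination -h2 - h3
  have h4 := he z
  rw [(F.eq_zero_of_add_eq_zero h1).1, zero_mul, Derivation.commutator_apply] at h4
  exact sub_eq_zero.1 h4

theorem exists_character (μ : ℂˣ) : ∃ c : ℂ, c ≠ 0 ∧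
    (∀ z, Φ (h.scale μ μ) (D₁ z) = algebraMap ℂ K c * D₁ (Φ (h.scale μ μ) z)) ∧
    ∀ z, Φ (h.scale μ μ) (D₂ z) = algebraMap ℂ K c * D₂ (Φ (h.scale μ μ) z) := by
  set B := Φ (h.scale μ μ) with hB
  have hs : ∀ a b z, Φ (h.trans a b) (B z) = B (Φ (h.trans (μ * a) (μ * b)) z) := fun a b z => by
    rw [← AlgEquiv.mul_apply, ← AlgEquiv.mul_apply, hB, ← map_mul, ← map_mul, h.scale_mul_trans]
  have hsi : ∀ a b z, B.symm (Φ (h.trans a b) z) = Φ (h.trans (μ * a) (μ * b)) (B.symm z) := by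
    intro a b z
    rw [AlgEquiv.symm_apply_eq, ← hs, AlgEquiv.apply_symm_apply]
  have hd : ∀ z, Φ h.double (B z) = B (Φ h.double z) := fun z => by
    rw [← AlgEquiv.mul_apply, ← AlgEquiv.mul_apply, hB, ← map_mul, ← map_mul]
    rw [double, h.scale_commute]
  have hdi : ∀ z, B.symm (Φ h.double z) = Φ h.double (B.symm z) := fun z => by
    rw [AlgEquiv.symm_apply_eq, ← hd, AlgEquiv.apply_symm_apply]
  have hw : ∀ z, Φ h.swap (B z) = B (Φ h.swap z) := fun z => by
    rw [← AlgEquiv.mul_apply, ← AlgEquiv.mul_apply, hB, ← map_mul, ← map_mul, h.scale_mul_swap]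
  obtain ⟨c, hc⟩ := F.exists_eq_smul (D := conjD B.toRingEquiv D₁)
    (fun c => by
      change B (D₁ (B.symm _)) = 0
      rw [AlgEquiv.commutes, F.alg₁, map_zero])
    (fun r s z => by
      change Φ _ (B (D₁ (B.symm _))) = B (D₁ (B.symm _))
      rw [hs, F.equivariant₁, hsi])
    (fun z => by
      change B (D₁ (B.symm _)) = 2 * Φ _ (B (D₁ (B.symm _)))
      rw [hdi, F.double₁, map_mul, map_ofNat, hd])
  have hc' : ∀ z, B (D₁ z) = algebraMap ℂ K c * D₁ (B z) := fun z => by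
    rw [← hc]
    change _ = B (D₁ (B.symm (B z)))
    rw [AlgEquiv.symm_apply_apply]
  refine ⟨c, ?_, hc', fun z => ?_⟩
  · rintro rfl
    have h1 : ∀ z, 1 * D₁ z + 0 * D₂ z = 0 := fun z => by
      apply B.injective
      simp [hc']
    exact one_ne_zero (F.eq_zero_of_add_eq_zero h1).1
  · apply (Φ h.swap).injective
    rw [hw, F.swap₂, hc', map_mul, AlgEquiv.commutes, F.swap₂, hw]

theorem eq_of_character (H : h.Adapted Φ k) {μ ν : ℂˣ} {c : ℂ} (hc : c ≠ 0)
    (hμ : ∀ z, Φ (h.scale μ μ) (D₁ z) = algebraMap ℂ K c * D₁ (Φ (h.scale μ μ) z))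
    (hν : ∀ z, Φ (h.scale ν ν) (D₁ z) = algebraMap ℂ K c * D₁ (Φ (h.scale ν ν) z)) : μ = ν := by
  by_contra hne
  obtain ⟨l, hlc, hkl, hl, -⟩ := h.exists_definedOver H.countable (Set.Countable.insert
    (Φ (h.scale μ μ)) (Set.countable_singleton (Φ (h.scale ν ν)))) Set.countable_empty
  replace H := H.mono hlc hkl
  have hsub : ((μ : ℂ) - ν) ≠ 0 := sub_ne_zero.2 (Units.val_injective.ne hne)
  obtain ⟨a, δ, hδ, hne⟩ := h.exists_twist_ne_zero hlc
    (f := fun a => Φ (h.trans (((μ : ℂ) - ν) * a) 0))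
    (Φ.injective.comp fun a b hab => mul_left_cancel₀ hsub (h.trans_injective hab).1)
  obtain ⟨e, he⟩ := F.exists_eq_smul (D := twist (h.lift δ) (Φ (h.trans a 0)))
    (h.twist_lift_algebraMap δ) (fun r s => H.equivariant δ hδ _ _ _ _)
    (H.double_twist_left hδ a)
  have key : ∀ τ : ℂˣ, DefinedOver x y l (Φ (h.scale τ τ)) →
      (∀ z, Φ (h.scale τ τ) (D₁ z) = algebraMap ℂ K c * D₁ (Φ (h.scale τ τ) z)) →
      ∀ z, twist (h.lift δ) (Φ (h.trans (τ * a) 0)) z = algebraMap ℂ K (e / c) * D₁ z := by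
    intro τ hτ hτ' z
    apply (Φ (h.scale τ τ)).injective
    rw [map_twist_conj (c' := Φ (h.trans a 0)) (h.equivariant_lift hτ hδ)
      (by
        have := h.scale_mul_trans τ τ a 0
        rw [mul_zero] at this
        rw [← map_mul, ← map_mul, this]), he, map_mul, AlgEquiv.commutes, hτ', ← mul_assoc,
      ← map_mul, div_mul_cancel₀ _ hc]
  refine hne (Derivation.ext fun z => ?_)
  have h1 := H.twist_add hδ ((μ - ν) * a) 0 (ν * a) 0
  rw [← add_mul, sub_add_cancel, add_zero] at h1
  have h2 := DFunLike.congr_fun h1 z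
  rw [Derivation.add_apply, key μ (hl _ (by simp)) hμ, key ν (hl _ (by simp)) hν] at h2
  simpa using h2

theorem exists_character_notMem (H : h.Adapted Φ k) {l : Subfield ℂ}
    (hl : (l : Set ℂ).Countable) : ∃ μ : ℂˣ, ∃ c : ℂ, c ∉ algClos l ∧
    (∀ z, Φ (h.scale μ μ) (D₁ z) = algebraMap ℂ K c * D₁ (Φ (h.scale μ μ) z)) ∧
    ∀ z, Φ (h.scale μ μ) (D₂ z) = algebraMap ℂ K c * D₂ (Φ (h.scale μ μ) z) := by
  choose χ h0 h1 h2 using F.exists_character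
  by_contra! hcon
  have h3 : ∀ μ, χ μ ∈ algClos l := fun μ => by
    by_contra h4
    obtain ⟨z, hz⟩ := hcon μ _ h4 (h1 μ)
    exact hz (h2 μ z)
  have : Countable (algClos l) := countable_algClos hl
  have hi : Function.Injective fun μ => (⟨χ μ, h3 μ⟩ : algClos l) := by
    intro μ ν hμν
    have h4 : χ μ = χ ν := congrArg Subtype.val hμν
    exact F.eq_of_character H (h0 μ) (h1 μ) (by rw [h4]; exact h1 ν)
  have h5 : Countable ℂˣ := hi.countable
  refine not_countable_complex (Set.Countable.mono (s₂ := insert 0 (Set.range Units.val)) ?_ ?_)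
  · intro c _
    by_cases hc : c = 0
    · exact Or.inl hc
    · exact Or.inr ⟨Units.mk0 c hc, rfl⟩
  · exact (Set.countable_range _).insert _

theorem mem_range {z : K} (h1 : D₁ z = 0) (h2 : D₂ z = 0) : z ∈ Set.range (algebraMap ℂ K) := by
  obtain ⟨p, q, hpq, h0⟩ := h.exists_partials z
  rw [hpq _ F.alg₁] at h1
  rw [hpq _ F.alg₂] at h2
  have hdet : D₁ x * D₂ y - D₂ x * D₁ y ≠ 0 := fun h3 =>
    F.det_ne_zero (by linear_combination h3)
  have := eq_zero_of_det_ne_zero (e := p) (e' := q) hdet (by linear_combination h1)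
    (by linear_combination h2)
  exact h0 this.1 this.2

/-- Coordinates dual to the frame. -/
theorem exists_dual (H : h.Adapted Φ k) : ∃ u₁ u₂ : K,
    D₁ u₁ = 1 ∧ D₁ u₂ = 0 ∧ D₂ u₁ = 0 ∧ D₂ u₂ = 1 := by
  obtain ⟨l, hlc, -, -, hl⟩ := h.exists_definedOver H.countable Set.countable_empty
    (Z := {D₁ x, D₁ y, D₂ x, D₂ y}) (Set.toFinite _).countable
  obtain ⟨μ, c, hc, hμ₁, hμ₂⟩ := F.exists_character_notMem H hlc
  obtain ⟨δ, hδ, hδc⟩ := exists_derivation_ne_zero (k := l) (ξ := c)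
    (fun h0 => hc (mem_algClos.2 h0))
  set B := Φ (h.scale μ μ)
  have hcomm : ∀ D : Derivation ℤ K K, (∀ c : ℂ, D (algebraMap ℂ K c) = 0) →
      D x ∈ coordField x y l → D y ∈ coordField x y l → ∀ z, h.lift δ (D z) = D (h.lift δ z) := by
    intro D hD hx hy z
    have : ⁅h.lift δ, D⁆ = 0 := h.derivation_ext
      (fun c => by simp [Derivation.commutator_apply, hD])
      (by simp [Derivation.commutator_apply, h.lift_eq_zero hδ hx])
      (by simp [Derivation.commutator_apply, h.lift_eq_zero hδ hy])
    have h1 := DFunLike.congr_fun this z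
    rw [Derivation.commutator_apply, Derivation.zero_apply] at h1
    exact sub_eq_zero.1 h1
  have hcomm₁ := hcomm D₁ F.alg₁ (hl (by simp)) (hl (by simp))
  have hcomm₂ := hcomm D₂ F.alg₂ (hl (by simp)) (hl (by simp))
  set E := twist (h.lift δ) B with hE
  have hBE : ∀ z, B (E z) = h.lift δ (B z) - B (h.lift δ z) := fun z => map_twist z
  have hc0 : c ≠ 0 := by
    rintro rfl
    exact hδc δ.map_zero
  have hcK : algebraMap ℂ K (δ c / c) * algebraMap ℂ K c = algebraMap ℂ K (δ c) := by
    rw [← map_mul, div_mul_cancel₀ _ hc0]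
  have hlie : ∀ D : Derivation ℤ K K, (∀ z, h.lift δ (D z) = D (h.lift δ z)) →
      (∀ z, B (D z) = algebraMap ℂ K c * D (B z)) →
      ∀ z, E (D z) - D (E z) = algebraMap ℂ K (δ c / c) * D z := by
    intro D hD hDB z
    apply B.injective
    rw [map_sub, hBE, hDB (E z), hBE, hD, map_sub, hDB, hDB, map_mul B, AlgEquiv.commutes, hDB,
      Derivation.leibniz, ← hD, lift_algebraMap]
    simp only [smul_eq_mul]
    linear_combination -D (B z) * hcK
  obtain ⟨e₁, e₂, he⟩ := h.eq_add_of_det_ne_zero F.alg₁ F.alg₂ (h.twist_lift_algebraMap δ)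
    F.det_ne_zero (D := E)
  have hE' : ∀ z, E z = e₁ * D₁ z + e₂ * D₂ z := fun z => by rw [he]; simp
  set ν := algebraMap ℂ K (δ c / c) with hν
  have hν0 : ν ≠ 0 := (_root_.map_ne_zero _).2 (div_ne_zero hδc hc0)
  have h₁ : ∀ z, (D₁ e₁ + ν) * D₁ z + D₁ e₂ * D₂ z = 0 := fun z => by
    have h1 := hlie D₁ hcomm₁ hμ₁ z
    rw [hE', hE', map_add, Derivation.leibniz, Derivation.leibniz, F.commute] at h1
    simp only [smul_eq_mul] at h1
    linear_combination -h1
  have h₂ : ∀ z, D₂ e₁ * D₁ z + (D₂ e₂ + ν) * D₂ z = 0 := fun z => by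
    have h1 := hlie D₂ hcomm₂ hμ₂ z
    rw [hE', hE', map_add, Derivation.leibniz, Derivation.leibniz, F.commute] at h1
    simp only [smul_eq_mul] at h1
    linear_combination -h1
  obtain ⟨a₁, a₂⟩ := F.eq_zero_of_add_eq_zero h₁
  obtain ⟨b₁, b₂⟩ := F.eq_zero_of_add_eq_zero h₂
  have hν' : -ν⁻¹ = algebraMap ℂ K (-(δ c / c)⁻¹) := by rw [map_neg, map_inv₀]
  have hd : ∀ D : Derivation ℤ K K, (∀ c : ℂ, D (algebraMap ℂ K c) = 0) → ∀ e,
      D (-ν⁻¹ * e) = -ν⁻¹ * D e := fun D hD e => by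
    rw [Derivation.leibniz, hν', hD]
    simp
  refine ⟨-ν⁻¹ * e₁, -ν⁻¹ * e₂, ?_, ?_, ?_, ?_⟩
  · rw [hd D₁ F.alg₁, eq_neg_of_add_eq_zero_left a₁, neg_mul_neg, inv_mul_cancel₀ hν0]
  · rw [hd D₁ F.alg₁, a₂, mul_zero]
  · rw [hd D₂ F.alg₂, b₁, mul_zero]
  · rw [hd D₂ F.alg₂, eq_neg_of_add_eq_zero_left b₂, neg_mul_neg, inv_mul_cancel₀ hν0]

end Frame

end IsCoord

end Frame

section Cocycle

theorem transcendental_of_derivation_ne_zero {F E : Type*} [Field F] [Field E] [Algebra F E]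
    [CharZero F] {D : Derivation ℤ E E} (hD : ∀ c : F, D (algebraMap F E c) = 0) {t : E}
    (ht : D t ≠ 0) : Transcendental F t := by
  intro h
  have key : ∀ R : Polynomial F,
      D (Polynomial.aeval t R) = Polynomial.aeval t (Polynomial.derivative R) * D t := by
    intro R
    induction R using Polynomial.induction_on' with
    | add p q hp hq => simp [hp, hq, add_mul]
    | monomial n a =>
      simp [Polynomial.aeval_monomial, Polynomial.derivative_monomial, Derivation.leibniz,
        Derivation.leibniz_pow, hD]
      ring
  have h1 := key (minpoly F t)
  rw [minpoly.aeval, map_zero, eq_comm, mul_eq_zero, or_iff_left ht] at h1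
  exact (minpoly.irreducible h.isIntegral).separable.aeval_derivative_ne_zero
    (minpoly.aeval F t) h1

variable {K : Type*} [Field K] [Algebra ℂ K] {x y : K}

/-- Conjugation by a semilinear automorphism. -/
def semiConj (θ : K ≃+* K) (κ : ℂ ≃+* ℂ)
    (hθ : ∀ c, θ (algebraMap ℂ K c) = algebraMap ℂ K (κ c)) :
    (K ≃ₐ[ℂ] K) ≃* (K ≃ₐ[ℂ] K) where
  toFun g := AlgEquiv.ofRingEquiv (f := θ.symm.trans (g.toRingEquiv.trans θ)) fun c => by
    have : θ.symm (algebraMap ℂ K c) = algebraMap ℂ K (κ.symm c) := by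
      rw [RingEquiv.symm_apply_eq, hθ, RingEquiv.apply_symm_apply]
    simp [this, hθ]
  invFun g := AlgEquiv.ofRingEquiv (f := θ.trans (g.toRingEquiv.trans θ.symm)) fun c => by
    have : θ.symm (algebraMap ℂ K (κ c)) = algebraMap ℂ K c := by
      rw [RingEquiv.symm_apply_eq, hθ]
    simp [this, hθ]
  left_inv g := by ext z; simp
  right_inv g := by ext z; simp
  map_mul' f g := by ext z; simp

@[simp] theorem semiConj_apply {θ : K ≃+* K} {κ : ℂ ≃+* ℂ}
    (hθ : ∀ c, θ (algebraMap ℂ K c) = algebraMap ℂ K (κ c)) (g : K ≃ₐ[ℂ] K) (z : K) :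
    semiConj θ κ hθ g z = θ (g (θ.symm z)) := rfl

namespace IsCoord

variable (h : IsCoord x y) {Φ : (K ≃ₐ[ℂ] K) ≃* (K ≃ₐ[ℂ] K)} {D₁ D₂ : Derivation ℤ K K}

variable (Φ D₁ D₂) in
/-- Coordinates dual to a frame, translated by the images of the translations. -/
structure DualFrame (u₁ u₂ : K) (γ₁ γ₂ : ℂ →+ ℂ) : Prop extends h.Frame Φ D₁ D₂ where
  one₁ : D₁ u₁ = 1
  zero₁ : D₁ u₂ = 0
  zero₂ : D₂ u₁ = 0
  one₂ : D₂ u₂ = 1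
  trans₁ : ∀ a b, Φ (h.trans a b) u₁ = u₁ + algebraMap ℂ K (γ₁ a)
  trans₂ : ∀ a b, Φ (h.trans a b) u₂ = u₂ + algebraMap ℂ K (γ₂ b)

variable {h} {k : Subfield ℂ}

theorem Frame.exists_trans_apply (F : h.Frame Φ D₁ D₂) {u : K}
    (h1 : D₁ u ∈ Set.range (algebraMap ℂ K)) (h2 : D₂ u ∈ Set.range (algebraMap ℂ K)) (a b : ℂ) :
    ∃ c, Φ (h.trans a b) u = u + algebraMap ℂ K c := by
  obtain ⟨c₁, h1⟩ := h1
  obtain ⟨c₂, h2⟩ := h2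
  obtain ⟨c, hc⟩ := F.mem_range (z := Φ (h.trans a b) u - u)
    (by rw [map_sub, ← F.equivariant₁, ← h1, AlgEquiv.commutes, sub_self])
    (by rw [map_sub, ← F.equivariant₂, ← h2, AlgEquiv.commutes, sub_self])
  exact ⟨c, by rw [hc]; ring⟩

theorem Frame.exists_dualFrame (F : h.Frame Φ D₁ D₂) (H : h.Adapted Φ k) :
    ∃ u₁ u₂ γ₁ γ₂, h.DualFrame Φ D₁ D₂ u₁ u₂ γ₁ γ₂ := by
  obtain ⟨u₁, u₂, h11, h12, h21, h22⟩ := F.exists_dual H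
  have m0 : (0 : K) ∈ Set.range (algebraMap ℂ K) := ⟨0, map_zero _⟩
  have m1 : (1 : K) ∈ Set.range (algebraMap ℂ K) := ⟨1, map_one _⟩
  have inj := (algebraMap ℂ K).injective
  choose c₁ hc₁ using F.exists_trans_apply (u := u₁) (h11 ▸ m1) (h21 ▸ m0)
  choose c₂ hc₂ using F.exists_trans_apply (u := u₂) (h12 ▸ m0) (h22 ▸ m1)
  have add₁ : ∀ a b a' b', c₁ (a + a') (b + b') = c₁ a b + c₁ a' b' := fun a b a' b' => by
    apply inj
    have h1 := hc₁ (a + a') (b + b')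
    rw [← h.trans_mul, map_mul, AlgEquiv.mul_apply, hc₁, map_add, hc₁, AlgEquiv.commutes] at h1
    rw [map_add]
    linear_combination -h1
  have add₂ : ∀ a b a' b', c₂ (a + a') (b + b') = c₂ a b + c₂ a' b' := fun a b a' b' => by
    apply inj
    have h1 := hc₂ (a + a') (b + b')
    rw [← h.trans_mul, map_mul, AlgEquiv.mul_apply, hc₂, map_add, hc₂, AlgEquiv.commutes] at h1
    rw [map_add]
    linear_combination -h1
  have hd : ∀ a b z, Φ h.double (Φ (h.trans (2 * a) b) z) = Φ (h.trans a b) (Φ h.double z) := by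
    intro a b z
    rw [← AlgEquiv.mul_apply, ← AlgEquiv.mul_apply, ← map_mul, ← map_mul, h.double_mul_trans]
  have h2 : ∀ D : Derivation ℤ K K, D 2 = 0 := fun D => by exact_mod_cast D.map_natCast 2
  obtain ⟨e₁, he₁⟩ := F.mem_range (z := Φ h.double u₁ - 2 * u₁)
    (by simp [F.double₁, h11, h2]) (by simp [F.double₂, h21, h2])
  obtain ⟨e₂, he₂⟩ := F.mem_range (z := Φ h.double u₂ - u₂)
    (by simp [F.double₁, h12]) (by simp [F.double₂, h22])
  replace he₁ : Φ h.double u₁ = 2 * u₁ + algebraMap ℂ K e₁ := by rw [he₁]; ring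
  replace he₂ : Φ h.double u₂ = u₂ + algebraMap ℂ K e₂ := by rw [he₂]; ring
  have z₁ : ∀ b, c₁ 0 b = 0 := fun b => by
    apply inj
    have h1 := hd 0 b u₁
    rw [mul_zero, hc₁, map_add, he₁, map_add, map_mul, hc₁, AlgEquiv.commutes, AlgEquiv.commutes,
      map_ofNat] at h1
    rw [map_zero]
    linear_combination -h1
  have z₂ : ∀ a, c₂ a 0 = 0 := fun a => by
    have h1 := hd a 0 u₂
    rw [hc₂, map_add, he₂, map_add, hc₂, AlgEquiv.commutes, AlgEquiv.commutes, add_right_comm] at h1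
    have h3 := inj (add_left_cancel (add_right_cancel h1))
    have h4 := add₂ a 0 a 0
    rw [← two_mul, add_zero] at h4
    linear_combination h3 - h4
  refine ⟨u₁, u₂, AddMonoidHom.mk' (fun a => c₁ a 0) fun a b => by simpa using add₁ a 0 b 0,
    AddMonoidHom.mk' (fun b => c₂ 0 b) fun a b => by simpa using add₂ 0 a 0 b,
    ⟨F, h11, h12, h21, h22, fun a b => ?_, fun a b => ?_⟩⟩
  · have := add₁ a 0 0 b
    simp only [add_zero, zero_add, z₁] at this
    rw [hc₁, this, AddMonoidHom.mk'_apply]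
  · have := add₂ a 0 0 b
    simp only [add_zero, zero_add, z₂] at this
    rw [hc₂, this, AddMonoidHom.mk'_apply]

namespace DualFrame

variable {u₁ u₂ : K} {γ₁ γ₂ : ℂ →+ ℂ} (F : h.DualFrame Φ D₁ D₂ u₁ u₂ γ₁ γ₂)
include F

theorem twist_eq {δ : Derivation ℤ ℂ ℂ} (hδ₁ : h.lift δ u₁ = 0) (hδ₂ : h.lift δ u₂ = 0) (a b : ℂ) :
    twist (h.lift δ) (Φ (h.trans a b)) =
      algebraMap ℂ K (δ (γ₁ a)) • D₁ + algebraMap ℂ K (δ (γ₂ b)) • D₂ := by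
  set g := Φ (h.trans a b) with hg
  obtain ⟨e₁, e₂, he⟩ := h.eq_add_of_det_ne_zero F.alg₁ F.alg₂
    (h.twist_lift_algebraMap (c := g) δ) F.det_ne_zero
  have h1 := map_twist (D := h.lift δ) (c := g) u₁
  have h2 := map_twist (D := h.lift δ) (c := g) u₂
  rw [he, Derivation.add_apply, Derivation.smul_apply, Derivation.smul_apply, F.one₁, F.zero₂,
    smul_zero, add_zero, smul_eq_mul, mul_one, hδ₁, map_zero, sub_zero, hg, F.trans₁, map_add, hδ₁,
    zero_add, lift_algebraMap, ← hg, ← g.commutes] at h1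
  rw [he, Derivation.add_apply, Derivation.smul_apply, Derivation.smul_apply, F.one₂, F.zero₁,
    smul_zero, zero_add, smul_eq_mul, mul_one, hδ₂, map_zero, sub_zero, hg, F.trans₂, map_add, hδ₂,
    zero_add, lift_algebraMap, ← hg, ← g.commutes] at h2
  rw [he, g.injective h1, g.injective h2]

theorem isAlgebraic (v : K) : IsAlgebraic (IntermediateField.adjoin ℂ {u₁, u₂}) v := by
  refine h.isAlgebraic_adjoin_pair (transcendental_of_derivation_ne_zero F.alg₁
    (by rw [F.one₁]; exact one_ne_zero)) (transcendental_of_derivation_ne_zero (D := D₂)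
    (fun c => ?_) (by rw [F.one₂]; exact one_ne_zero)) v
  obtain ⟨z, hz⟩ := c
  change D₂ z = 0
  exact derivation_adjoin_simple_eq_zero hz F.alg₂ F.zero₂

theorem trans_eq_zero {p q : ℂ} (hp : γ₁ p = 0) (hq : γ₂ q = 0) : h.trans p q = 1 := by
  have hγ : ∀ γ : ℂ →+ ℂ, ∀ p : ℂ, γ p = 0 → ∀ t : ℚ, γ (t * p) = 0 := by
    intro γ p hp t
    have := map_rat_smul γ t p
    rwa [Rat.smul_def, hp, smul_zero] at this
  have key : ∀ v, Φ (h.trans p q) v = v := fun v => by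
    have := apply_eq_of_isAlgebraic (ρ := fun t : ℚ => Φ (h.trans (t * p) (t * q)))
      (fun a b => by rw [← map_mul, h.trans_mul]; push_cast; rw [add_mul, add_mul])
      (Z := {u₁, u₂}) (fun t z hz => ?_) (F.isAlgebraic v) 1
    · simpa using this
    · rcases hz with rfl | rfl
      · rw [F.trans₁, hγ _ _ hp, map_zero, add_zero]
      · rw [F.trans₂, hγ _ _ hq, map_zero, add_zero]
  exact Φ.injective ((AlgEquiv.ext key).trans (map_one Φ).symm)

end DualFrame

end IsCoord

end Cocycle

section DualCoord

variable {K : Type*} [Field K] [Algebra ℂ K] {x y : K}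

namespace IsCoord

variable {h : IsCoord x y} {Φ : (K ≃ₐ[ℂ] K) ≃* (K ≃ₐ[ℂ] K)} {D₁ D₂ : Derivation ℤ K K}
  {k : Subfield ℂ} {u₁ u₂ : K} {γ₁ γ₂ : ℂ →+ ℂ}

namespace DualFrame

variable (F : h.DualFrame Φ D₁ D₂ u₁ u₂ γ₁ γ₂)
include F

theorem exists_independent (H : h.Adapted Φ k) (hu₁ : u₁ ∈ coordField x y k)
    (hu₂ : u₂ ∈ coordField x y k) : ∃ (a b : ℂ) (δ₁ δ₂ : Derivation ℤ ℂ ℂ),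
      (∀ c ∈ k, δ₁ c = 0) ∧ (∀ c ∈ k, δ₂ c = 0) ∧ δ₁ (γ₁ a) ≠ 0 ∧ δ₂ (γ₁ a) = 0 ∧
        δ₂ (γ₂ b) ≠ 0 := by
  obtain ⟨a, δ₁, hδ₁, ha⟩ := h.exists_twist_ne_zero H.countable (f := fun a => Φ (h.trans a 0))
    (Φ.injective.comp fun a b hab => (h.trans_injective hab).1)
  set l := Subfield.closure (k ∪ {γ₁ a}) with hl
  have hkl : k ≤ l := fun c hc => Subfield.subset_closure (Or.inl hc)
  obtain ⟨b, δ₂, hδ₂, hb⟩ := h.exists_twist_ne_zero (k := l)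
    (countable_closure (H.countable.union (Set.countable_singleton _)))
    (f := fun b => Φ (h.trans 0 b))
    (Φ.injective.comp fun a b hab => (h.trans_injective hab).2)
  have hδ₂' : ∀ c ∈ k, δ₂ c = 0 := fun c hc => hδ₂ c (hkl hc)
  refine ⟨a, b, δ₁, δ₂, hδ₁, hδ₂', fun h0 => ha ?_,
    hδ₂ _ (Subfield.subset_closure (Or.inr rfl)), fun h0 => hb ?_⟩
  · rw [F.twist_eq (h.lift_eq_zero hδ₁ hu₁) (h.lift_eq_zero hδ₁ hu₂), h0]
    simp
  · rw [F.twist_eq (h.lift_eq_zero hδ₂' hu₁) (h.lift_eq_zero hδ₂' hu₂), h0]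
    simp

theorem definedOver (H : h.Adapted Φ k) (hu₁ : u₁ ∈ coordField x y k)
    (hu₂ : u₂ ∈ coordField x y k) {m : Subfield ℂ} (hkm : k ≤ m) {a b : ℂ} (ha : γ₁ a ∈ m)
    (hb : γ₂ b ∈ m) : DefinedOver x y m (Φ (h.trans a b)) := by
  set g := Φ (h.trans a b) with hg
  have hδ : ∀ δ : Derivation ℤ ℂ ℂ, (∀ c ∈ m, δ c = 0) → Equivariant (h.lift δ) g := by
    intro δ hδ
    have hδk : ∀ c ∈ k, δ c = 0 := fun c hc => hδ c (hkm hc)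
    rw [← twist_eq_zero_iff, F.twist_eq (h.lift_eq_zero hδk hu₁) (h.lift_eq_zero hδk hu₂),
      hδ _ ha, hδ _ hb]
    simp
  have hκ : ∀ κ : ℂ ≃+* ℂ, (∀ c ∈ m, κ c = c) →
      semiConj (h.liftEquiv κ) κ (h.liftEquiv_algebraMap κ) g = g := by
    intro κ hκ
    have hκk : ∀ c ∈ k, κ c = c := fun c hc => hκ c (hkm hc)
    set S := semiConj (h.liftEquiv κ) κ (h.liftEquiv_algebraMap κ) with hS
    have hfix : ∀ f, DefinedOver x y k f → S f = f := fun f hf => h.algEquiv_ext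
      (by
        have : (h.liftEquiv κ).symm x = x := by rw [RingEquiv.symm_apply_eq, liftEquiv_left]
        rw [hS, semiConj_apply, this, h.liftEquiv_eq hκk hf.1])
      (by
        have : (h.liftEquiv κ).symm y = y := by rw [RingEquiv.symm_apply_eq, liftEquiv_right]
        rw [hS, semiConj_apply, this, h.liftEquiv_eq hκk hf.2])
    have hcomm : ∀ r s : ℚ, Φ.symm (S g) * h.trans r s = h.trans r s * Φ.symm (S g) := by
      intro r s
      apply Φ.injective
      rw [map_mul, map_mul, MulEquiv.apply_symm_apply, ← hfix _ (H.definedOver_trans r s),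
        ← map_mul, ← map_mul, hg, ← map_mul, ← map_mul, h.trans_commute]
    obtain ⟨p, q, hpq⟩ := h.exists_eq_trans hcomm
    have hSg : S g = Φ (h.trans p q) := by rw [← hpq, MulEquiv.apply_symm_apply]
    have hu : ∀ u ∈ coordField x y k, ∀ c ∈ m, g u = u + algebraMap ℂ K c →
        S g u = u + algebraMap ℂ K c := by
      intro u hu c hc huc
      have : (h.liftEquiv κ).symm u = u := by
        rw [RingEquiv.symm_apply_eq, h.liftEquiv_eq hκk hu]
      rw [hS, semiConj_apply, this, huc, map_add, h.liftEquiv_eq hκk hu, liftEquiv_algebraMap,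
        hκ c hc]
    have h1 := hu u₁ hu₁ _ ha (F.trans₁ a b)
    have h2 := hu u₂ hu₂ _ hb (F.trans₂ a b)
    rw [hSg, F.trans₁] at h1
    rw [hSg, F.trans₂] at h2
    have h3 := F.trans_eq_zero (p := p - a) (q := q - b)
      (by rw [map_sub, (algebraMap ℂ K).injective (add_left_cancel h1), sub_self])
      (by rw [map_sub, (algebraMap ℂ K).injective (add_left_cancel h2), sub_self])
    have h4 := h.trans_mul (p - a) (q - b) a b
    rw [h3, one_mul, sub_add_cancel, sub_add_cancel] at h4
    rw [hSg, hg, h4]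
  constructor
  · refine h.mem_coordField (fun δ hδm => ?_) fun κ hκm => ?_
    · rw [← hδ δ hδm, lift_left, map_zero]
    · have h1 := DFunLike.congr_fun (hκ κ hκm) x
      have : (h.liftEquiv κ).symm x = x := by rw [RingEquiv.symm_apply_eq, liftEquiv_left]
      rwa [semiConj_apply, this] at h1
  · refine h.mem_coordField (fun δ hδm => ?_) fun κ hκm => ?_
    · rw [← hδ δ hδm, lift_right, map_zero]
    · have h1 := DFunLike.congr_fun (hκ κ hκm) y
      have : (h.liftEquiv κ).symm y = y := by rw [RingEquiv.symm_apply_eq, liftEquiv_right]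
      rwa [semiConj_apply, this] at h1

end DualFrame

end IsCoord

omit [Algebra ℂ K] in
/-- An element killed by two independent derivations which kill the subfield `P`. -/
theorem mem_of_derivation_eq_zero [CharZero K] {P : Subfield K} {D D' : Derivation ℤ K K}
    (hD : ∀ c ∈ P, D c = 0) (hD' : ∀ c ∈ P, D' c = 0) (hdet : D x * D' y - D y * D' x ≠ 0) {z : K}
    (hz : z ∈ Subfield.closure (P ∪ {x, y})) (hDz : D z = 0) (hDz' : D' z = 0) : z ∈ P := by
  set F₁ := IntermediateField.adjoin P {x} with hF₁
  set Ey := D x • D' - D' x • D with hEy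
  set Ex := D' y • D - D y • D' with hEx
  have hEyc : ∀ c : P, Ey (algebraMap P K c) = 0 := fun c => by
    change Ey (c : K) = 0
    simp [hEy, hD c c.2, hD' c c.2]
  have hExc : ∀ c : P, Ex (algebraMap P K c) = 0 := fun c => by
    change Ex (c : K) = 0
    simp [hEx, hD c c.2, hD' c c.2]
  have hEyF : ∀ c : F₁, Ey (algebraMap F₁ K c) = 0 := by
    rintro ⟨c, hc⟩
    change Ey c = 0
    induction hc using IntermediateField.adjoin_induction with
    | mem z hz =>
      rw [Set.mem_singleton_iff.1 hz]
      simp only [hEy, Derivation.sub_apply, Derivation.smul_apply, smul_eq_mul]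
      ring
    | algebraMap c => exact hEyc c
    | add a b _ _ ha hb => rw [map_add, ha, hb, add_zero]
    | inv a _ ha => rw [Derivation.leibniz_inv, ha, smul_zero]
    | mul a b _ _ ha hb => rw [Derivation.leibniz, ha, hb, smul_zero, smul_zero, add_zero]
  have hyy : Ey y ≠ 0 := by
    convert hdet using 1
    simp only [hEy, Derivation.sub_apply, Derivation.smul_apply, smul_eq_mul]
    ring
  have hxx : Ex x ≠ 0 := by
    convert hdet using 1
    simp only [hEx, Derivation.sub_apply, Derivation.smul_apply, smul_eq_mul]
    ring
  have hz1 : z ∈ IntermediateField.adjoin F₁ {y} := by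
    have : Subfield.closure (P ∪ {x, y}) ≤ (IntermediateField.adjoin F₁ {y}).toSubfield := by
      rw [Subfield.closure_le]
      rintro c (hc | rfl | rfl)
      · exact IntermediateField.algebraMap_mem _
          (⟨c, IntermediateField.algebraMap_mem F₁ ⟨c, hc⟩⟩ : F₁)
      · exact IntermediateField.algebraMap_mem _
          (⟨c, IntermediateField.mem_adjoin_simple_self P c⟩ : F₁)
      · exact IntermediateField.mem_adjoin_simple_self F₁ c
    exact this hz
  obtain ⟨⟨z, hz2⟩, rfl⟩ := mem_range_of_derivation_eq_zero
    (transcendental_of_derivation_ne_zero hEyF hyy) hz1 Ey hEyF hyy (by simp [hEy, hDz, hDz'])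
  change D z = 0 at hDz
  change D' z = 0 at hDz'
  obtain ⟨⟨c, hc⟩, rfl⟩ := mem_range_of_derivation_eq_zero
    (transcendental_of_derivation_ne_zero hExc hxx) hz2 Ex hExc hxx (by simp [hEx, hDz, hDz'])
  exact hc

namespace IsCoord

variable {h : IsCoord x y} {Φ : (K ≃ₐ[ℂ] K) ≃* (K ≃ₐ[ℂ] K)} {D₁ D₂ : Derivation ℤ K K}
  {u₁ u₂ : K} {γ₁ γ₂ : ℂ →+ ℂ}

theorem DualFrame.isCoord (F : h.DualFrame Φ D₁ D₂ u₁ u₂ γ₁ γ₂) : IsCoord u₁ u₂ := by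
  obtain ⟨k₀, H₀⟩ := h.exists_adapted Φ
  obtain ⟨k, hk, hk₀, -, hu⟩ := h.exists_definedOver H₀.countable (S := ∅) Set.countable_empty
    (Z := {u₁, u₂}) (Set.toFinite _).countable
  have H := H₀.mono hk hk₀
  have hu₁ : u₁ ∈ coordField x y k := hu (by simp)
  have hu₂ : u₂ ∈ coordField x y k := hu (by simp)
  obtain ⟨a, b, δ₁, δ₂, hδ₁, hδ₂, ha, ha', hb⟩ := F.exists_independent H hu₁ hu₂
  set m := Subfield.closure (k ∪ {γ₁ a, γ₂ b}) with hm
  have hkm : k ≤ m := fun c hc => Subfield.subset_closure (Or.inl hc)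
  have hdef := F.definedOver H hu₁ hu₂ (m := m) hkm (a := a) (b := b)
    (Subfield.subset_closure (by simp)) (Subfield.subset_closure (by simp))
  have ht₁ := F.trans₁ a b
  have ht₂ := F.trans₂ a b
  have heq₁ := F.equivariant₁ a b
  have heq₂ := F.equivariant₂ a b
  set g := Φ (h.trans a b) with hg
  set P := coordField (g u₁) (g u₂) k with hP
  have : CharZero K := charZero_of_injective_algebraMap (algebraMap ℂ K).injective
  have hgen : coordField x y m ≤ Subfield.closure (P ∪ {x, y}) := by
    have hkP : ∀ c ∈ k, algebraMap ℂ K c ∈ Subfield.closure (P ∪ {x, y} : Set K) := fun c hc =>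
      Subfield.subset_closure (Or.inl (algebraMap_mem_coordField hc))
    have hx : x ∈ Subfield.closure (P ∪ {x, y} : Set K) := Subfield.subset_closure (by simp)
    have hy : y ∈ Subfield.closure (P ∪ {x, y} : Set K) := Subfield.subset_closure (by simp)
    have hle : coordField x y k ≤ Subfield.closure (P ∪ {x, y}) := by
      refine Subfield.closure_le.2 ?_
      rintro _ (⟨c, hc, rfl⟩ | rfl | rfl)
      exacts [hkP c hc, hx, hy]
    have hγ : ∀ c, c = γ₁ a ∨ c = γ₂ b → algebraMap ℂ K c ∈ Subfield.closure (P ∪ {x, y}) := by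
      rintro c (rfl | rfl)
      · have : algebraMap ℂ K (γ₁ a) = g u₁ - u₁ := by rw [ht₁]; ring
        rw [this]
        exact sub_mem (Subfield.subset_closure (Or.inl (left_mem_coordField k))) (hle hu₁)
      · have : algebraMap ℂ K (γ₂ b) = g u₂ - u₂ := by rw [ht₂]; ring
        rw [this]
        exact sub_mem (Subfield.subset_closure (Or.inl (right_mem_coordField k))) (hle hu₂)
    have hmle : m ≤ (Subfield.closure (P ∪ {x, y})).comap (algebraMap ℂ K) := by
      refine Subfield.closure_le.2 ?_
      rintro c (hc | hc)
      exacts [hkP c hc, hγ c hc]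
    refine Subfield.closure_le.2 ?_
    rintro _ (⟨c, hc, rfl⟩ | rfl | rfl)
    exacts [hmle hc, hx, hy]
  set E : Derivation ℤ ℂ ℂ → Derivation ℤ K K := fun δ => twist (h.lift δ) g - h.lift δ with hE
  have htw : ∀ δ : Derivation ℤ ℂ ℂ, (∀ c ∈ k, δ c = 0) → twist (h.lift δ) g =
      algebraMap ℂ K (δ (γ₁ a)) • D₁ + algebraMap ℂ K (δ (γ₂ b)) • D₂ := fun δ hδ =>
    F.twist_eq (h.lift_eq_zero hδ hu₁) (h.lift_eq_zero hδ hu₂) a b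
  have hEg : ∀ δ : Derivation ℤ ℂ ℂ, (∀ c ∈ k, δ c = 0) → ∀ z ∈ coordField x y k,
      E δ (g z) = 0 := by
    intro δ hδ z hz
    have h1 := map_twist (D := h.lift δ) (c := g) z
    rw [h.lift_eq_zero hδ hz, map_zero, sub_zero] at h1
    rw [hE, Derivation.sub_apply, ← h1, htw δ hδ]
    simp only [Derivation.add_apply, Derivation.smul_apply, smul_eq_mul, map_add, map_mul g,
      AlgEquiv.commutes, heq₁ z, heq₂ z, sub_self]
  have hEk : ∀ δ : Derivation ℤ ℂ ℂ, (∀ c ∈ k, δ c = 0) → ∀ c ∈ P, E δ c = 0 := by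
    intro δ hδ c hc
    refine derivation_coordField_eq_zero (D := E δ) (fun c hc => ?_) (hEg δ hδ _ hu₁)
      (hEg δ hδ _ hu₂) hc
    rw [← g.commutes]
    exact hEg δ hδ _ (algebraMap_mem_coordField hc)
  have hEx : ∀ δ, E δ x = twist (h.lift δ) g x := fun δ => by simp [hE]
  have hEy : ∀ δ, E δ y = twist (h.lift δ) g y := fun δ => by simp [hE]
  have hdet : E δ₁ x * E δ₂ y - E δ₁ y * E δ₂ x ≠ 0 := by
    rw [hEx, hEx, hEy, hEy, htw δ₁ hδ₁, htw δ₂ hδ₂, ha', map_zero, zero_smul, zero_add]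
    simp only [Derivation.add_apply, Derivation.smul_apply, smul_eq_mul]
    have h1 : algebraMap ℂ K (δ₁ (γ₁ a)) ≠ 0 := (_root_.map_ne_zero _).2 ha
    have h2 : algebraMap ℂ K (δ₂ (γ₂ b)) ≠ 0 := (_root_.map_ne_zero _).2 hb
    convert mul_ne_zero (mul_ne_zero h1 h2) F.det_ne_zero using 1
    ring
  have hmem : ∀ z ∈ coordField x y k, g z ∈ coordField x y m →
      z ∈ IntermediateField.adjoin ℂ {u₁, u₂} := by
    intro z hz hgz
    have h1 : g z ∈ P := mem_of_derivation_eq_zero (hEk δ₁ hδ₁) (hEk δ₂ hδ₂) hdet (hgen hgz)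
      (hEg δ₁ hδ₁ z hz) (hEg δ₂ hδ₂ z hz)
    have h2 : ∀ w ∈ P, g.symm w ∈ IntermediateField.adjoin ℂ {u₁, u₂} := by
      intro w hw
      refine coordField_induction (p := fun w => g.symm w ∈ IntermediateField.adjoin ℂ {u₁, u₂})
        (fun c _ => ?_) ?_ ?_ (fun a b ha hb => ?_) (fun a ha => ?_) (fun a ha => ?_)
        (fun a b ha hb => ?_) hw
      · rw [AlgEquiv.commutes]
        exact IntermediateField.algebraMap_mem _ c
      · rw [AlgEquiv.symm_apply_apply]
        exact IntermediateField.subset_adjoin _ _ (by simp)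
      · rw [AlgEquiv.symm_apply_apply]
        exact IntermediateField.subset_adjoin _ _ (by simp)
      · rw [map_add]; exact add_mem ha hb
      · rw [map_neg]; exact neg_mem ha
      · rw [map_inv₀]; exact inv_mem ha
      · rw [map_mul]; exact mul_mem ha hb
    simpa using h2 _ h1
  exact h.of_mem (hmem x (left_mem_coordField k) hdef.1) (hmem y (right_mem_coordField k) hdef.2)

end IsCoord

end DualCoord

section Normalize

variable {K : Type*} [Field K] [Algebra ℂ K] {x y : K}

/-- The automorphism `Φ` is conjugation by a semilinear automorphism. -/
def IsSemilinear (Φ : (K ≃ₐ[ℂ] K) ≃* (K ≃ₐ[ℂ] K)) : Prop :=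
  ∃ (θ : K ≃+* K) (κ : ℂ ≃+* ℂ) (hθ : ∀ c, θ (algebraMap ℂ K c) = algebraMap ℂ K (κ c)),
    ∀ f, Φ f = semiConj θ κ hθ f

theorem IsSemilinear.of_semiConj {Φ : (K ≃ₐ[ℂ] K) ≃* (K ≃ₐ[ℂ] K)} {θ : K ≃+* K} {κ : ℂ ≃+* ℂ}
    (hθ : ∀ c, θ (algebraMap ℂ K c) = algebraMap ℂ K (κ c))
    (H : IsSemilinear (Φ.trans (semiConj θ κ hθ).symm)) : IsSemilinear Φ := by
  obtain ⟨θ', κ', hθ', H⟩ := H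
  refine ⟨θ'.trans θ, κ'.trans κ, fun c => by simp [hθ', hθ], fun f => ?_⟩
  have h1 := H f
  rw [MulEquiv.trans_apply, MulEquiv.symm_apply_eq] at h1
  rw [h1]
  rfl

namespace IsCoord

variable (h : IsCoord x y) {Φ : (K ≃ₐ[ℂ] K) ≃* (K ≃ₐ[ℂ] K)}

theorem exists_eq_add_of_trans {v : K} (hv : ∀ p q, ∃ c, h.trans p q v = v + algebraMap ℂ K c) :
    ∃ α β : ℂ, ∀ p q, h.trans p q v = v + algebraMap ℂ K (α * p + β * q) := by
  obtain ⟨P, hPc, hPx, hPy⟩ := h.exists_derivation 0 1 0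
  obtain ⟨Q, hQc, hQx, hQy⟩ := h.exists_derivation 0 0 1
  simp only [Derivation.zero_apply, map_zero] at hPc hQc
  have hD : ∀ D : Derivation ℤ K K, (∀ c : ℂ, D (algebraMap ℂ K c) = 0) →
      (∀ p q, h.trans p q (D x) = D x) → (∀ p q, h.trans p q (D y) = D y) →
      D v ∈ Set.range (algebraMap ℂ K) := by
    intro D hD hx hy
    refine FixedByTrans.mem_range (h := h) (Φ := MulEquiv.refl _) fun r s => ?_
    have h1 : Equivariant D (h.trans r s) := by
      refine twist_eq_zero_iff.1 (h.derivation_ext (fun c => ?_) ?_ ?_)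
      · rw [twist_algebraMap (δ := 0) (fun c => by simp [hD]), Derivation.zero_apply]
      · apply (h.trans r s).injective
        rw [map_twist, trans_left, map_add, hD, hx, add_zero, sub_self, Derivation.zero_apply,
          map_zero]
      · apply (h.trans r s).injective
        rw [map_twist, trans_right, map_add, hD, hy, add_zero, sub_self, Derivation.zero_apply,
          map_zero]
    obtain ⟨c, hc⟩ := hv r s
    rw [MulEquiv.refl_apply, h1, hc, map_add, hD, add_zero]
  obtain ⟨α, hα⟩ := hD P hPc (by simp [hPx]) (by simp [hPy])
  obtain ⟨β, hβ⟩ := hD Q hQc (by simp [hQx]) (by simp [hQy])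
  obtain ⟨p, q, hpq, h0⟩ := h.exists_partials (v - algebraMap ℂ K α * x - algebraMap ℂ K β * y)
  obtain ⟨e, he⟩ := h0
    (by
      have h1 := hpq P hPc
      rw [map_sub, map_sub, Derivation.leibniz, Derivation.leibniz, hPc, hPc, hPx, hPy, ← hα] at h1
      simpa using h1.symm)
    (by
      have h1 := hpq Q hQc
      rw [map_sub, map_sub, Derivation.leibniz, Derivation.leibniz, hQc, hQc, hQx, hQy, ← hβ] at h1
      simpa using h1.symm)
  have hv' : v = algebraMap ℂ K α * x + algebraMap ℂ K β * y + algebraMap ℂ K e := by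
    rw [he]; ring
  refine ⟨α, β, fun p q => ?_⟩
  rw [hv']
  simp only [map_add, map_mul, AlgEquiv.commutes, trans_left, trans_right]
  ring

theorem exists_additive (Φ : (K ≃ₐ[ℂ] K) ≃* (K ≃ₐ[ℂ] K)) : ∃ (γ₁ γ₂ : ℂ →+ ℂ) (ψ : K ≃ₐ[ℂ] K),
    ∀ a b, ψ.symm * Φ (h.trans a b) * ψ = h.trans (γ₁ a) (γ₂ b) := by
  obtain ⟨k, H⟩ := h.exists_adapted Φ
  obtain ⟨D₁, D₂, F⟩ := H.exists_frame
  obtain ⟨u₁, u₂, γ₁, γ₂, F⟩ := F.exists_dualFrame H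
  refine ⟨γ₁, γ₂, h.equiv F.isCoord, fun a b => h.algEquiv_ext ?_ ?_⟩
  · rw [AlgEquiv.mul_apply, AlgEquiv.mul_apply, AlgEquiv.symm_apply_eq, trans_left, map_add,
      equiv_left, AlgEquiv.commutes, F.trans₁]
  · rw [AlgEquiv.mul_apply, AlgEquiv.mul_apply, AlgEquiv.symm_apply_eq, trans_right, map_add,
      equiv_right, AlgEquiv.commutes, F.trans₂]

variable {h} {γ₁ γ₂ : ℂ →+ ℂ} (H : ∀ a b, Φ (h.trans a b) = h.trans (γ₁ a) (γ₂ b))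
include H

theorem exists_eq_additive (p q : ℂ) : ∃ a b, γ₁ a = p ∧ γ₂ b = q := by
  obtain ⟨a, b, hab⟩ := h.exists_eq_trans (g := Φ.symm (h.trans p q)) fun r s => by
    apply Φ.injective
    rw [map_mul, map_mul, MulEquiv.apply_symm_apply, H, h.trans_commute]
  rw [MulEquiv.symm_apply_eq, H] at hab
  obtain ⟨h1, h2⟩ := h.trans_injective hab
  exact ⟨a, b, h1.symm, h2.symm⟩

theorem additive_mul (μ a : ℂ) : γ₁ (μ * a) * γ₁ 1 = γ₁ μ * γ₁ a := by
  by_cases hμ : μ = 0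
  · simp [hμ]
  set B := Φ (h.scale (Units.mk0 μ hμ) (Units.mk0 μ hμ)) with hB
  have hs : ∀ a b, h.trans (γ₁ a) (γ₂ b) (B x) = B x + algebraMap ℂ K (γ₁ (μ * a)) := by
    intro a b
    have h1 := h.scale_mul_trans (Units.mk0 μ hμ) (Units.mk0 μ hμ) a b
    have h2 := DFunLike.congr_fun (congrArg Φ h1) x
    rw [map_mul, map_mul, H, H, ← hB, AlgEquiv.mul_apply, AlgEquiv.mul_apply, trans_left, map_add,
      AlgEquiv.commutes] at h2
    exact h2.symm
  obtain ⟨α, β, hαβ⟩ := h.exists_eq_add_of_trans (v := B x) fun p q => by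
    obtain ⟨a, b, rfl, rfl⟩ := exists_eq_additive H p q
    exact ⟨_, hs a b⟩
  have key : ∀ a, γ₁ (μ * a) = α * γ₁ a := fun a => by
    have h1 := hs a 0
    rw [hαβ, map_zero, mul_zero, add_zero] at h1
    exact (algebraMap ℂ K).injective (add_left_cancel h1).symm
  have h1 := key 1
  rw [mul_one] at h1
  rw [key, h1]
  ring

theorem exists_eq_mul : ∃ c : ℂ, ∀ a, γ₂ a = c * γ₁ a := by
  set B := Φ h.swap with hB
  have hs : ∀ a b, h.trans (γ₁ a) (γ₂ b) (B y) = B y + algebraMap ℂ K (γ₂ a) := by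
    intro a b
    have h2 := DFunLike.congr_fun (congrArg Φ (h.swap_mul_trans b a)) y
    rw [map_mul, map_mul, H, H, ← hB, AlgEquiv.mul_apply, AlgEquiv.mul_apply, trans_right, map_add,
      AlgEquiv.commutes] at h2
    exact h2.symm
  obtain ⟨α, β, hαβ⟩ := h.exists_eq_add_of_trans (v := B y) fun p q => by
    obtain ⟨a, b, rfl, rfl⟩ := exists_eq_additive H p q
    exact ⟨_, hs a b⟩
  refine ⟨α, fun a => ?_⟩
  have h1 := hs a 0
  rw [hαβ, map_zero, mul_zero, add_zero] at h1
  exact (algebraMap ℂ K).injective (add_left_cancel h1).symm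

theorem exists_semilinear_normalization : ∃ (σ : K ≃+* K) (κ : ℂ ≃+* ℂ)
    (hσ : ∀ c, σ (algebraMap ℂ K c) = algebraMap ℂ K (κ c)),
    ∀ a b, Φ (h.trans a b) = semiConj σ κ hσ (h.trans a b) := by
  have surj : Function.Surjective γ₁ := fun p => by
    obtain ⟨a, -, ha, -⟩ := exists_eq_additive H p 0
    exact ⟨a, ha⟩
  obtain ⟨c, hc⟩ := exists_eq_mul H
  have hc0 : c ≠ 0 := by
    rintro rfl
    obtain ⟨-, b, -, hb⟩ := exists_eq_additive H 0 1
    simp [hc] at hb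
  have h1 : γ₁ 1 ≠ 0 := fun h0 => by
    obtain ⟨a, ha⟩ := surj 1
    have := additive_mul H a a
    simp [h0, ha] at this
  let κ₀ : ℂ →+* ℂ :=
    { toFun := fun a => γ₁ a / γ₁ 1
      map_zero' := by simp
      map_one' := div_self h1
      map_add' := fun a b => by rw [map_add, add_div]
      map_mul' := fun a b => by
        rw [div_mul_div_comm, div_eq_div_iff h1 (mul_ne_zero h1 h1), ← mul_assoc,
          additive_mul H] }
  let κ : ℂ ≃+* ℂ := RingEquiv.ofBijective κ₀ ⟨κ₀.injective, fun p => by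
    obtain ⟨a, ha⟩ := surj (p * γ₁ 1)
    exact ⟨a, by change γ₁ a / γ₁ 1 = p; rw [ha, mul_div_cancel_right₀ _ h1]⟩⟩
  have hκ : ∀ a, κ a = γ₁ a / γ₁ 1 := fun a => rfl
  obtain ⟨σ, hσ, hx, hy⟩ := h.exists_ringEquiv
    (h.scale_isCoord (Units.mk0 _ h1)⁻¹ (Units.mk0 _ (mul_ne_zero hc0 h1))⁻¹) κ
  simp only [Units.val_inv_eq_inv_val, Units.val_mk0] at hx hy
  refine ⟨σ, κ, hσ, fun a b => h.algEquiv_ext ?_ ?_⟩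
  all_goals rw [H]
  · have hx' : σ.symm x = algebraMap ℂ K (κ.symm (γ₁ 1)) * x := by
      rw [RingEquiv.symm_apply_eq, map_mul, hσ, RingEquiv.apply_symm_apply, hx, ← mul_assoc,
        ← map_mul, mul_inv_cancel₀ h1, map_one, one_mul]
    have : κ (κ.symm (γ₁ 1) * a) = γ₁ a := by
      rw [map_mul, RingEquiv.apply_symm_apply, hκ, mul_div_cancel₀ _ h1]
    rw [semiConj_apply, hx', map_mul, AlgEquiv.commutes, trans_left, trans_left, mul_add, map_add,
      ← hx', RingEquiv.apply_symm_apply, ← map_mul, hσ, this]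
  · have hc1 := mul_ne_zero hc0 h1
    have hy' : σ.symm y = algebraMap ℂ K (κ.symm (c * γ₁ 1)) * y := by
      rw [RingEquiv.symm_apply_eq, map_mul, hσ, RingEquiv.apply_symm_apply, hy, ← mul_assoc,
        ← map_mul, mul_inv_cancel₀ hc1, map_one, one_mul]
    have : κ (κ.symm (c * γ₁ 1) * b) = γ₂ b := by
      rw [map_mul, RingEquiv.apply_symm_apply, hκ, hc, mul_assoc, mul_div_cancel₀ _ h1]
    rw [semiConj_apply, hy', map_mul, AlgEquiv.commutes, trans_right, trans_right, mul_add,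
      map_add, ← hy', RingEquiv.apply_symm_apply, ← map_mul, hσ, this]

end IsCoord

end Normalize

section Main

variable {K : Type*} [Field K] [Algebra ℂ K] {x y : K}

namespace IsCoord

variable {h : IsCoord x y} {Φ : (K ≃ₐ[ℂ] K) ≃* (K ≃ₐ[ℂ] K)}

theorem exists_mul_trans_of_isAffine (H : ∀ a b, Φ (h.trans a b) = h.trans a b)
    {f : K ≃ₐ[ℂ] K} (hf : IsAffine x y f) : ∃ p q, Φ f = f * h.trans p q := by
  obtain ⟨a, b, c, d, e, g, hfx, hfy⟩ := hf
  have key : ∀ r s, h.trans r s * f = f * h.trans (a * r + b * s) (c * r + d * s) := by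
    intro r s
    refine h.algEquiv_ext ?_ ?_
    · simp only [AlgEquiv.mul_apply, hfx, map_add, map_mul, AlgEquiv.commutes, trans_left,
        trans_right]
      ring
    · simp only [AlgEquiv.mul_apply, hfy, map_add, map_mul, AlgEquiv.commutes, trans_left,
        trans_right]
      ring
  obtain ⟨p, q, hpq⟩ := h.exists_eq_trans (g := Φ f * f⁻¹) fun r s => by
    have h1 := congrArg Φ (key r s)
    have h2 : f⁻¹ * h.trans r s = h.trans (a * r + b * s) (c * r + d * s) * f⁻¹ := by
      rw [inv_mul_eq_iff_eq_mul, ← mul_assoc, ← key, mul_inv_cancel_right]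
    rw [map_mul, map_mul, H, H] at h1
    rw [mul_assoc, h2, ← mul_assoc, ← h1, mul_assoc]
  exact ⟨_, _, by rw [← key p q, ← hpq, inv_mul_cancel_right]⟩

theorem apply_eq_of_isAffine (H : ∀ a b, Φ (h.trans a b) = h.trans a b)
    (H2 : Φ (h.scale (Units.mk0 2 two_ne_zero) (Units.mk0 2 two_ne_zero)) =
      h.scale (Units.mk0 2 two_ne_zero) (Units.mk0 2 two_ne_zero))
    {f : K ≃ₐ[ℂ] K} (hf : IsAffine x y f) : Φ f = f := by
  obtain ⟨p, q, hpq⟩ := exists_mul_trans_of_isAffine H hf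
  set s := h.scale (Units.mk0 2 two_ne_zero) (Units.mk0 2 two_ne_zero) with hs
  have hst : s * h.trans (2 * p) (2 * q) = h.trans p q * s := h.scale_mul_trans _ _ p q
  obtain ⟨a, b, c, d, e, g, hfx, hfy⟩ := hf
  have key : f * s = s * f * h.trans e g := by
    refine h.algEquiv_ext ?_ ?_
    · simp only [hs, AlgEquiv.mul_apply, hfx, map_add, map_mul, AlgEquiv.commutes, trans_left,
        scale_left, scale_right, Units.val_mk0, map_ofNat]
      ring
    · simp only [hs, AlgEquiv.mul_apply, hfy, map_add, map_mul, AlgEquiv.commutes, trans_right,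
        scale_left, scale_right, Units.val_mk0, map_ofNat]
      ring
  have h1 := congrArg Φ key
  rw [map_mul, map_mul, map_mul, H2, H, hpq, mul_assoc, ← hst, ← mul_assoc, key, ← mul_assoc,
    mul_assoc, mul_assoc _ (h.trans p q), mul_right_inj, h.trans_mul, h.trans_mul] at h1
  obtain ⟨h2, h3⟩ := h.trans_injective h1
  have hp : p = 0 := by linear_combination h2
  have hq : q = 0 := by linear_combination h3
  rw [hpq, hp, hq, h.trans_zero, mul_one]

theorem isSemilinear_of_trans (H : ∀ a b, Φ (h.trans a b) = h.trans a b) : IsSemilinear Φ := by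
  set s := h.scale (Units.mk0 2 two_ne_zero) (Units.mk0 2 two_ne_zero) with hs
  obtain ⟨p, q, hpq⟩ := exists_mul_trans_of_isAffine H (f := s)
    ⟨2, 0, 0, 2, 0, 0, by simp [hs], by simp [hs]⟩
  have hst : s * h.trans (2 * p) (2 * q) = h.trans p q * s := h.scale_mul_trans _ _ p q
  set τ := h.trans p q with hτ
  have hconj : ∀ f, semiConj τ.toRingEquiv (RingEquiv.refl ℂ) τ.commutes f = τ * f * τ⁻¹ :=
    fun f => rfl
  refine IsSemilinear.of_semiConj (θ := τ.toRingEquiv) (κ := RingEquiv.refl ℂ) τ.commutes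
    ⟨RingEquiv.refl K, RingEquiv.refl ℂ, fun c => rfl, fun f => ?_⟩
  refine FixesAffine.map_eq (x := x) (y := y) ⟨h, fun f hf => ?_⟩ f
  refine apply_eq_of_isAffine (h := h) (fun a b => ?_) ?_ hf
  · rw [MulEquiv.trans_apply, MulEquiv.symm_apply_eq, hconj, H, hτ, h.trans_commute,
      mul_inv_cancel_right]
  · rw [MulEquiv.trans_apply, MulEquiv.symm_apply_eq, hconj, ← hs, hpq, ← hst,
      eq_mul_inv_iff_mul_eq, mul_assoc, h.trans_mul, two_mul, two_mul]

theorem isSemilinear (h : IsCoord x y) (Φ : (K ≃ₐ[ℂ] K) ≃* (K ≃ₐ[ℂ] K)) : IsSemilinear Φ := by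
  obtain ⟨γ₁, γ₂, ψ, hψ⟩ := h.exists_additive Φ
  refine IsSemilinear.of_semiConj (θ := ψ.toRingEquiv) (κ := RingEquiv.refl ℂ) ψ.commutes ?_
  set Φ₁ := Φ.trans (semiConj ψ.toRingEquiv (RingEquiv.refl ℂ) ψ.commutes).symm with hΦ₁
  have H₁ : ∀ a b, Φ₁ (h.trans a b) = h.trans (γ₁ a) (γ₂ b) := hψ
  obtain ⟨σ, κ, hσ, H₂⟩ := exists_semilinear_normalization H₁
  refine IsSemilinear.of_semiConj hσ ?_
  refine isSemilinear_of_trans (h := h) fun a b => ?_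
  rw [MulEquiv.trans_apply, MulEquiv.symm_apply_eq, H₂]

end IsCoord

theorem isCoord_X0_X1 : IsCoord X0 X1 where
  indep := by
    have h1 := (MvPolynomial.algebraicIndependent_X (Fin 2) ℂ).map'
      (f := IsScalarTower.toAlgHom ℂ (MvPolynomial (Fin 2) ℂ) K2)
      (IsFractionRing.injective (MvPolynomial (Fin 2) ℂ) K2)
    have h2 : ![X0, X1] = IsScalarTower.toAlgHom ℂ (MvPolynomial (Fin 2) ℂ) K2 ∘
        MvPolynomial.X := by
      ext i
      fin_cases i <;> rfl
    rw [h2]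
    exact h1
  gen := by
    have key : ∀ p : MvPolynomial (Fin 2) ℂ,
        algebraMap _ K2 p ∈ IntermediateField.adjoin ℂ {X0, X1} := by
      intro p
      induction p using MvPolynomial.induction_on with
      | C a =>
        rw [← MvPolynomial.algebraMap_eq, ← IsScalarTower.algebraMap_apply]
        exact IntermediateField.algebraMap_mem _ a
      | add p q hp hq => rw [map_add]; exact add_mem hp hq
      | mul_X p i hp =>
        rw [map_mul]
        refine mul_mem hp (IntermediateField.subset_adjoin _ _ ?_)
        fin_cases i
        · exact Or.inl rfl
        · exact Or.inr rfl
    refine eq_top_iff.2 fun z _ => ?_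
    obtain ⟨p, q, -, rfl⟩ := IsFractionRing.div_surjective (A := MvPolynomial (Fin 2) ℂ) z
    exact div_mem (key p) (key q)

end Main

/-- **Automorphisms of the plane Cremona group.** Every group automorphism `Φ` of
`Bir(ℙ²_ℂ) = Aut_ℂ(ℂ(x,y))` is inner up to a field automorphism of `ℂ`: there exists a ring
automorphism `θ` of the field `ℂ(x,y)`, mapping the subfield `ℂ` onto itself, such that
`Φ(f) = θ ∘ f ∘ θ⁻¹` for every `f`. -/
theorem aut_of_cremona (Φ : Cremona2 ≃* Cremona2) :
    ∃ θ : K2 ≃+* K2,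
      Set.image (⇑θ) (Set.range (algebraMap ℂ K2)) = Set.range (algebraMap ℂ K2) ∧
      ∀ (f : Cremona2) (z : K2), Φ f z = θ (f (θ.symm z)) := by
  obtain ⟨θ, κ, hθ, H⟩ := isCoord_X0_X1.isSemilinear Φ
  refine ⟨θ, ?_, fun f z => by rw [H, semiConj_apply]⟩
  ext z
  constructor
  · rintro ⟨_, ⟨c, rfl⟩, rfl⟩
    exact ⟨κ c, (hθ c).symm⟩
  · rintro ⟨c, rfl⟩
    exact ⟨_, ⟨κ.symm c, rfl⟩, by rw [hθ, RingEquiv.apply_symm_apply]⟩
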